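/- arXiv:1805.06772 — 2 statements merged into one kernel-verified Lean document; each statement's English description precedes it below -/
import Mathlib

section
/- Let n ≥ 3 and let Aₙ ⊆ ℝ² be the convex hull of the n points (R·cos(2πk/n), R·sin(2πk/n)), k = 0, …, n−1, where R = 1/(2·sin(π/n)) (a regular n-gon with unit side length, of area (n/4)·cot(π/n)). For m ≥ 1, call a family U₁, …, Uₘ of pairwise disjoint sets, each open in the subspace topology of Aₙ and each of two-dimensional Lebesgue measure (n/(4m))·cot(π/n), an m-part equal-area division of Aₙ, and call μH¹((Aₙ \ (U₁ ∪ ⋯ ∪ Uₘ)) ∩ interior Aₙ) its dividing length. Then every m-part equal-area division of Aₙ has dividing length at least (1/2)·(√(m·n·π·cot(π/n)) − n). -/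
open MeasureTheory

section

open MeasureTheory Set Filter Topology

/-- right adjacency -/
def RAdj {E : Type*} [AddCommGroup E] [Module ℝ E] (O : Set E) (v x : E) : Prop :=
  ∃ δ > (0 : ℝ), ∀ t ∈ Ioo (0 : ℝ) δ, x + t • v ∈ O

open Classical in
theorem oneD_interval (O : Set ℝ) (hO : MeasurableSet O) (f : ℝ → ℝ) (hf : ContDiff ℝ 1 f) (F : Finset ℝ) :
    ∀ a b : ℝ, a < b → (∀ x ∈ Ioo a b, x ∈ frontier O → x ∈ F) →
    ∫ x in O ∩ Ioo a b, deriv f x =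
      (if RAdj O (-1) b then f b else 0) - (if RAdj O 1 a then f a else 0)
      + ∑ x ∈ F.filter (fun x => x ∈ Ioo a b),
        ((if RAdj O (-1) x then f x else 0) - (if RAdj O 1 x then f x else 0)) := by
  have hint : ∀ a b : ℝ, IntegrableOn (deriv f) (Ioo a b) := fun a b =>
    ((hf.continuous_deriv le_rfl).integrableOn_Icc (a := a) (b := b)).mono_set Ioo_subset_Icc_self
  induction F using Finset.induction with
  | empty =>
    intro a b hab h
    simp only [Finset.filter_empty, Finset.sum_empty, add_zero]
    have hfr : Ioo a b ⊆ interior O ∪ interior Oᶜ := by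
      intro x hx
      by_contra hcon
      have : x ∈ frontier O := by
        rw [frontier_eq_closure_inter_closure]
        simp only [mem_union, not_or, interior_compl, mem_compl_iff, not_not] at hcon
        refine ⟨hcon.2, ?_⟩
        rw [closure_compl]; exact hcon.1
      simpa using h x hx this
    have hdj : Disjoint (interior O) (interior Oᶜ) :=
      (disjoint_compl_right (a := O)).mono interior_subset interior_subset
    rcases isPreconnected_Ioo.subset_or_subset isOpen_interior isOpen_interior hdj hfr with h1 | h1
    · have h1' : Ioo a b ⊆ O := h1.trans interior_subset
      have hb : RAdj O (-1) b := ⟨b - a, by linarith, fun t ht => h1' (by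
        simp only [smul_eq_mul, mem_Ioo] at ht ⊢; constructor <;> linarith [ht.1, ht.2])⟩
      have ha : RAdj O 1 a := ⟨b - a, by linarith, fun t ht => h1' (by
        simp only [smul_eq_mul, mem_Ioo] at ht ⊢; constructor <;> linarith [ht.1, ht.2])⟩
      rw [if_pos ha, if_pos hb, inter_eq_self_of_subset_right h1', ← integral_Ioc_eq_integral_Ioo,
        ← intervalIntegral.integral_of_le hab.le]
      apply intervalIntegral.integral_deriv_eq_sub
      · intro x _; exact hf.differentiable one_ne_zero x
      · exact (hf.continuous_deriv le_rfl).intervalIntegrable _ _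
    · have h1' : Ioo a b ⊆ Oᶜ := h1.trans interior_subset
      have hb : ¬ RAdj O (-1) b := by
        rintro ⟨δ, hδ, h⟩
        have hm : 0 < min δ (b-a) := lt_min hδ (by linarith)
        have h2 := min_le_left δ (b-a)
        have h3 := min_le_right δ (b-a)
        refine h1' (a := b + (min δ (b-a) / 2) • (-1)) ?_ (h _ ⟨by linarith, by linarith⟩)
        simp only [smul_eq_mul, mem_Ioo]; constructor <;> linarith
      have ha : ¬ RAdj O 1 a := by
        rintro ⟨δ, hδ, h⟩
        have hm : 0 < min δ (b-a) := lt_min hδ (by linarith)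
        have h2 := min_le_left δ (b-a)
        have h3 := min_le_right δ (b-a)
        refine h1' (a := a + (min δ (b-a) / 2) • 1) ?_ (h _ ⟨by linarith, by linarith⟩)
        simp only [smul_eq_mul, mem_Ioo]; constructor <;> linarith
      rw [if_neg ha, if_neg hb]
      have : O ∩ Ioo a b = ∅ := by
        ext x; simp only [mem_inter_iff, mem_empty_iff_false, iff_false, not_and]
        intro hx hx'; exact h1' hx' hx
      simp [this]
  | insert c F hc ih =>
    intro a b hab h
    by_cases hcm : c ∈ Ioo a b
    · have e1 := ih a c hcm.1 (by
        intro x hx hx'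
        have := h x ⟨hx.1, hx.2.trans hcm.2⟩ hx'
        rcases Finset.mem_insert.1 this with rfl | h2
        · exact absurd hx.2 (lt_irrefl _)
        · exact h2)
      have e2 := ih c b hcm.2 (by
        intro x hx hx'
        have := h x ⟨hcm.1.trans hx.1, hx.2⟩ hx'
        rcases Finset.mem_insert.1 this with rfl | h2
        · exact absurd hx.1 (lt_irrefl _)
        · exact h2)
      have hset : (O ∩ Ioo a b : Set ℝ) =ᵐ[volume] (O ∩ Ioo a c ∪ O ∩ Ioo c b : Set ℝ) := by
        have : ({c} : Set ℝ)ᶜ ∈ ae volume := by simp [mem_ae_iff]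
        filter_upwards [this] with x hx
        have hx : x ≠ c := hx
        apply propext
        change (x ∈ O ∧ (a < x ∧ x < b)) ↔ (x ∈ O ∧ (a < x ∧ x < c)) ∨ (x ∈ O ∧ (c < x ∧ x < b))
        have := hcm.1
        have := hcm.2
        constructor
        · rintro ⟨h1, h2, h3⟩
          rcases lt_or_gt_of_ne hx with h4 | h4
          · exact Or.inl ⟨h1, h2, h4⟩
          · exact Or.inr ⟨h1, h4, h3⟩
        · rintro (⟨h1, h2, h3⟩ | ⟨h1, h2, h3⟩)
          · exact ⟨h1, h2, by linarith⟩
          · exact ⟨h1, by linarith, h3⟩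
      rw [setIntegral_congr_set hset]
      have hd : Disjoint (O ∩ Ioo a c) (O ∩ Ioo c b) := by
        rw [Set.disjoint_left]
        rintro x ⟨_, h1⟩ ⟨_, h2⟩
        exact absurd (h1.2.trans h2.1) (lt_irrefl _)
      rw [setIntegral_union hd (hO.inter measurableSet_Ioo) ((hint a c).mono_set inter_subset_right)
        ((hint c b).mono_set inter_subset_right), e1, e2, Finset.filter_insert, if_pos hcm,
        Finset.sum_insert (by simp [hc])]
      have hsplit : F.filter (fun x => x ∈ Ioo a b) =
          F.filter (fun x => x ∈ Ioo a c) ∪ F.filter (fun x => x ∈ Ioo c b) := by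
        ext x
        simp only [Finset.mem_filter, Finset.mem_union, mem_Ioo]
        have h1 := hcm.1
        have h2 := hcm.2
        constructor
        · rintro ⟨hx, h3, h4⟩
          have : x ≠ c := by rintro rfl; exact hc hx
          rcases lt_or_gt_of_ne this with h5 | h5
          · exact Or.inl ⟨hx, h3, h5⟩
          · exact Or.inr ⟨hx, h5, h4⟩
        · rintro (⟨hx, h3, h4⟩ | ⟨hx, h3, h4⟩)
          · exact ⟨hx, h3, by linarith⟩
          · exact ⟨hx, by linarith, h4⟩
      have hdf : Disjoint (F.filter (fun x => x ∈ Ioo a c)) (F.filter (fun x => x ∈ Ioo c b)) := by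
        rw [Finset.disjoint_left]
        intro x hx hx'
        simp only [Finset.mem_filter, mem_Ioo] at hx hx'
        linarith [hx.2.2, hx'.2.1]
      rw [hsplit, Finset.sum_union hdf]
      ring
    · rw [Finset.filter_insert, if_neg hcm]
      apply ih a b hab
      intro x hx hx'
      rcases Finset.mem_insert.1 (h x hx hx') with rfl | h2
      · exact absurd hx hcm
      · exact h2

open Classical in
theorem oneD_bound (O : Set ℝ) (hO : MeasurableSet O) (hb : Bornology.IsBounded O)
    (f : ℝ → ℝ) (hf : ContDiff ℝ 1 f) (F : Finset ℝ) (hF : frontier O ⊆ F) :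
    |∫ x in O, deriv f x| ≤ ∑ x ∈ F.filter (fun x => RAdj O 1 x ∨ RAdj O (-1) x), |f x| := by
  obtain ⟨M, hM⟩ := hb.subset_ball (0 : ℝ)
  set a := -(|M| + 1) with ha
  set b := |M| + 1 with hbd
  have habs := le_abs_self M
  have hsub : ∀ x ∈ O, -|M| < x ∧ x < |M| := by
    intro x hx
    have := hM hx
    rw [Metric.mem_ball, Real.dist_eq, sub_zero, abs_lt] at this
    constructor <;> linarith [this.1, this.2]
  have hab : a < b := by have := abs_nonneg M; linarith
  have h1 := oneD_interval O hO f hf F a b hab (fun x _ hx => hF hx)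
  have hOab : O ∩ Ioo a b = O := by
    apply inter_eq_self_of_subset_left
    intro x hx
    have := hsub x hx
    constructor <;> linarith [this.1, this.2]
  have nb : ¬ RAdj O (-1) b := by
    rintro ⟨δ, hδ, h⟩
    have hm : 0 < min δ 1 := lt_min hδ one_pos
    have h2 := min_le_left δ 1
    have h3 := min_le_right δ 1
    have := hsub _ (h (min δ 1 / 2) ⟨by linarith, by linarith⟩)
    simp only [smul_eq_mul] at this
    linarith [this.2]
  have na : ¬ RAdj O 1 a := by
    rintro ⟨δ, hδ, h⟩
    have hm : 0 < min δ 1 := lt_min hδ one_pos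
    have h2 := min_le_left δ 1
    have h3 := min_le_right δ 1
    have := hsub _ (h (min δ 1 / 2) ⟨by linarith, by linarith⟩)
    simp only [smul_eq_mul] at this
    linarith [this.1]
  rw [hOab, if_neg nb, if_neg na, sub_zero, zero_add] at h1
  rw [h1]
  refine (Finset.abs_sum_le_sum_abs _ _).trans ?_
  rw [Finset.sum_filter, Finset.sum_filter]
  apply Finset.sum_le_sum
  intro x _
  by_cases h1 : RAdj O 1 x <;> by_cases h2 : RAdj O (-1) x <;> by_cases h3 : x ∈ Ioo a b <;>
    simp [h1, h2, h3]

/-- Eilenberg for sets -/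
theorem eilenberg_set {v w : EuclideanSpace ℝ (Fin 2)} (hv : ‖v‖ = 1) (hw : ‖w‖ = 1)
    (hvw : inner ℝ w v = 0) (B : Set (EuclideanSpace ℝ (Fin 2))) :
    ∃ N : ℝ → ENNReal, Measurable N ∧
      (∀ p, Measure.count {s : ℝ | s • v + p • w ∈ B} ≤ N p) ∧
      ∫⁻ p, N p ≤ μH[1] B := by
  by_cases hB : μH[1] B = ⊤
  · exact ⟨fun _ => ⊤, measurable_const, fun p => le_top, by rw [hB]; exact le_top⟩
  have hcov : ∀ k : ℕ, ∃ t : ℕ → Set (EuclideanSpace ℝ (Fin 2)), B ⊆ ⋃ n, t n ∧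
      (∀ n, Metric.ediam (t n) ≤ ((k : ENNReal) + 1)⁻¹) ∧
      ∑' n, Metric.ediam (t n) ≤ μH[1] B + ((k : ENNReal) + 1)⁻¹ := by
    intro k
    have hr : 0 < ((k : ENNReal) + 1)⁻¹ := by
      rw [ENNReal.inv_pos]; finiteness
    have h0 := Measure.hausdorffMeasure_apply (1 : ℝ) B
    have h1 : (⨅ (t : ℕ → Set (EuclideanSpace ℝ (Fin 2))) (_ : B ⊆ ⋃ n, t n)
        (_ : ∀ n, Metric.ediam (t n) ≤ ((k : ENNReal) + 1)⁻¹),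
          ∑' n, ⨆ _ : (t n).Nonempty, Metric.ediam (t n) ^ (1 : ℝ))
        < μH[1] B + ((k : ENNReal) + 1)⁻¹ := by
      refine lt_of_le_of_lt ?_ (ENNReal.lt_add_right hB hr.ne')
      rw [h0]
      exact le_iSup₂ (f := fun (r : ENNReal) (_ : 0 < r) => ⨅ (t : ℕ → Set (EuclideanSpace ℝ (Fin 2)))
        (_ : B ⊆ ⋃ n, t n)
        (_ : ∀ n, Metric.ediam (t n) ≤ r),
          ∑' n, ⨆ _ : (t n).Nonempty, Metric.ediam (t n) ^ (1 : ℝ)) _ hr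
    simp only [iInf_lt_iff] at h1
    obtain ⟨t, h1, h2, h3⟩ := h1
    refine ⟨t, h1, h2, le_trans ?_ h3.le⟩
    apply ENNReal.tsum_le_tsum
    intro n
    rcases (t n).eq_empty_or_nonempty with h | h
    · simp [h]
    · simp [h]
  choose t ht1 ht2 ht3 using hcov
  have hinv : Tendsto (fun k : ℕ => ((k : ENNReal) + 1)⁻¹) atTop (𝓝 0) := by
    have := (tendsto_add_atTop_iff_nat 1).2 ENNReal.tendsto_inv_nat_nhds_zero
    simpa using this
  let π : EuclideanSpace ℝ (Fin 2) → ℝ := fun x => inner ℝ w x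
  have hπ : LipschitzWith 1 π := by
    apply LipschitzWith.of_dist_le_mul
    intro x y
    rw [Real.dist_eq, ← inner_sub_right, dist_eq_norm, NNReal.coe_one, one_mul]
    have := abs_real_inner_le_norm w (x - y)
    rwa [hw, one_mul] at this
  have hπf : ∀ s p : ℝ, π (s • v + p • w) = p := by
    intro s p
    simp only [π, inner_add_right, inner_smul_right, hvw, real_inner_self_eq_norm_sq, hw]
    simp
  let T : ℕ → ℕ → Set ℝ := fun k j => toMeasurable volume (π '' t k j)
  have hTv : ∀ k j, volume (T k j) ≤ Metric.ediam (t k j) := by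
    intro k j
    simp only [T, measure_toMeasurable]
    refine (Real.volume_le_diam _).trans ?_
    have := hπ.ediam_image_le (t k j)
    simpa using this
  let Nk : ℕ → ℝ → ENNReal := fun k p => ∑' j, (T k j).indicator 1 p
  have hNm : ∀ k, Measurable (Nk k) := fun k =>
    Measurable.tsum fun j => measurable_one.indicator (measurableSet_toMeasurable _ _)
  have hNi : ∀ k, ∫⁻ p, Nk k p ≤ μH[1] B + ((k : ENNReal) + 1)⁻¹ := by
    intro k
    simp only [Nk]
    rw [lintegral_tsum fun j =>
      (measurable_one.indicator (measurableSet_toMeasurable _ _)).aemeasurable]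
    refine le_trans (ENNReal.tsum_le_tsum fun j => ?_) (ht3 k)
    rw [lintegral_indicator_one (measurableSet_toMeasurable _ _)]
    exact hTv k j
  refine ⟨fun p => liminf (fun k => Nk k p) atTop, Measurable.liminf hNm, ?_, ?_⟩
  · intro p
    have key : ∀ q : Finset ℝ, (∀ s ∈ q, s • v + p • w ∈ B) →
        ∀ᶠ k in atTop, (q.card : ENNReal) ≤ Nk k p := by
      intro q hq
      obtain ⟨ε, hε, hsep⟩ : ∃ ε > (0 : ℝ), ∀ s ∈ q, ∀ s' ∈ q, s ≠ s' → ε < dist s s' := by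
        rcases q.offDiag.eq_empty_or_nonempty with h | h
        · refine ⟨1, one_pos, fun s hs s' hs' hne => ?_⟩
          have : (s, s') ∈ q.offDiag := Finset.mem_offDiag.2 ⟨hs, hs', hne⟩
          rw [h] at this
          simp at this
        · obtain ⟨x, hx, hmin⟩ := Finset.exists_min_image q.offDiag (fun x => dist x.1 x.2) h
          have hpos : 0 < dist x.1 x.2 := dist_pos.2 (Finset.mem_offDiag.1 hx).2.2
          refine ⟨dist x.1 x.2 / 2, by linarith, fun s hs s' hs' hne => ?_⟩
          have := hmin (s, s') (Finset.mem_offDiag.2 ⟨hs, hs', hne⟩)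
          simp only at this
          linarith
      have hlim : ∀ᶠ k : ℕ in atTop, ((k : ENNReal) + 1)⁻¹ < ENNReal.ofReal ε :=
        hinv.eventually (gt_mem_nhds (ENNReal.ofReal_pos.2 hε))
      filter_upwards [hlim] with k hk
      have : ∀ s ∈ q, ∃ j, s • v + p • w ∈ t k j := fun s hs => mem_iUnion.1 (ht1 k (hq s hs))
      choose! j hj using this
      have hinj : Set.InjOn j q := by
        intro s hs s' hs' hjj
        by_contra hne
        have h1 := hsep s hs s' hs' hne
        have h2 := Metric.edist_le_ediam_of_mem (hj s hs) (hjj ▸ hj s' hs')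
        have h3 : dist (s • v + p • w) (s' • v + p • w) = dist s s' := by
          rw [dist_add_right, dist_eq_norm, ← sub_smul, norm_smul, hv, mul_one, dist_eq_norm]
        rw [edist_dist, h3] at h2
        have h4 := (h2.trans (ht2 k _)).trans_lt hk
        exact absurd (ENNReal.ofReal_lt_ofReal_iff'.1 h4).1 (not_lt.2 h1.le)
      calc (q.card : ENNReal) = ∑ i ∈ q.image j, 1 := by
            rw [Finset.sum_const, Finset.card_image_of_injOn hinj]; simp
        _ = ∑ i ∈ q.image j, (T k i).indicator 1 p := by
            apply Finset.sum_congr rfl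
            intro i hi
            obtain ⟨s, hs, rfl⟩ := Finset.mem_image.1 hi
            rw [indicator_of_mem]
            · rfl
            · exact subset_toMeasurable _ _ ⟨_, hj s hs, hπf s p⟩
        _ ≤ Nk k p := ENNReal.sum_le_tsum _
    have key2 : ∀ q : Finset ℝ, (∀ s ∈ q, s • v + p • w ∈ B) →
        (q.card : ENNReal) ≤ liminf (fun k => Nk k p) atTop := fun q hq =>
      le_liminf_of_le (by isBoundedDefault) (key q hq)
    by_cases hfin : {s : ℝ | s • v + p • w ∈ B}.Finite
    · rw [Measure.count_apply_finite _ hfin]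
      exact key2 _ (by simp)
    · rw [Measure.count_apply_infinite hfin]
      rw [top_le_iff]
      refine ENNReal.eq_top_of_forall_nnreal_le fun r => ?_
      obtain ⟨n, hn⟩ := exists_nat_ge r
      obtain ⟨q, hq1, hq2⟩ := Set.Infinite.exists_subset_card_eq hfin n
      refine le_trans ?_ (key2 q hq1)
      rw [hq2]
      exact_mod_cast hn
  · refine (lintegral_liminf_le hNm).trans ?_
    refine (liminf_le_liminf (Eventually.of_forall hNi)).trans ?_
    have : Tendsto (fun k : ℕ => μH[1] B + ((k : ENNReal) + 1)⁻¹) atTop (𝓝 (μH[1] B + 0)) :=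
      tendsto_const_nhds.add hinv
    rw [this.liminf_eq, add_zero]

theorem eilenberg_fun {v w : EuclideanSpace ℝ (Fin 2)} (hv : ‖v‖ = 1) (hw : ‖w‖ = 1)
    (hvw : inner ℝ w v = 0) (h : EuclideanSpace ℝ (Fin 2) → ENNReal) (hh : Measurable h) :
    ∃ N : ℝ → ENNReal, Measurable N ∧
      (∀ p, ∫⁻ s : ℝ, h (s • v + p • w) ∂Measure.count ≤ N p) ∧
      ∫⁻ p, N p ≤ ∫⁻ x, h x ∂μH[1] := by
  have hcont : ∀ p : ℝ, Measurable fun s : ℝ => s • v + p • w := fun p => by fun_prop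
  refine Measurable.ennreal_induction (motive := fun h => ∃ N : ℝ → ENNReal, Measurable N ∧
      (∀ p, ∫⁻ s : ℝ, h (s • v + p • w) ∂Measure.count ≤ N p) ∧
      ∫⁻ p, N p ≤ ∫⁻ x, h x ∂μH[1]) ?_ ?_ ?_ hh
  · intro c B hB
    obtain ⟨N, h1, h2, h3⟩ := eilenberg_set hv hw hvw B
    refine ⟨fun p => c * N p, h1.const_mul c, fun p => ?_, ?_⟩
    · have : (fun s : ℝ => B.indicator (fun _ => c) (s • v + p • w)) =
          ((fun s : ℝ => s • v + p • w) ⁻¹' B).indicator (fun _ => c) := by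
        ext s; rfl
      rw [this, lintegral_indicator_const (hcont p hB)]
      exact mul_le_mul_right (h2 p) c
    · rw [lintegral_const_mul _ h1, lintegral_indicator_const hB]
      gcongr
  · intro f g _ hf hg ⟨N, h1, h2, h3⟩ ⟨N', h1', h2', h3'⟩
    refine ⟨fun p => N p + N' p, h1.add h1', fun p => ?_, ?_⟩
    · simp only [Pi.add_apply]
      have hm : Measurable fun s : ℝ => f (s • v + p • w) := hf.comp (hcont p)
      rw [lintegral_add_left hm]
      exact add_le_add (h2 p) (h2' p)
    · simp only [Pi.add_apply]
      rw [lintegral_add_left h1, lintegral_add_left hf]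
      exact add_le_add h3 h3'
  · intro f hf hmono hN
    choose N h1 h2 h3 using hN
    refine ⟨fun p => liminf (fun k => N k p) atTop, Measurable.liminf h1, fun p => ?_, ?_⟩
    · have hm : Monotone fun (n : ℕ) (s : ℝ) => f n (s • v + p • w) := fun a b hab s => hmono hab _
      have hfm : ∀ n, Measurable fun s : ℝ => f n (s • v + p • w) := fun n => (hf n).comp (hcont p)
      beta_reduce
      rw [lintegral_iSup hfm hm]
      have ht : Tendsto (fun n => ∫⁻ s : ℝ, f n (s • v + p • w) ∂Measure.count) atTop
          (𝓝 (⨆ n, ∫⁻ s : ℝ, f n (s • v + p • w) ∂Measure.count)) :=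
        tendsto_atTop_iSup fun a b hab => lintegral_mono (hm hab)
      rw [← ht.liminf_eq]
      exact liminf_le_liminf (Eventually.of_forall fun n => h2 n p)
    · refine (lintegral_liminf_le h1).trans ?_
      rw [lintegral_iSup hf hmono]
      have ht : Tendsto (fun n => ∫⁻ x, f n x ∂μH[1]) atTop
          (𝓝 (⨆ n, ∫⁻ x, f n x ∂μH[1])) :=
        tendsto_atTop_iSup fun a b hab => lintegral_mono (hmono hab)
      rw [← ht.liminf_eq]
      exact liminf_le_liminf (Eventually.of_forall h3)


theorem exists_param (v : EuclideanSpace ℝ (Fin 2)) (hv : ‖v‖ = 1) :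
    ∃ w : EuclideanSpace ℝ (Fin 2), ‖w‖ = 1 ∧ inner ℝ w v = 0 ∧
    ∃ Φ : ℝ × ℝ ≃ᵐ EuclideanSpace ℝ (Fin 2), (∀ p s : ℝ, Φ (p, s) = s • v + p • w) ∧
      MeasurePreserving Φ := by
  obtain ⟨b, hb⟩ := Orthonormal.exists_orthonormalBasis_extension_of_card_eq (𝕜 := ℝ)
    (E := EuclideanSpace ℝ (Fin 2)) (ι := Fin 2) (by simp) (v := fun _ => v) (s := {1}) (by
      rw [orthonormal_iff_ite]
      rintro ⟨i, hi⟩ ⟨j, hj⟩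
      simp only [mem_singleton_iff] at hi hj
      subst hi; subst hj
      simp [hv])
  have hb1 : b 1 = v := hb 1 rfl
  refine ⟨b 0, b.orthonormal.1 0, ?_, ?_⟩
  · rw [← hb1]; exact b.orthonormal.2 (by decide)
  refine ⟨(MeasurableEquiv.finTwoArrow (α := ℝ)).symm.trans
    ((MeasurableEquiv.toLp 2 (Fin 2 → ℝ)).trans b.measurableEquiv.symm), ?_, ?_⟩
  · intro p s
    rw [← hb1]
    have : ∀ y : EuclideanSpace ℝ (Fin 2), b.measurableEquiv.symm y = ∑ i, y i • b i := by
      intro y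
      exact (b.sum_repr_symm y).symm
    simp only [MeasurableEquiv.trans_apply, this, Fin.sum_univ_two]
    rw [add_comm]
    rfl
  · exact ((b.measurePreserving_measurableEquiv.symm).comp
      ((EuclideanSpace.volume_preserving_symm_measurableEquiv_toLp (Fin 2)).symm)).comp
      ((volume_preserving_finTwoArrow ℝ).symm)

open Pointwise in
theorem measurableSet_RAdj {O : Set (EuclideanSpace ℝ (Fin 2))} (hO : IsOpen O)
    (v : EuclideanSpace ℝ (Fin 2)) : MeasurableSet {x | RAdj O v x} := by
  have : {x | RAdj O v x} = ⋃ l : ℕ, ⋂ k : ℕ,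
      {x | ∀ t ∈ Icc (1 / ((k : ℝ) + 1)) (1 / ((l : ℝ) + 1)), x + t • v ∈ O} := by
    ext x
    simp only [mem_ofPred_eq, mem_iUnion, mem_iInter]
    constructor
    · rintro ⟨δ, hδ, h⟩
      obtain ⟨l, hl⟩ := exists_nat_one_div_lt hδ
      exact ⟨l, fun k t ht => h t ⟨lt_of_lt_of_le (by positivity) ht.1, lt_of_le_of_lt ht.2 hl⟩⟩
    · rintro ⟨l, h⟩
      refine ⟨1 / ((l : ℝ) + 1), by positivity, fun t ht => ?_⟩
      obtain ⟨k, hk⟩ := exists_nat_one_div_lt ht.1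
      exact h k t ⟨hk.le, ht.2.le⟩
  rw [this]
  refine MeasurableSet.iUnion fun l => MeasurableSet.iInter fun k => ?_
  apply IsOpen.measurableSet
  have hc : {x | ∀ t ∈ Icc (1 / ((k : ℝ) + 1)) (1 / ((l : ℝ) + 1)), x + t • v ∈ O}ᶜ =
      Oᶜ + (fun t : ℝ => -(t • v)) '' Icc (1 / ((k : ℝ) + 1)) (1 / ((l : ℝ) + 1)) := by
    ext x
    simp only [mem_compl_iff, mem_ofPred_eq, not_forall, Set.mem_add, mem_image]
    constructor
    · rintro ⟨t, ht, h⟩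
      exact ⟨x + t • v, h, _, ⟨t, ht, rfl⟩, by abel⟩
    · rintro ⟨y, hy, _, ⟨t, ht, rfl⟩, rfl⟩
      refine ⟨t, ht, ?_⟩
      have : y + -(t • v) + t • v = y := by abel
      rwa [this]
  rw [← isClosed_compl_iff, hc]
  exact hO.isClosed_compl.add_right_of_isCompact (isCompact_Icc.image (by fun_prop))

theorem directional_bound (O D : Set (EuclideanSpace ℝ (Fin 2))) (hO : IsOpen O)
    (hb : Bornology.IsBounded O) (hD : MeasurableSet D) (hDf : μH[1] D ≠ ⊤)
    (hfr : frontier O ⊆ D) (v : EuclideanSpace ℝ (Fin 2)) (hv : ‖v‖ = 1)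
    (f : EuclideanSpace ℝ (Fin 2) → ℝ) (hf : ContDiff ℝ 1 f) :
    ENNReal.ofReal |∫ x in O, fderiv ℝ f x v| ≤
      ∫⁻ x in D ∩ {x | RAdj O v x ∨ RAdj O (-v) x}, ENNReal.ofReal |f x| ∂μH[1] := by
  classical
  obtain ⟨w, hw, hwv, Φ, hΦ, hmp⟩ := exists_param v hv
  set S : Set (EuclideanSpace ℝ (Fin 2)) := D ∩ {x | RAdj O v x ∨ RAdj O (-v) x} with hS
  have hSm : MeasurableSet S := hD.inter ((measurableSet_RAdj hO v).union (measurableSet_RAdj hO (-v)))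
  have hfm : Measurable fun x => ENNReal.ofReal |f x| :=
    (hf.continuous.abs.measurable).ennreal_ofReal
  obtain ⟨N, hN1, hN2, hN3⟩ := eilenberg_fun hv hw hwv (S.indicator fun x => ENNReal.ofReal |f x|)
    (hfm.indicator hSm)
  obtain ⟨N', hN1', hN2', hN3'⟩ := eilenberg_set hv hw hwv D
  have hfin : ∀ᵐ p, N' p < ⊤ := ae_lt_top hN1' (ne_top_of_le_ne_top hDf hN3')
  rw [lintegral_indicator hSm] at hN3
  refine le_trans ?_ hN3
  have hcl : IsCompact (closure O) := hb.isCompact_closure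
  have hcont : Continuous fun x => fderiv ℝ f x v :=
    (hf.continuous_fderiv one_ne_zero).clm_apply continuous_const
  have hint : IntegrableOn (fun x => fderiv ℝ f x v) O :=
    (hcont.continuousOn.integrableOn_compact hcl).mono_set subset_closure
  have e1 : ∫ x in O, fderiv ℝ f x v =
      ∫ p : ℝ, ∫ s in {s : ℝ | s • v + p • w ∈ O}, fderiv ℝ f (s • v + p • w) v := by
    have hint' : Integrable (O.indicator fun x => fderiv ℝ f x v) :=
      (integrable_indicator_iff hO.measurableSet).2 hint
    rw [← integral_indicator hO.measurableSet, ← hmp.integral_comp Φ.measurableEmbedding,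
      Measure.volume_eq_prod, integral_prod]
    · congr 1
      ext p
      rw [← integral_indicator]
      · congr 1
        ext s
        rw [hΦ]; rfl
      · exact (hO.preimage (f := fun s : ℝ => s • v + p • w) (by fun_prop)).measurableSet
    · exact (hmp.integrable_comp_emb Φ.measurableEmbedding).2 hint'
  rw [e1, ← Real.norm_eq_abs, ofReal_norm]
  refine (enorm_integral_le_lintegral_enorm _).trans (lintegral_mono_ae ?_)
  filter_upwards [hfin] with p hp
  refine le_trans ?_ (hN2 p)
  have hFfin : {s : ℝ | s • v + p • w ∈ D}.Finite := by
    by_contra hcon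
    have := hN2' p
    rw [Measure.count_apply_infinite hcon] at this
    exact absurd hp (not_lt.2 this)
  set Op : Set ℝ := {s : ℝ | s • v + p • w ∈ O} with hOp
  have hlc : Continuous fun s : ℝ => s • v + p • w := by fun_prop
  have hOpo : IsOpen Op := hO.preimage hlc
  have hOpb : Bornology.IsBounded Op := by
    obtain ⟨M, hM⟩ := hb.subset_closedBall 0
    refine (Metric.isBounded_closedBall (x := (0:ℝ)) (r := M + |p|)).subset ?_
    intro s hs
    have h1 := hM hs
    rw [mem_closedBall_zero_iff] at h1 ⊢
    have : s • v = (s • v + p • w) - p • w := by abel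
    have h2 : ‖s • v‖ ≤ ‖s • v + p • w‖ + ‖p • w‖ := by rw [this]; simpa using norm_sub_le (s • v + p • w) (p • w)
    rw [norm_smul, norm_smul, hv, hw, mul_one, mul_one] at h2
    simp only [Real.norm_eq_abs] at *
    linarith
  have hfrp : frontier Op ⊆ hFfin.toFinset := by
    intro s hs
    simp only [Finite.coe_toFinset, mem_ofPred_eq]
    exact hfr (hlc.frontier_preimage_subset O hs)
  have hfp : ContDiff ℝ 1 fun s : ℝ => f (s • v + p • w) := hf.comp (by fun_prop)
  have hder : ∀ s : ℝ, deriv (fun s : ℝ => f (s • v + p • w)) s = fderiv ℝ f (s • v + p • w) v := by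
    intro s
    have h1 : HasDerivAt (fun s : ℝ => s • v + p • w) v s := by
      simpa using ((hasDerivAt_id s).smul_const v).add_const (p • w)
    exact (((hf.differentiable one_ne_zero) _).hasFDerivAt.comp_hasDerivAt s h1).deriv
  have hone := oneD_bound Op hOpo.measurableSet hOpb _ hfp _ hfrp
  simp only [hder] at hone
  rw [← ofReal_norm, Real.norm_eq_abs]
  refine (ENNReal.ofReal_le_ofReal hone).trans ?_
  rw [ENNReal.ofReal_sum_of_nonneg (fun _ _ => abs_nonneg _)]
  rw [lintegral_count]
  refine le_trans (le_of_eq ?_) (ENNReal.sum_le_tsum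
    (hFfin.toFinset.filter fun x => RAdj Op 1 x ∨ RAdj Op (-1) x))
  refine Finset.sum_congr rfl fun s hs => ?_
  rw [Finset.mem_filter] at hs
  rw [indicator_of_mem]
  refine ⟨by simpa using hs.1, ?_⟩
  rcases hs.2 with ⟨δ, hδ, h⟩ | ⟨δ, hδ, h⟩
  · refine Or.inl ⟨δ, hδ, fun t ht => ?_⟩
    have := h t ht
    simp only [hOp, mem_ofPred_eq, smul_eq_mul, mul_one, add_smul] at this
    convert this using 1; abel
  · refine Or.inr ⟨δ, hδ, fun t ht => ?_⟩
    have := h t ht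
    simp only [hOp, mem_ofPred_eq, smul_eq_mul, mul_neg, mul_one, add_smul, neg_smul] at this
    convert this using 1; rw [smul_neg]; abel


theorem ae_nonneg_of_test (H : Measure (EuclideanSpace ℝ (Fin 2))) [IsFiniteMeasure H]
    (Ψ : EuclideanSpace ℝ (Fin 2) → ℝ) (hΨm : Measurable Ψ) (hΨ : Integrable Ψ H)
    (h : ∀ f : EuclideanSpace ℝ (Fin 2) → ℝ, ContDiff ℝ 1 f → (∀ x, f x ∈ Icc (0 : ℝ) 1) →
      0 ≤ ∫ x, f x * Ψ x ∂H) : ∀ᵐ x ∂H, 0 ≤ Ψ x := by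
  have hK : ∀ K : Set (EuclideanSpace ℝ (Fin 2)), IsCompact K → 0 ≤ ∫ x in K, Ψ x ∂H := by
    intro K hK
    have hex : ∀ n : ℕ, ∃ f : EuclideanSpace ℝ (Fin 2) → ℝ, ContDiff ℝ 1 f ∧
        (∀ x, f x ∈ Icc (0 : ℝ) 1) ∧ Function.support f = Metric.thickening (1 / ((n : ℝ) + 1)) K ∧
        ∀ x ∈ K, f x = 1 := by
      intro n
      obtain ⟨f, h1, h2, h3, h4⟩ := exists_contMDiff_support_eq_eq_one_iff (n := 1)
        (modelWithCornersSelf ℝ (EuclideanSpace ℝ (Fin 2)))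
        (Metric.isOpen_thickening (δ := 1 / ((n : ℝ) + 1)) (E := K)) hK.isClosed
        (Metric.self_subset_thickening (by positivity) K)
      exact ⟨f, h1.contDiff, fun x => h2 (mem_range_self x), h3, fun x hx => (h4 x).1 hx⟩
    choose f hf1 hf2 hf3 hf4 using hex
    have L : Tendsto (fun n ↦ ∫ x, f n x * Ψ x ∂H) atTop (𝓝 (∫ x in K, Ψ x ∂H)) := by
      rw [← integral_indicator hK.measurableSet]
      refine tendsto_integral_of_dominated_convergence (fun x => ‖Ψ x‖) ?_ hΨ.norm ?_ ?_
      · intro n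
        exact (hf1 n).continuous.aestronglyMeasurable.mul hΨ.aestronglyMeasurable
      · intro n
        filter_upwards with x
        rw [norm_mul, Real.norm_of_nonneg (hf2 n x).1]
        exact mul_le_of_le_one_left (norm_nonneg _) (hf2 n x).2
      · filter_upwards with x
        by_cases hx : x ∈ K
        · simp [hf4 _ x hx, hx]
        · rw [indicator_of_notMem hx]
          apply tendsto_const_nhds.congr'
          obtain ⟨ε, εpos, hε⟩ : ∃ ε, 0 < ε ∧ x ∉ Metric.thickening ε K := by
            rw [← hK.isClosed.closure_eq, Metric.closure_eq_iInter_thickening K] at hx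
            simpa using hx
          filter_upwards [(tendsto_order.1 (tendsto_one_div_add_atTop_nhds_zero_nat (𝕜 := ℝ))).2 _ εpos]
            with n hn
          have : f n x = 0 := by
            rw [← Function.notMem_support, hf3]
            exact fun hc => hε (Metric.thickening_mono hn.le K hc)
          simp [this]
    exact ge_of_tendsto' L fun n => h _ (hf1 n) (hf2 n)
  by_contra hcon
  have hpos : 0 < H {x | Ψ x < 0} := by
    rw [pos_iff_ne_zero]
    intro h0
    apply hcon
    rw [ae_iff]
    simpa using h0
  have hm : MeasurableSet {x | Ψ x < 0} := hΨm measurableSet_Iio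
  obtain ⟨K, hKs, hKc, hKp⟩ := hm.exists_lt_isCompact hpos
  have h1 := hK K hKc
  have h2 : 0 < ∫ x in K, -Ψ x ∂H := by
    rw [setIntegral_pos_iff_support_of_nonneg_ae]
    · refine hKp.trans_le (measure_mono fun x hx => ⟨?_, hx⟩)
      have : Ψ x < 0 := hKs hx
      simp [this.ne]
    · filter_upwards [ae_restrict_mem hKc.measurableSet] with x hx
      have : Ψ x < 0 := hKs hx
      simp [this.le]
    · exact hΨ.neg.integrableOn
  rw [integral_neg] at h2
  linarith

theorem riesz_abstract {C L : Type*} [AddCommGroup C] [Module ℝ C] [NormedAddCommGroup L]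
    [InnerProductSpace ℝ L] [CompleteSpace L] (ι : C →ₗ[ℝ] L) (T : C →ₗ[ℝ] ℝ) (M : ℝ)
    (h : ∀ c, |T c| ≤ M * ‖ι c‖) : ∃ g : L, ∀ c, T c = inner ℝ g (ι c) := by
  have h1 : T ∈ LinearMap.range ι.dualMap := by
    rw [LinearMap.range_dualMap_eq_dualAnnihilator_ker, Submodule.mem_dualAnnihilator]
    intro c hc
    have := h c
    rw [LinearMap.mem_ker.1 hc, norm_zero, mul_zero] at this
    exact abs_nonpos_iff.1 this
  obtain ⟨T', hT'⟩ := h1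
  have hT2 : ∀ c, T c = T' (ι c) := fun c => by rw [← hT']; rfl
  let F : StrongDual ℝ (LinearMap.range ι) :=
    LinearMap.mkContinuous (T'.comp (LinearMap.range ι).subtype) M (by
      rintro ⟨_, c, rfl⟩
      simpa [← hT2] using h c)
  obtain ⟨G, hG, -⟩ := exists_extension_norm_eq _ F
  refine ⟨(InnerProductSpace.toDual ℝ L).symm G, fun c => ?_⟩
  rw [InnerProductSpace.toDual_symm_apply, hG ⟨ι c, c, rfl⟩, hT2]
  rfl

/-- The C¹ functions. -/
def C1Fun : Submodule ℝ (EuclideanSpace ℝ (Fin 2) → ℝ) where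
  carrier := {f | ContDiff ℝ 1 f}
  add_mem' := by
    intro f g hf hg
    rw [mem_ofPred_eq] at *
    exact hf.add hg
  zero_mem' := by
    rw [mem_ofPred_eq]
    exact contDiff_const
  smul_mem' := by
    intro c f hf
    rw [mem_ofPred_eq] at *
    exact hf.const_smul c

theorem mem_C1Fun {f : EuclideanSpace ℝ (Fin 2) → ℝ} : f ∈ C1Fun ↔ ContDiff ℝ 1 f := Iff.rfl

theorem riesz_C1 (H : Measure (EuclideanSpace ℝ (Fin 2))) [IsFiniteMeasure H]
    (D : Set (EuclideanSpace ℝ (Fin 2))) (hD : IsCompact D) (hH : ∀ᵐ x ∂H, x ∈ D)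
    (T : C1Fun →ₗ[ℝ] ℝ)
    (h : ∀ f : C1Fun, |T f| ≤ ∫ x, |f.1 x| ∂H) :
    ∃ g : EuclideanSpace ℝ (Fin 2) → ℝ, Measurable g ∧ Integrable g H ∧
      ∀ f : C1Fun, T f = ∫ x, f.1 x * g x ∂H := by
  have hmem : ∀ f : C1Fun, MemLp f.1 2 H := by
    intro f
    have hc : Continuous f.1 := (mem_C1Fun.1 f.2).continuous
    obtain ⟨M, hM⟩ := hD.exists_bound_of_continuousOn hc.continuousOn
    exact MemLp.of_bound hc.aestronglyMeasurable M (hH.mono fun x hx => hM x hx)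
  let ι : C1Fun →ₗ[ℝ] Lp ℝ 2 H :=
    { toFun := fun f => (hmem f).toLp f.1
      map_add' := fun f g => MemLp.toLp_add (hmem f) (hmem g)
      map_smul' := fun c f => MemLp.toLp_const_smul c (hmem f) }
  obtain ⟨g, hg⟩ := riesz_abstract ι T (‖(memLp_const (1 : ℝ) : MemLp (fun _ => (1:ℝ)) 2 H).toLp‖) (by
    intro f
    refine (h f).trans ?_
    let a : Lp ℝ 2 H := ((hmem f).abs).toLp
    let b : Lp ℝ 2 H := (memLp_const (1 : ℝ) : MemLp (fun _ => (1:ℝ)) 2 H).toLp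
    have h1 : inner ℝ b a = ∫ x, |f.1 x| ∂H := by
      rw [L2.inner_def]
      apply integral_congr_ae
      filter_upwards [MemLp.coeFn_toLp ((hmem f).abs),
        MemLp.coeFn_toLp (memLp_const (1 : ℝ) : MemLp (fun _ => (1:ℝ)) 2 H)] with x hx hx'
      rw [hx, hx']; simp
    have h2 : ‖a‖ = ‖ι f‖ := by
      simp only [a, ι, LinearMap.coe_mk, AddHom.coe_mk, Lp.norm_toLp]
      congr 1
      apply eLpNorm_congr_norm_ae
      filter_upwards with x
      simp
    rw [← h1, ← h2]
    exact real_inner_le_norm b a)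
  have hgm := Lp.stronglyMeasurable g
  refine ⟨g, hgm.measurable, (Lp.memLp g).integrable (by norm_num), fun f => ?_⟩
  rw [hg, L2.inner_def]
  apply integral_congr_ae
  filter_upwards [MemLp.coeFn_toLp (hmem f)] with x hx
  simp only [ι, LinearMap.coe_mk, AddHom.coe_mk]
  rw [hx]
  simp


/-- The directional derivative functional. -/
noncomputable def dirT (O : Set (EuclideanSpace ℝ (Fin 2))) (hb : Bornology.IsBounded O)
    (v : EuclideanSpace ℝ (Fin 2)) : C1Fun →ₗ[ℝ] ℝ where
  toFun f := ∫ x in O, fderiv ℝ f.1 x v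
  map_add' := by
    intro f g
    have hint : ∀ f : C1Fun, IntegrableOn (fun x => fderiv ℝ f.1 x v) O := fun f =>
      (((((mem_C1Fun.1 f.2).continuous_fderiv one_ne_zero).clm_apply
        continuous_const).continuousOn).integrableOn_compact hb.isCompact_closure).mono_set
          subset_closure
    rw [← integral_add (hint f) (hint g)]
    congr 1
    ext x
    have h1 := (mem_C1Fun.1 f.2).differentiable one_ne_zero x
    have h2 := (mem_C1Fun.1 g.2).differentiable one_ne_zero x
    rw [Submodule.coe_add, fderiv_add h1 h2]
    rfl
  map_smul' := by
    intro c f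
    simp only [RingHom.id_apply, smul_eq_mul]
    rw [← integral_const_mul]
    congr 1
    ext x
    have h1 := (mem_C1Fun.1 f.2).differentiable one_ne_zero x
    rw [Submodule.coe_smul, fderiv_const_smul h1]
    rfl

theorem exists_density (O D : Set (EuclideanSpace ℝ (Fin 2))) (hO : IsOpen O)
    (hb : Bornology.IsBounded O) (hD : IsCompact D) (hDf : μH[1] D ≠ ⊤)
    (hfr : frontier O ⊆ D) :
    ∃ g : EuclideanSpace ℝ (Fin 2) → EuclideanSpace ℝ (Fin 2), Measurable g ∧
      Integrable g (μH[1].restrict D) ∧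
      (∀ f : EuclideanSpace ℝ (Fin 2) → ℝ, ContDiff ℝ 1 f → ∀ v,
        ∫ x in O, fderiv ℝ f x v = ∫ x in D, f x * inner ℝ (g x) v ∂μH[1]) ∧
      (∀ v, ‖v‖ = 1 → ∀ᵐ x ∂(μH[1].restrict D),
        |inner ℝ (g x) v| ≤ {x | RAdj O v x ∨ RAdj O (-v) x}.indicator 1 x) := by
  have hfinm : IsFiniteMeasure ((μH[1] : Measure (EuclideanSpace ℝ (Fin 2))).restrict D) :=
    ⟨by rw [Measure.restrict_apply_univ]; exact hDf.lt_top⟩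
  set H := (μH[1] : Measure (EuclideanSpace ℝ (Fin 2))).restrict D with hH
  have hHD : ∀ᵐ x ∂H, x ∈ D := ae_restrict_mem hD.measurableSet
  have hSm : ∀ v, MeasurableSet {x | RAdj O v x ∨ RAdj O (-v) x} := fun v =>
    (measurableSet_RAdj hO v).union (measurableSet_RAdj hO (-v))
  have hfint : ∀ f : EuclideanSpace ℝ (Fin 2) → ℝ, Continuous f → Integrable f H := by
    intro f hf
    obtain ⟨M, hM⟩ := hD.exists_bound_of_continuousOn hf.continuousOn
    exact Integrable.of_bound hf.aestronglyMeasurable M (hHD.mono fun x hx => hM x hx)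
  -- bound
  have bound : ∀ v, ‖v‖ = 1 → ∀ f : C1Fun, |dirT O hb v f| ≤
      ∫ x, |f.1 x| * {x | RAdj O v x ∨ RAdj O (-v) x}.indicator 1 x ∂H := by
    intro v hv f
    have h1 := directional_bound O D hO hb hD.measurableSet hDf hfr v hv f.1 (mem_C1Fun.1 f.2)
    have hc := (mem_C1Fun.1 f.2).continuous
    have h2 : ∫⁻ x in D ∩ {x | RAdj O v x ∨ RAdj O (-v) x}, ENNReal.ofReal |f.1 x| ∂μH[1] =
        ENNReal.ofReal (∫ x, |f.1 x| * {x | RAdj O v x ∨ RAdj O (-v) x}.indicator 1 x ∂H) := by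
      rw [inter_comm, ← Measure.restrict_restrict (hSm v), ← hH,
        ← ofReal_integral_eq_lintegral_ofReal]
      · rw [← integral_indicator (hSm v)]
        congr 2
        ext x
        by_cases hx : x ∈ {x | RAdj O v x ∨ RAdj O (-v) x}
        · rw [indicator_of_mem hx, indicator_of_mem hx]; simp
        · rw [indicator_of_notMem hx, indicator_of_notMem hx]; simp
      · exact (hfint _ hc.abs).restrict
      · exact Eventually.of_forall fun x => abs_nonneg _
    rw [h2] at h1
    refine (ENNReal.ofReal_le_ofReal_iff ?_).1 h1
    refine integral_nonneg fun x => mul_nonneg (abs_nonneg _) (indicator_nonneg (fun _ _ => zero_le_one) _)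
  have hSint : ∀ (f : EuclideanSpace ℝ (Fin 2) → ℝ) v, Continuous f →
      Integrable (fun x => f x * {x | RAdj O v x ∨ RAdj O (-v) x}.indicator 1 x) H := by
    intro f v hf
    have := (hfint f hf).indicator (hSm v)
    refine this.congr (Eventually.of_forall fun x => ?_)
    by_cases hx : x ∈ {x | RAdj O v x ∨ RAdj O (-v) x}
    · simp [indicator_of_mem hx]
    · simp [indicator_of_notMem hx]
  have bound' : ∀ v, ‖v‖ = 1 → ∀ f : C1Fun, |dirT O hb v f| ≤ ∫ x, |f.1 x| ∂H := by
    intro v hv f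
    have hc := (mem_C1Fun.1 f.2).continuous
    refine (bound v hv f).trans (integral_mono (hSint _ v hc.abs) (hfint _ hc.abs) fun x => ?_)
    refine mul_le_of_le_one_right (abs_nonneg _) ?_
    exact indicator_le_self' (fun _ _ => zero_le_one) x
  have hex : ∀ i : Fin 2, ∃ g : EuclideanSpace ℝ (Fin 2) → ℝ, Measurable g ∧ Integrable g H ∧
      ∀ f : C1Fun, dirT O hb (EuclideanSpace.single i 1) f = ∫ x, f.1 x * g x ∂H := fun i =>
    riesz_C1 H D hD hHD _ (bound' _ (by simp))
  choose g hg1 hg2 hg3 using hex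
  let G : EuclideanSpace ℝ (Fin 2) → EuclideanSpace ℝ (Fin 2) := fun x => WithLp.toLp 2 fun i => g i x
  have hinner : ∀ x v, inner ℝ (G x) v = v 0 * g 0 x + v 1 * g 1 x := by
    intro x v
    simp [G, PiLp.inner_apply, Fin.sum_univ_two]
  have hfg : ∀ i (f : EuclideanSpace ℝ (Fin 2) → ℝ), Continuous f → Integrable (fun x => f x * g i x) H := by
    intro i f hf
    obtain ⟨M, hM⟩ := hD.exists_bound_of_continuousOn hf.continuousOn
    exact (hg2 i).bdd_mul hf.aestronglyMeasurable (hHD.mono fun x hx => hM x hx)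
  have hrep : ∀ f : EuclideanSpace ℝ (Fin 2) → ℝ, ContDiff ℝ 1 f → ∀ v,
        ∫ x in O, fderiv ℝ f x v = ∫ x, f x * inner ℝ (G x) v ∂H := by
    intro f hf v
    have hint : ∀ v, IntegrableOn (fun x => fderiv ℝ f x v) O := fun v =>
      ((((hf.continuous_fderiv one_ne_zero).clm_apply
        continuous_const).continuousOn).integrableOn_compact hb.isCompact_closure).mono_set
          subset_closure
    have hv : v = v 0 • EuclideanSpace.single (0 : Fin 2) (1 : ℝ) +
        v 1 • EuclideanSpace.single (1 : Fin 2) (1 : ℝ) := by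
      ext i; fin_cases i <;> simp
    have h0 := hg3 0 ⟨f, mem_C1Fun.2 hf⟩
    have h1 := hg3 1 ⟨f, mem_C1Fun.2 hf⟩
    simp only [dirT, LinearMap.coe_mk, AddHom.coe_mk] at h0 h1
    calc ∫ x in O, fderiv ℝ f x v
        = ∫ x in O, (v 0 * fderiv ℝ f x (EuclideanSpace.single (0 : Fin 2) (1 : ℝ))
            + v 1 * fderiv ℝ f x (EuclideanSpace.single (1 : Fin 2) (1 : ℝ))) := by
          congr 1; ext x
          conv_lhs => rw [hv]
          simp
      _ = v 0 * (∫ x, f x * g 0 x ∂H) + v 1 * (∫ x, f x * g 1 x ∂H) := by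
          rw [integral_add ((hint _).const_mul _) ((hint _).const_mul _), integral_const_mul,
            integral_const_mul, h0, h1]
      _ = _ := by
          rw [← integral_const_mul, ← integral_const_mul, ← integral_add
            ((hfg 0 f hf.continuous).const_mul _) ((hfg 1 f hf.continuous).const_mul _)]
          congr 1; ext x
          rw [hinner]; ring
  have hGm : Measurable G := by
    apply (MeasurableEquiv.toLp 2 (Fin 2 → ℝ)).measurable.comp
    exact measurable_pi_lambda _ hg1
  have hGin : ∀ v, Integrable (fun x => inner ℝ (G x) v) H := by
    intro v
    simp only [hinner]
    exact ((hg2 0).const_mul _).add ((hg2 1).const_mul _)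
  have hGinm : ∀ v, Measurable (fun x => inner ℝ (G x) v) := by
    intro v
    simp only [hinner]
    exact ((hg1 0).const_mul _).add ((hg1 1).const_mul _)
  have hGi : Integrable G H := by
    refine Integrable.mono' ((hg2 0).norm.add (hg2 1).norm) hGm.aestronglyMeasurable ?_
    filter_upwards with x
    rw [EuclideanSpace.norm_eq, Fin.sum_univ_two]
    apply Real.sqrt_le_iff.2
    simp only [G, Pi.add_apply]
    have := norm_nonneg (g 0 x)
    have := norm_nonneg (g 1 x)
    constructor
    · positivity
    · nlinarith
  refine ⟨G, hGm, hGi, hrep, fun v hv => ?_⟩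
  have hside : ∀ v, ‖v‖ = 1 → ∀ᵐ x ∂H, 0 ≤
      {x | RAdj O v x ∨ RAdj O (-v) x}.indicator 1 x - inner ℝ (G x) v := by
    intro v hv
    have hi1 : Integrable (({x | RAdj O v x ∨ RAdj O (-v) x}.indicator 1 :
        EuclideanSpace ℝ (Fin 2) → ℝ)) H := by
      simpa using hSint (fun _ => 1) v continuous_const
    apply ae_nonneg_of_test H _ ((measurable_one.indicator (hSm v)).sub (hGinm v))
      (hi1.sub (hGin v))
    intro f hf hf01
    have hb1 := bound v hv ⟨f, mem_C1Fun.2 hf⟩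
    simp only [dirT, LinearMap.coe_mk, AddHom.coe_mk] at hb1
    rw [hrep f hf v] at hb1
    have hb2 := (le_abs_self _).trans hb1
    have hfi : Integrable (fun x => f x * inner ℝ (G x) v) H := by
      obtain ⟨M, hM⟩ := hD.exists_bound_of_continuousOn hf.continuous.continuousOn
      exact (hGin v).bdd_mul hf.continuous.aestronglyMeasurable (hHD.mono fun x hx => hM x hx)
    simp only [Pi.sub_apply, mul_sub]
    rw [integral_sub (hSint f v hf.continuous) hfi]
    simp only [abs_of_nonneg (hf01 _).1] at hb2
    linarith
  have hneg := hside (-v) (by rwa [norm_neg])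
  filter_upwards [hside v hv, hneg] with x h1 h2
  have hsw : {x | RAdj O (-v) x ∨ RAdj O (- -v) x} = {x | RAdj O v x ∨ RAdj O (-v) x} := by
    ext y; rw [neg_neg, mem_ofPred_eq, mem_ofPred_eq, or_comm]
  rw [hsw, inner_neg_right] at h2
  rw [abs_le]
  constructor <;> linarith


lemma bath_inner (s c : ℝ) (hc : 0 < c) :
    ∫⁻ r in Ioi (0:ℝ), ENNReal.ofReal (s - c * r) ≤ ENNReal.ofReal ((max s 0)^2/(2*c)) := by
  rcases le_or_gt s 0 with hs | hs
  · have : ∫⁻ r in Ioi (0:ℝ), ENNReal.ofReal (s - c * r) = ∫⁻ r in Ioi (0:ℝ), 0 := by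
      refine setLIntegral_congr_fun measurableSet_Ioi (fun r hr => ?_)
      refine ENNReal.ofReal_of_nonpos ?_
      have := mul_pos hc (mem_Ioi.1 hr); linarith
    rw [this]; simp
  · have h1 : ∫⁻ r in Ioi (0:ℝ), ENNReal.ofReal (s - c * r)
        ≤ ∫⁻ r in Ioc 0 (s/c), ENNReal.ofReal (s - c * r) := by
      rw [← lintegral_indicator measurableSet_Ioi, ← lintegral_indicator measurableSet_Ioc]
      refine lintegral_mono (fun r => ?_)
      by_cases h : r ∈ Ioi (0:ℝ)
      · by_cases h2 : r ≤ s / c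
        · rw [indicator_of_mem h, indicator_of_mem (show r ∈ Ioc 0 (s/c) from ⟨h, h2⟩)]
        · rw [indicator_of_mem h, ENNReal.ofReal_of_nonpos]
          · exact zero_le
          · push Not at h2
            rw [div_lt_iff₀ hc] at h2; linarith
      · rw [indicator_of_notMem h]; exact zero_le
    refine h1.trans ?_
    have hsc : 0 ≤ s / c := by positivity
    have hi : IntegrableOn (fun r => s - c * r) (Ioc 0 (s/c)) :=
      (Continuous.integrableOn_Icc (by fun_prop)).mono_set Ioc_subset_Icc_self
    rw [← ofReal_integral_eq_lintegral_ofReal hi]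
    · refine ENNReal.ofReal_le_ofReal ?_
      rw [← intervalIntegral.integral_of_le hsc, intervalIntegral.integral_sub (by simp)
        (Continuous.intervalIntegrable (by fun_prop) _ _), intervalIntegral.integral_const_mul,
        intervalIntegral.integral_const, integral_id, max_eq_left hs.le]
      apply le_of_eq
      simp only [smul_eq_mul]
      field_simp
      ring
    · filter_upwards [ae_restrict_mem measurableSet_Ioc] with r hr
      have := hr.2
      rw [le_div_iff₀ hc] at this
      simp only [Pi.zero_apply]
      linarith

lemma bath_outer (c : ℝ) (hc : 0 < c) :
    ∫⁻ θ in Ioo (-Real.pi) Real.pi, ENNReal.ofReal ((max (Real.sin θ) 0)^2/(2*c))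
      ≤ ENNReal.ofReal (Real.pi/(4*c)) := by
  have h1 : ∫⁻ θ in Ioo (-Real.pi) Real.pi, ENNReal.ofReal ((max (Real.sin θ) 0)^2/(2*c))
      ≤ ∫⁻ θ in Ioc 0 Real.pi, ENNReal.ofReal ((Real.sin θ)^2/(2*c)) := by
    rw [← lintegral_indicator measurableSet_Ioo, ← lintegral_indicator measurableSet_Ioc]
    refine lintegral_mono (fun r => ?_)
    by_cases h : r ∈ Ioo (-Real.pi) Real.pi
    · rw [indicator_of_mem h]
      by_cases h2 : 0 < r
      · rw [indicator_of_mem (show r ∈ Ioc 0 Real.pi from ⟨h2, h.2.le⟩),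
          max_eq_left (Real.sin_nonneg_of_nonneg_of_le_pi h2.le h.2.le)]
      · rw [max_eq_right (Real.sin_nonpos_of_nonpos_of_neg_pi_le (not_lt.1 h2) h.1.le)]
        simp
    · rw [indicator_of_notMem h]; exact zero_le
  refine h1.trans ?_
  have hi : IntegrableOn (fun θ => (Real.sin θ)^2/(2*c)) (Ioc 0 Real.pi) :=
    (Continuous.integrableOn_Icc (by fun_prop)).mono_set Ioc_subset_Icc_self
  rw [← ofReal_integral_eq_lintegral_ofReal hi]
  · refine ENNReal.ofReal_le_ofReal ?_
    rw [← intervalIntegral.integral_of_le Real.pi_pos.le, intervalIntegral.integral_div,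
      integral_sin_sq]
    apply le_of_eq
    simp
    field_simp
    norm_num
  · exact Eventually.of_forall (fun r => by simp only [Pi.zero_apply]; positivity)

lemma bath (e : EuclideanSpace ℝ (Fin 2)) (he : ‖e‖ = 1) (c : ℝ) (hc : 0 < c) :
    ∫⁻ z : EuclideanSpace ℝ (Fin 2), ENNReal.ofReal (inner ℝ e z / ‖z‖^2 - c)
      ≤ ENNReal.ofReal (Real.pi/(4*c)) := by
  obtain ⟨w, hw, hwe, Φ, hΦ, hmp⟩ := exists_param e he
  rw [← hmp.lintegral_comp_emb Φ.measurableEmbedding]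
  have h1 : ∀ q : ℝ × ℝ, ENNReal.ofReal (inner ℝ e (Φ q) / ‖Φ q‖^2 - c)
      = ENNReal.ofReal (q.2 / (q.2^2 + q.1^2) - c) := by
    rintro ⟨p, s⟩
    have a1 : inner ℝ e (Φ (p, s)) = s := by
      rw [hΦ, inner_add_right, inner_smul_right, inner_smul_right, real_inner_self_eq_norm_sq, he,
        real_inner_comm, hwe]; simp
    have a2 : ‖Φ (p, s)‖^2 = s^2 + p^2 := by
      rw [hΦ, norm_add_sq_real, norm_smul, norm_smul, inner_smul_left, inner_smul_right,
        real_inner_comm, hwe, he, hw]; simp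
    rw [a1, a2]
  simp_rw [h1]
  rw [← lintegral_comp_polarCoord_symm]
  have h2 : ∫⁻ p in polarCoord.target, ENNReal.ofReal p.1 •
      ENNReal.ofReal ((polarCoord.symm p).2 / ((polarCoord.symm p).2^2 + (polarCoord.symm p).1^2) - c)
      = ∫⁻ p in (Ioi (0:ℝ)) ×ˢ (Ioo (-Real.pi) Real.pi),
        ENNReal.ofReal (Real.sin p.2 - c * p.1) := by
    rw [polarCoord_target]
    refine setLIntegral_congr_fun (measurableSet_Ioi.prod measurableSet_Ioo) (fun p hp => ?_)
    have hp1 : 0 < p.1 := hp.1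
    simp only [polarCoord_symm_apply, smul_eq_mul]
    rw [← ENNReal.ofReal_mul hp1.le]
    congr 1
    have : (p.1 * Real.sin p.2)^2 + (p.1 * Real.cos p.2)^2 = p.1^2 := by
      have := Real.sin_sq_add_cos_sq p.2
      linear_combination p.1^2 * this
    rw [this]
    field_simp
  rw [h2, Measure.volume_eq_prod, ← Measure.prod_restrict, lintegral_prod_symm _ (by fun_prop)]
  exact (lintegral_mono (fun θ => bath_inner _ c hc)).trans (bath_outer c hc)

lemma kernel_bound (O : Set (EuclideanSpace ℝ (Fin 2))) (hO : IsOpen O) (ρ : ℝ) (hρ : 0 < ρ)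
    (hvol : volume O = ENNReal.ofReal (Real.pi * ρ^2))
    (u x : EuclideanSpace ℝ (Fin 2)) (ε : ℝ) (hε : 0 < ε) :
    ∫ y in O, inner ℝ u (x - y) / (‖x - y‖^2 + ε^2) ≤ ‖u‖ * (Real.pi * ρ) := by
  by_cases hu : u = 0
  · simp [hu]
  have hu' : 0 < ‖u‖ := norm_pos_iff.2 hu
  set e := ‖u‖⁻¹ • u with he
  have he1 : ‖e‖ = 1 := by rw [he, norm_smul, norm_inv, norm_norm]; field_simp
  have hue : u = ‖u‖ • e := by rw [he, smul_smul]; field_simp; simp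
  rw [hue]
  simp_rw [inner_smul_left, mul_div_assoc]
  rw [integral_const_mul, ← hue]
  simp only [conj_trivial]
  refine mul_le_mul_of_nonneg_left ?_ hu'.le
  set c := 1/(2*ρ) with hcdef
  have hc : 0 < c := by positivity
  have hpt : ∀ z : EuclideanSpace ℝ (Fin 2), ENNReal.ofReal (inner ℝ e z / (‖z‖^2 + ε^2))
      ≤ ENNReal.ofReal (inner ℝ e z / ‖z‖^2 - c) + ENNReal.ofReal c := by
    intro z
    rw [← ENNReal.ofReal_eq_ofReal_iff hc.le hc.le |>.2 rfl]
    rcases le_or_gt (inner ℝ e z) 0 with h | h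
    · rw [ENNReal.ofReal_of_nonpos (div_nonpos_of_nonpos_of_nonneg h (by positivity))]
      exact zero_le
    · have hz : z ≠ 0 := by rintro rfl; simp at h
      have hz' : 0 < ‖z‖ := norm_pos_iff.2 hz
      have : inner ℝ e z / (‖z‖^2 + ε^2) ≤ inner ℝ e z / ‖z‖^2 :=
        div_le_div_of_nonneg_left h.le (by positivity) (by nlinarith)
      calc _ ≤ ENNReal.ofReal ((inner ℝ e z / ‖z‖^2 - c) + c) :=
            ENNReal.ofReal_le_ofReal (by linarith)
        _ ≤ _ := ENNReal.ofReal_add_le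
  have hlin : ∫⁻ y in O, ENNReal.ofReal (inner ℝ e (x - y) / (‖x - y‖^2 + ε^2))
      ≤ ENNReal.ofReal (Real.pi * ρ) := by
    calc _ ≤ ∫⁻ y in O, (ENNReal.ofReal (inner ℝ e (x - y) / ‖x - y‖^2 - c) + ENNReal.ofReal c) :=
          lintegral_mono (fun y => hpt _)
      _ = (∫⁻ y in O, ENNReal.ofReal (inner ℝ e (x - y) / ‖x - y‖^2 - c))
          + ENNReal.ofReal c * volume O := by
          rw [lintegral_add_right _ measurable_const, setLIntegral_const]
      _ ≤ (∫⁻ y, ENNReal.ofReal (inner ℝ e (x - y) / ‖x - y‖^2 - c))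
          + ENNReal.ofReal c * volume O := by
          exact add_le_add (setLIntegral_le_lintegral _ _) le_rfl
      _ = (∫⁻ z, ENNReal.ofReal (inner ℝ e z / ‖z‖^2 - c))
          + ENNReal.ofReal c * volume O := by
          rw [lintegral_sub_left_eq_self
            (fun z => ENNReal.ofReal (inner ℝ e z / ‖z‖^2 - c)) x]
      _ ≤ ENNReal.ofReal (Real.pi/(4*c)) + ENNReal.ofReal c * volume O := by
          exact add_le_add (bath e he1 c hc) le_rfl
      _ = ENNReal.ofReal (Real.pi * ρ) := by
          rw [hvol, ← ENNReal.ofReal_mul hc.le, ← ENNReal.ofReal_add (by positivity) (by positivity)]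
          congr 1
          rw [hcdef]; field_simp; norm_num
  by_cases hi : IntegrableOn (fun y => inner ℝ e (x - y) / (‖x - y‖^2 + ε^2)) O
  · rw [integral_eq_lintegral_pos_part_sub_lintegral_neg_part hi]
    have : (∫⁻ y in O, ENNReal.ofReal (inner ℝ e (x - y) / (‖x - y‖^2 + ε^2))).toReal
      ≤ Real.pi * ρ := ENNReal.toReal_le_of_le_ofReal (by positivity) hlin
    have h2 := @ENNReal.toReal_nonneg
      (∫⁻ y in O, ENNReal.ofReal (-(inner ℝ e (x - y) / (‖x - y‖^2 + ε^2))))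
    linarith
  · rw [integral_undef hi]; positivity


lemma radial_fact : IntegrableOn (fun y : ℝ => y * (2 / (y^2+1)^2)) (Ioi 0) ∧
    ∫ y in Ioi (0:ℝ), y * (2 / (y^2+1)^2) = 1 := by
  have hd : ∀ x ∈ Ici (0:ℝ), HasDerivAt (fun y : ℝ => -(y^2+1)⁻¹) (x * (2 / (x^2+1)^2)) x := by
    intro x _
    have h1 : HasDerivAt (fun y : ℝ => y^2+1) (2*x) x := by
      simpa using (hasDerivAt_pow 2 x).add_const 1
    have h2 := (h1.inv (by positivity)).neg
    have e : x * (2 / (x^2+1)^2) = -(-(2 * x) / (x ^ 2 + 1) ^ 2) := by ring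
    rw [e]
    exact h2
  have hl : Tendsto (fun y : ℝ => -(y^2+1)⁻¹) atTop (𝓝 0) := by
    have : Tendsto (fun y : ℝ => y^2+1) atTop atTop :=
      tendsto_atTop_add_const_right _ _ (tendsto_pow_atTop two_ne_zero)
    simpa using this.inv_tendsto_atTop.neg
  have hp : ∀ x ∈ Ioi (0:ℝ), 0 ≤ x * (2 / (x^2+1)^2) := fun x hx => by
    have := mem_Ioi.1 hx; positivity
  refine ⟨integrableOn_Ioi_deriv_of_nonneg' hd hp hl, ?_⟩
  rw [integral_Ioi_of_hasDerivAt_of_nonneg' hd hp hl]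
  norm_num

lemma phi_integrable : Integrable (fun z : EuclideanSpace ℝ (Fin 2) => 2 / (‖z‖^2+1)^2) := by
  have := (integrable_fun_norm_addHaar (E := EuclideanSpace ℝ (Fin 2)) volume
    (f := fun y : ℝ => 2 / (y^2+1)^2))
  rw [this]
  simpa using radial_fact.1

lemma phi_integral : ∫ z : EuclideanSpace ℝ (Fin 2), 2 / (‖z‖^2+1)^2 = 2 * Real.pi := by
  have := (integral_fun_norm_addHaar (E := EuclideanSpace ℝ (Fin 2)) volume
    (f := fun y : ℝ => 2 / (y^2+1)^2))
  rw [this]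
  have h := radial_fact.2
  simp only [finrank_euclideanSpace, Fintype.card_fin, Nat.add_one_sub_one, pow_one, smul_eq_mul, h,
    Measure.real, EuclideanSpace.volume_ball_fin_two]
  simp [ENNReal.toReal_ofReal Real.pi_pos.le]

lemma scale_eq (O : Set (EuclideanSpace ℝ (Fin 2))) (hO : IsOpen O)
    (y : EuclideanSpace ℝ (Fin 2)) (ε : ℝ) (hε : 0 < ε) :
    ∫ x in O, 2*ε^2 / (‖x-y‖^2+ε^2)^2 =
      ∫ z, (O.indicator 1 (y + ε • z) : ℝ) * (2 / (‖z‖^2+1)^2) := by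
  rw [← integral_indicator hO.measurableSet]
  rw [← integral_add_left_eq_self _ y]
  have := Measure.integral_comp_smul (volume : Measure (EuclideanSpace ℝ (Fin 2)))
    (fun w => O.indicator (fun x => 2*ε^2 / (‖x-y‖^2+ε^2)^2) (y + w)) ε
  rw [finrank_euclideanSpace, Fintype.card_fin, abs_of_pos (by positivity), eq_inv_smul_iff₀ (by positivity)] at this
  rw [← this, smul_eq_mul, ← integral_const_mul]
  congr 1
  ext z
  by_cases h : y + ε • z ∈ O
  · rw [indicator_of_mem h, indicator_of_mem h, add_sub_cancel_left, norm_smul,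
      Real.norm_of_nonneg hε.le]
    simp only [Pi.one_apply]
    have : (ε * ‖z‖)^2 + ε^2 = ε^2 * (‖z‖^2+1) := by ring
    rw [this]
    field_simp
  · rw [indicator_of_notMem h, indicator_of_notMem h]
    simp

lemma limit_inner (O : Set (EuclideanSpace ℝ (Fin 2))) (hO : IsOpen O)
    (y : EuclideanSpace ℝ (Fin 2)) (hy : y ∈ O) :
    Tendsto (fun k : ℕ => ∫ x in O, 2*(1/((k:ℝ)+1))^2 / (‖x-y‖^2+(1/((k:ℝ)+1))^2)^2) atTop
      (𝓝 (2 * Real.pi)) := by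
  have hk : ∀ k : ℕ, 0 < 1/((k:ℝ)+1) := fun k => by positivity
  simp_rw [fun k : ℕ => scale_eq O hO y _ (hk k)]
  rw [← phi_integral]
  refine tendsto_integral_of_dominated_convergence
    (fun z => 2 / (‖z‖^2+1)^2) (fun k => ?_) phi_integrable (fun k => ?_) ?_
  · refine AEStronglyMeasurable.mul ?_ phi_integrable.aestronglyMeasurable
    refine Measurable.aestronglyMeasurable ?_
    exact (measurable_one.indicator hO.measurableSet).comp (by fun_prop)
  · refine Eventually.of_forall (fun z => ?_)
    rw [norm_mul, Real.norm_of_nonneg (by positivity : (0:ℝ) ≤ 2 / (‖z‖^2+1)^2)]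
    refine mul_le_of_le_one_left (by positivity) ?_
    refine (norm_indicator_le_norm_self _ _).trans ?_
    simp
  · refine Eventually.of_forall (fun z => ?_)
    have h1 : Tendsto (fun k : ℕ => y + (1/((k:ℝ)+1)) • z) atTop (𝓝 y) := by
      have := (tendsto_one_div_add_atTop_nhds_zero_nat (𝕜 := ℝ)).smul_const z
      simpa using this.const_add y
    refine tendsto_const_nhds.congr' ?_
    filter_upwards [h1 (hO.mem_nhds hy)] with k hk
    rw [indicator_of_mem (by exact hk)]
    simp

lemma inner_le (O : Set (EuclideanSpace ℝ (Fin 2))) (hO : IsOpen O)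
    (y : EuclideanSpace ℝ (Fin 2)) (ε : ℝ) (hε : 0 < ε) :
    ‖∫ x in O, 2*ε^2 / (‖x-y‖^2+ε^2)^2‖ ≤ 2 * Real.pi := by
  rw [scale_eq O hO y _ hε, ← phi_integral]
  refine norm_integral_le_of_norm_le phi_integrable (Eventually.of_forall (fun z => ?_))
  rw [norm_mul, Real.norm_of_nonneg (by positivity : (0:ℝ) ≤ 2 / (‖z‖^2+1)^2)]
  refine mul_le_of_le_one_left (by positivity) ?_
  refine (norm_indicator_le_norm_self _ _).trans ?_
  simp

lemma limit_outer (O : Set (EuclideanSpace ℝ (Fin 2))) (hO : IsOpen O)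
    (hf : volume O ≠ ⊤) :
    Tendsto (fun k : ℕ => ∫ y in O, ∫ x in O,
      2*(1/((k:ℝ)+1))^2 / (‖x-y‖^2+(1/((k:ℝ)+1))^2)^2) atTop
      (𝓝 (2 * Real.pi * (volume O).toReal)) := by
  have hk : ∀ k : ℕ, 0 < 1/((k:ℝ)+1) := fun k => by positivity
  have e1 : 2 * Real.pi * (volume O).toReal = ∫ y in O, 2 * Real.pi := by
    rw [setIntegral_const, smul_eq_mul, Measure.real, mul_comm]
  rw [e1]
  refine tendsto_integral_of_dominated_convergence
    (fun z => 2 * Real.pi) (fun k => ?_) ?_ (fun k => ?_) ?_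
  · refine StronglyMeasurable.aestronglyMeasurable ?_
    refine StronglyMeasurable.integral_prod_right (ν := volume.restrict O)
      (f := fun y x : EuclideanSpace ℝ (Fin 2) =>
       2*(1/((k:ℝ)+1))^2 / (‖x-y‖^2+(1/((k:ℝ)+1))^2)^2) ?_
    refine Measurable.stronglyMeasurable ?_
    unfold Function.uncurry
    fun_prop
  · exact integrableOn_const hf
  · exact Eventually.of_forall (fun y => inner_le O hO y _ (hk k))
  · filter_upwards [ae_restrict_mem hO.measurableSet] with y hy
    exact limit_inner O hO y hy


lemma kern_contDiff (v y : EuclideanSpace ℝ (Fin 2)) (ε : ℝ) (hε : 0 < ε) :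
    ContDiff ℝ 1 (fun x => inner ℝ v (x - y) / (‖x - y‖^2 + ε^2)) := by
  refine ContDiff.div ?_ ?_ (fun x => by positivity)
  · exact contDiff_const.inner ℝ (contDiff_id.sub contDiff_const)
  · exact ((contDiff_id.sub contDiff_const).norm_sq ℝ).add contDiff_const

lemma kern_deriv (v y x : EuclideanSpace ℝ (Fin 2)) (ε : ℝ) (hε : 0 < ε) (hv : ‖v‖ = 1) :
    fderiv ℝ (fun x => inner ℝ v (x - y) / (‖x - y‖^2 + ε^2)) x v
      = ((‖x - y‖^2 + ε^2) - 2 * (inner ℝ v (x-y))^2) / (‖x - y‖^2 + ε^2)^2 := by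
  have hne : ‖x - y‖^2 + ε^2 ≠ 0 := by positivity
  have hdiff : DifferentiableAt ℝ (fun x => inner ℝ v (x - y) / (‖x - y‖^2 + ε^2)) x :=
    (kern_contDiff v y ε hε).differentiable one_ne_zero x
  rw [← hdiff.lineDeriv_eq_fderiv]
  refine HasLineDerivAt.lineDeriv ?_
  unfold HasLineDerivAt
  have e1 : (fun t : ℝ => inner ℝ v (x + t • v - y) / (‖x + t • v - y‖^2 + ε^2))
      = fun t : ℝ => (inner ℝ v (x-y) + t) /
        (‖x - y‖^2 + ε^2 + (2 * (t * inner ℝ v (x-y)) + t^2)) := by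
    ext t
    rw [add_sub_right_comm, inner_add_right, inner_smul_right, real_inner_self_eq_norm_sq,
      norm_add_sq_real, inner_smul_right, norm_smul, hv, real_inner_comm v (x-y)]
    simp only [mul_one, one_pow, Real.norm_eq_abs, sq_abs]
    congr 1
    ring
  rw [e1]
  have h1 : HasDerivAt (fun t : ℝ => inner ℝ v (x-y) + t) 1 0 :=
    (hasDerivAt_id (0:ℝ)).const_add _
  have h2 : HasDerivAt (fun t : ℝ => ‖x - y‖^2 + ε^2 + (2 * (t * inner ℝ v (x-y)) + t^2))
      (2 * (1 * inner ℝ v (x-y)) + 2 * 0) 0 := by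
    refine HasDerivAt.const_add _ (HasDerivAt.add ?_ ?_)
    · exact ((hasDerivAt_id (0:ℝ)).mul_const _).const_mul 2
    · simpa using hasDerivAt_pow 2 (0:ℝ)
  have h3 := h1.fun_div h2 (by simpa using hne)
  have e2 : ((‖x - y‖^2 + ε^2) - 2 * (inner ℝ v (x-y))^2) / (‖x - y‖^2 + ε^2)^2 =
     (1 * (‖x - y‖^2 + ε^2 + (2 * (0 * inner ℝ v (x-y)) + 0^2)) -
      (inner ℝ v (x-y) + 0) * (2 * (1 * inner ℝ v (x-y)) + 2 * 0)) /
      (‖x - y‖^2 + ε^2 + (2 * (0 * inner ℝ v (x-y)) + 0^2))^2 := by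
    congr 1 <;> ring
  rw [e2]
  exact h3

lemma div_identity (O D : Set (EuclideanSpace ℝ (Fin 2)))
    (hb : Bornology.IsBounded O) (hD : IsCompact D)
    (g : EuclideanSpace ℝ (Fin 2) → EuclideanSpace ℝ (Fin 2))
    (hgi : Integrable g (μH[1].restrict D))
    (hg : ∀ f : EuclideanSpace ℝ (Fin 2) → ℝ, ContDiff ℝ 1 f → ∀ v,
      ∫ x in O, fderiv ℝ f x v = ∫ x in D, f x * inner ℝ (g x) v ∂μH[1])
    (y : EuclideanSpace ℝ (Fin 2)) (ε : ℝ) (hε : 0 < ε) :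
    ∫ x in O, 2*ε^2 / (‖x-y‖^2+ε^2)^2
      = ∫ x in D, inner ℝ (g x) (x - y) / (‖x - y‖^2 + ε^2) ∂μH[1] := by
  set b := EuclideanSpace.basisFun (Fin 2) ℝ
  have hb1 : ∀ k, ‖b k‖ = 1 := fun k => b.orthonormal.1 k
  have key := fun k => hg _ (kern_contDiff (b k) y ε hε) (b k)
  have hI1 : ∀ k, IntegrableOn (fun x => fderiv ℝ
      (fun x => inner ℝ (b k) (x - y) / (‖x - y‖^2 + ε^2)) x (b k)) O := fun k =>
      ((((((kern_contDiff (b k) y ε hε)).continuous_fderiv one_ne_zero).clm_apply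
        continuous_const).continuousOn).integrableOn_compact hb.isCompact_closure).mono_set
          subset_closure
  have hI2 : ∀ k, Integrable (fun x => inner ℝ (b k) (x - y) / (‖x - y‖^2 + ε^2) *
      inner ℝ (g x) (b k)) (μH[1].restrict D) := by
    intro k
    have hc := (kern_contDiff (b k) y ε hε).continuous
    obtain ⟨C, hC⟩ := hD.exists_bound_of_continuousOn hc.continuousOn
    refine Integrable.bdd_mul (c := C) ?_ hc.aestronglyMeasurable ?_
    · exact hgi.inner_const (b k)
    · filter_upwards [ae_restrict_mem hD.measurableSet] with x hx
      exact hC x hx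
  have hs := Finset.sum_congr (rfl : (Finset.univ : Finset (Fin 2)) = Finset.univ)
    (fun k _ => key k)
  rw [← integral_finsetSum _ (fun k _ => hI1 k), ← integral_finsetSum _ (fun k _ => hI2 k)] at hs
  refine Eq.trans ?_ (hs.trans ?_)
  · congr 1
    ext x
    simp_rw [fun k => kern_deriv (b k) y x ε hε (hb1 k)]
    rw [← Finset.sum_div, Finset.sum_sub_distrib, ← Finset.mul_sum]
    have : ∑ k, (inner ℝ (b k) (x-y))^2 = ‖x - y‖^2 := by
      rw [← real_inner_self_eq_norm_sq, ← b.sum_inner_mul_inner (x-y) (x-y)]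
      refine Finset.sum_congr rfl (fun k _ => ?_)
      rw [real_inner_comm, sq]
    rw [this]
    simp
  · congr 1
    ext x
    rw [← b.sum_inner_mul_inner (g x) (x-y), Finset.sum_div]
    refine Finset.sum_congr rfl (fun k _ => ?_)
    ring

lemma isoperimetric (O D S : Set (EuclideanSpace ℝ (Fin 2))) (hO : IsOpen O)
    (hb : Bornology.IsBounded O) (hD : IsCompact D) (hDf : μH[1] D ≠ ⊤)
    (ρ : ℝ) (hρ : 0 < ρ) (hvol : volume O = ENNReal.ofReal (Real.pi * ρ^2))
    (g : EuclideanSpace ℝ (Fin 2) → EuclideanSpace ℝ (Fin 2)) (hgm : Measurable g)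
    (hgi : Integrable g (μH[1].restrict D))
    (hg : ∀ f : EuclideanSpace ℝ (Fin 2) → ℝ, ContDiff ℝ 1 f → ∀ v,
      ∫ x in O, fderiv ℝ f x v = ∫ x in D, f x * inner ℝ (g x) v ∂μH[1])
    (hS : MeasurableSet S)
    (hgS : ∀ᵐ x ∂(μH[1].restrict D), ‖g x‖ ≤ S.indicator 1 x) :
    2 * Real.pi * ρ ≤ (μH[1].restrict D S).toReal := by
  set H : Measure (EuclideanSpace ℝ (Fin 2)) := μH[1].restrict D with hH
  have : IsFiniteMeasure H := ⟨by rw [hH, Measure.restrict_apply_univ]; exact hDf.lt_top⟩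
  have hvf : volume O ≠ ⊤ := by rw [hvol]; exact ENNReal.ofReal_ne_top
  have : IsFiniteMeasure (volume.restrict O) :=
    ⟨by rw [Measure.restrict_apply_univ]; exact hvf.lt_top⟩
  have bound : ∀ ε : ℝ, 0 < ε → ∫ y in O, ∫ x in O, 2*ε^2 / (‖x-y‖^2+ε^2)^2
      ≤ Real.pi * ρ * (H S).toReal := by
    intro ε hε
    simp_rw [fun y => div_identity O D hb hD g hgi hg y ε hε]
    have hF : Integrable (Function.uncurry fun y x : EuclideanSpace ℝ (Fin 2) =>
        inner ℝ (g x) (x - y) / (‖x - y‖^2 + ε^2)) ((volume.restrict O).prod H) := by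
      have h1 : Integrable (fun p : EuclideanSpace ℝ (Fin 2) × EuclideanSpace ℝ (Fin 2) =>
          (ε⁻¹) * ‖g p.2‖) ((volume.restrict O).prod H) :=
        ((hgi.norm).comp_snd _).const_mul _
      refine h1.mono' ?_ (Eventually.of_forall ?_)
      · refine Measurable.aestronglyMeasurable ?_
        unfold Function.uncurry
        fun_prop
      · rintro ⟨y, x⟩
        simp only [Function.uncurry]
        rw [norm_div, Real.norm_of_nonneg (by positivity : (0:ℝ) ≤ ‖x-y‖^2+ε^2), div_le_iff₀ (by positivity)]
        refine (norm_inner_le_norm _ _).trans ?_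
        have h3 : ‖x - y‖ ≤ ε⁻¹ * (‖x-y‖^2+ε^2) := by
          rw [← div_eq_inv_mul, le_div_iff₀ hε]
          nlinarith [sq_nonneg (‖x-y‖ - ε), norm_nonneg (x-y), sq_nonneg (‖x-y‖ + ε)]
        calc ‖g x‖ * ‖x - y‖ ≤ ‖g x‖ * (ε⁻¹ * (‖x-y‖^2+ε^2)) :=
              mul_le_mul_of_nonneg_left h3 (norm_nonneg _)
          _ = _ := by ring
    rw [integral_integral_swap hF]
    calc _ ≤ ∫ x, ‖g x‖ * (Real.pi * ρ) ∂H := by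
            refine integral_mono hF.integral_prod_right (hgi.norm.mul_const _) (fun x => ?_)
            exact kernel_bound O hO ρ hρ hvol (g x) x ε hε
        _ = (∫ x, ‖g x‖ ∂H) * (Real.pi * ρ) := integral_mul_const _ _
        _ ≤ (∫ x, S.indicator 1 x ∂H) * (Real.pi * ρ) := by
            refine mul_le_mul_of_nonneg_right ?_ (by positivity)
            refine integral_mono_ae hgi.norm ?_ hgS
            exact (integrable_const (1:ℝ)).indicator hS
        _ = Real.pi * ρ * (H S).toReal := by
            rw [integral_indicator_one hS, mul_comm, Measure.real]
  have hlim := limit_outer O hO hvf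
  have hle := le_of_tendsto hlim (Eventually.of_forall (fun k : ℕ =>
    bound (1/((k:ℝ)+1)) (by positivity)))
  rw [hvol, ENNReal.toReal_ofReal (by positivity)] at hle
  have hpos : 0 < Real.pi * ρ := by positivity
  refine le_of_mul_le_mul_left ?_ hpos
  calc _ = 2 * Real.pi * (Real.pi * ρ^2) := by ring
    _ ≤ _ := hle


lemma norm_le_one_of_dirs (H : Measure (EuclideanSpace ℝ (Fin 2)))
    (g : EuclideanSpace ℝ (Fin 2) → EuclideanSpace ℝ (Fin 2))
    (hd : ∀ v : EuclideanSpace ℝ (Fin 2), ‖v‖ = 1 → ∀ᵐ x ∂H, |inner ℝ (g x) v| ≤ 1) :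
    ∀ᵐ x ∂H, ‖g x‖ ≤ 1 := by
  have h1 : ∀ v : EuclideanSpace ℝ (Fin 2), ∀ᵐ x ∂H, |inner ℝ (g x) v| ≤ ‖v‖ := by
    intro v
    by_cases hv : v = 0
    · simp [hv]
    have hv' : 0 < ‖v‖ := norm_pos_iff.2 hv
    have := hd (‖v‖⁻¹ • v) (by rw [norm_smul, norm_inv, norm_norm]; field_simp)
    filter_upwards [this] with x hx
    rw [inner_smul_right, abs_mul, abs_of_pos (inv_pos.2 hv'), ← div_eq_inv_mul,
      div_le_one hv'] at hx
    exact hx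
  have h2 := ae_all_iff.2 (fun k => h1 (TopologicalSpace.denseSeq (EuclideanSpace ℝ (Fin 2)) k))
  filter_upwards [h2] with x hx
  have h3 : ∀ v, |inner ℝ (g x) v| ≤ ‖v‖ := by
    intro v
    refine (TopologicalSpace.denseRange_denseSeq (EuclideanSpace ℝ (Fin 2))).induction_on
      (p := fun v => |inner ℝ (g x) v| ≤ ‖v‖) v ?_ hx
    exact isClosed_le (by fun_prop) (by fun_prop)
  have h4 := h3 (g x)
  rw [real_inner_self_eq_norm_sq, abs_of_nonneg (by positivity)] at h4
  by_contra hcon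
  push Not at hcon
  nlinarith

lemma exists_direction {m : ℕ} (H : Measure (EuclideanSpace ℝ (Fin 2))) [IsFiniteMeasure H]
    (g : Fin m → EuclideanSpace ℝ (Fin 2) → EuclideanSpace ℝ (Fin 2))
    (hgm : ∀ i, Measurable (g i)) :
    ∃ e : EuclideanSpace ℝ (Fin 2), ‖e‖ = 1 ∧
      ∀ i, ∀ᵐ x ∂H, g i x ≠ 0 → inner ℝ (g i x) e ≠ 0 := by
  let d : ℝ → EuclideanSpace ℝ (Fin 2) := fun t => !₂[1, t]
  have hin : ∀ (a : EuclideanSpace ℝ (Fin 2)) (t : ℝ), inner ℝ a (d t) = a 0 + t * a 1 := by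
    intro a t
    simp [d, PiLp.inner_apply, Fin.sum_univ_two]
  have hc : ∀ i, Set.Countable {t : ℝ | 0 < H {x | g i x ≠ 0 ∧ inner ℝ (g i x) (d t) = 0}} := by
    intro i
    refine Measure.countable_meas_pos_of_disjoint_iUnion (fun t => ?_) ?_
    · refine MeasurableSet.inter ?_ ?_
      · exact (hgm i (measurableSet_singleton 0)).compl
      · exact measurableSet_eq_fun (by have := hgm i; fun_prop) measurable_const
    · intro t s hts
      rw [Function.onFun, Set.disjoint_left]
      rintro x ⟨h1, h2⟩ ⟨-, h3⟩
      rw [hin] at h2 h3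
      apply h1
      have h4 : (t - s) * g i x 1 = 0 := by linarith
      have h5 : g i x 1 = 0 := (mul_eq_zero.1 h4).resolve_left (sub_ne_zero.2 hts)
      have h6 : g i x 0 = 0 := by rw [h5] at h2; linarith
      ext k
      fin_cases k
      · exact h6
      · exact h5
  have hcu := Set.countable_iUnion hc
  obtain ⟨t, ht⟩ : ∃ t, t ∉ ⋃ i, {t : ℝ | 0 < H {x | g i x ≠ 0 ∧ inner ℝ (g i x) (d t) = 0}} := by
    by_contra hcon
    push Not at hcon
    exact Cardinal.not_countable_real (hcu.mono (fun t _ => hcon t))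
  have hdne : d t ≠ 0 := by
    intro h
    have := congrArg (fun v : EuclideanSpace ℝ (Fin 2) => v 0) h
    simp [d] at this
  have hdp : 0 < ‖d t‖ := norm_pos_iff.2 hdne
  refine ⟨‖d t‖⁻¹ • d t, by rw [norm_smul, norm_inv, norm_norm]; field_simp, fun i => ?_⟩
  have h0 : H {x | g i x ≠ 0 ∧ inner ℝ (g i x) (d t) = 0} = 0 := by
    by_contra hne
    exact ht (mem_iUnion.2 ⟨i, pos_iff_ne_zero.2 hne⟩)
  have h1 : ∀ᵐ x ∂H, ¬ (g i x ≠ 0 ∧ inner ℝ (g i x) (d t) = 0) := measure_eq_zero_iff_ae_notMem.1 h0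
  filter_upwards [h1] with x hx hgx
  rw [inner_smul_right]
  refine mul_ne_zero (inv_ne_zero hdp.ne') (fun h => hx ⟨hgx, h⟩)

lemma radj_disj {O₁ O₂ : Set (EuclideanSpace ℝ (Fin 2))} (h : Disjoint O₁ O₂)
    (v x : EuclideanSpace ℝ (Fin 2)) (h1 : RAdj O₁ v x) (h2 : RAdj O₂ v x) : False := by
  obtain ⟨a, ha, h1⟩ := h1
  obtain ⟨b, hb, h2⟩ := h2
  have hab : 0 < min a b := lt_min ha hb
  have l1 := min_le_left a b
  have l2 := min_le_right a b
  exact Set.disjoint_left.1 h (h1 (min a b / 2) ⟨by linarith, by linarith⟩)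
    (h2 (min a b / 2) ⟨by linarith, by linarith⟩)

lemma radj_front {A O₁ O₂ : Set (EuclideanSpace ℝ (Fin 2))} (hA : Convex ℝ A)
    (h1s : O₁ ⊆ interior A) (h2s : O₂ ⊆ interior A)
    (v x : EuclideanSpace ℝ (Fin 2)) (h1 : RAdj O₁ v x) (h2 : RAdj O₂ (-v) x) :
    x ∈ interior A := by
  obtain ⟨a, ha, h1⟩ := h1
  obtain ⟨b, hb, h2⟩ := h2
  have hab : 0 < min a b := lt_min ha hb
  have l1 := min_le_left a b
  have l2 := min_le_right a b
  have p1 := h1s (h1 (min a b / 2) ⟨by linarith, by linarith⟩)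
  have p2 := h2s (h2 (min a b / 2) ⟨by linarith, by linarith⟩)
  have := hA.interior p1 p2 (a := 1/2) (b := 1/2) (by norm_num) (by norm_num) (by norm_num)
  convert this using 1
  module

lemma counting {m : ℕ} (A : Set (EuclideanSpace ℝ (Fin 2))) (hA : Convex ℝ A) (hAc : IsCompact A)
    (O : Fin m → Set (EuclideanSpace ℝ (Fin 2))) (hO : ∀ i, IsOpen (O i))
    (hdisj : ∀ i j, i ≠ j → Disjoint (O i) (O j)) (hOA : ∀ i, O i ⊆ interior A)
    (ρ : ℝ) (hρ : 0 < ρ) (hvol : ∀ i, volume (O i) = ENNReal.ofReal (Real.pi * ρ^2))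
    (hf : μH[1] (A \ ⋃ i, O i) ≠ ⊤) :
    ENNReal.ofReal (m * (2 * Real.pi * ρ)) ≤
      2 * μH[1] ((A \ ⋃ i, O i) ∩ interior A) + μH[1] (frontier A) := by
  set D := A \ ⋃ i, O i with hDdef
  have hD : IsCompact D := hAc.diff (isOpen_iUnion hO)
  have hfr : ∀ i, frontier (O i) ⊆ D := by
    intro i x hx
    rw [(hO i).frontier_eq] at hx
    refine ⟨?_, ?_⟩
    · exact closure_minimal ((hOA i).trans interior_subset) hAc.isClosed hx.1
    · intro hx2
      obtain ⟨j, hj⟩ := mem_iUnion.1 hx2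
      by_cases hij : i = j
      · subst hij; exact hx.2 hj
      · obtain ⟨y, hy1, hy2⟩ := mem_closure_iff.1 hx.1 (O j) (hO j) hj
        exact Set.disjoint_left.1 (hdisj i j hij) hy2 hy1
  have hb : ∀ i, Bornology.IsBounded (O i) := fun i =>
    hAc.isBounded.subset ((hOA i).trans interior_subset)
  choose g hgm hgi hg hgd using fun i => exists_density (O i) D (hO i) (hb i) hD hf (hfr i)
  have hfin : IsFiniteMeasure ((μH[1] : Measure (EuclideanSpace ℝ (Fin 2))).restrict D) :=
    ⟨by rw [Measure.restrict_apply_univ]; exact hf.lt_top⟩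
  obtain ⟨e, he, hge⟩ := exists_direction (μH[1].restrict D) g hgm
  let P : Fin m → Set (EuclideanSpace ℝ (Fin 2)) := fun i => {x | RAdj (O i) e x}
  let N : Fin m → Set (EuclideanSpace ℝ (Fin 2)) := fun i => {x | RAdj (O i) (-e) x}
  have hPm : ∀ i, MeasurableSet (P i) := fun i => measurableSet_RAdj (hO i) e
  have hNm : ∀ i, MeasurableSet (N i) := fun i => measurableSet_RAdj (hO i) (-e)
  have hiso : ∀ i, ENNReal.ofReal (2 * Real.pi * ρ) ≤ μH[1].restrict D (P i ∪ N i) := by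
    intro i
    refine ENNReal.ofReal_le_of_le_toReal ?_
    refine isoperimetric (O i) D _ (hO i) (hb i) hD hf ρ hρ (hvol i) (g i) (hgm i) (hgi i) (hg i)
      ((hPm i).union (hNm i)) ?_
    have hn := norm_le_one_of_dirs (μH[1].restrict D) (g i) (fun v hv => by
      filter_upwards [hgd i v hv] with x hx
      refine hx.trans ?_
      exact Set.indicator_le_self' (f := 1) (fun _ _ => zero_le_one) x)
    filter_upwards [hn, hgd i e he, hge i] with x hx1 hx2 hx3
    by_cases h0 : g i x = 0
    · rw [h0, norm_zero]
      exact Set.indicator_nonneg (fun _ _ => zero_le_one) x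
    · have h4 := abs_pos.2 (hx3 h0)
      by_cases hx : x ∈ P i ∪ N i
      · rw [indicator_of_mem hx]; exact hx1
      · rw [indicator_of_notMem hx] at *
        exfalso
        rw [indicator_of_notMem (by exact hx)] at hx2
        linarith
  have hDm := hD.measurableSet
  have hAm := hAc.isClosed.measurableSet
  have hsplit : ∀ i, μH[1].restrict D (P i ∪ N i) ≤
      (μH[1].restrict (D ∩ interior A)) (P i) + (μH[1].restrict (D ∩ interior A)) (N i)
        + (μH[1].restrict (frontier A)) (P i ∪ N i) := by
    intro i
    have hm := (hPm i).union (hNm i)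
    rw [Measure.restrict_apply (hPm i), Measure.restrict_apply (hNm i), Measure.restrict_apply hm,
      Measure.restrict_apply hm]
    refine le_trans (measure_mono ?_) ((measure_union_le _ _).trans
      (add_le_add (measure_union_le _ _) le_rfl))
    rintro x ⟨hx, hxD⟩
    by_cases hxi : x ∈ interior A
    · left
      rcases hx with hx | hx
      · exact Or.inl ⟨hx, hxD, hxi⟩
      · exact Or.inr ⟨hx, hxD, hxi⟩
    · right
      refine ⟨hx, subset_closure hxD.1, hxi⟩
  have hsP : ∑ i, (μH[1].restrict (D ∩ interior A)) (P i) ≤ μH[1] (D ∩ interior A) := by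
    refine (sum_measure_le_measure_univ (fun i _ => (hPm i).nullMeasurableSet) ?_).trans
      (by rw [Measure.restrict_apply_univ])
    intro i _ j _ hij
    exact Disjoint.aedisjoint (Set.disjoint_left.2 (fun x h1 h2 =>
      radj_disj (hdisj i j hij) e x h1 h2))
  have hsN : ∑ i, (μH[1].restrict (D ∩ interior A)) (N i) ≤ μH[1] (D ∩ interior A) := by
    refine (sum_measure_le_measure_univ (fun i _ => (hNm i).nullMeasurableSet) ?_).trans
      (by rw [Measure.restrict_apply_univ])
    intro i _ j _ hij
    exact Disjoint.aedisjoint (Set.disjoint_left.2 (fun x h1 h2 =>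
      radj_disj (hdisj i j hij) (-e) x h1 h2))
  have hsF : ∑ i, (μH[1].restrict (frontier A)) (P i ∪ N i) ≤ μH[1] (frontier A) := by
    have hfm : MeasurableSet (frontier A) := isClosed_frontier.measurableSet
    have e1 : ∀ i, (μH[1].restrict (frontier A)) (P i ∪ N i) =
        (μH[1].restrict (frontier A)) ((P i ∪ N i) ∩ frontier A) := by
      intro i
      have hm := (hPm i).union (hNm i)
      rw [Measure.restrict_apply hm, Measure.restrict_apply (hm.inter hfm), inter_assoc, inter_self]
    simp_rw [e1]
    refine (sum_measure_le_measure_univ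
      (fun i _ => (((hPm i).union (hNm i)).inter hfm).nullMeasurableSet) ?_).trans
      (by rw [Measure.restrict_apply_univ])
    intro i _ j _ hij
    refine Disjoint.aedisjoint (Set.disjoint_left.2 ?_)
    rintro x ⟨h1, h3⟩ ⟨h2, -⟩
    rcases h1 with h1 | h1 <;> rcases h2 with h2 | h2
    · exact radj_disj (hdisj i j hij) e x h1 h2
    · exact h3.2 (radj_front hA (hOA i) (hOA j) e x h1 h2)
    · exact h3.2 (radj_front hA (hOA j) (hOA i) e x h2 h1)
    · exact radj_disj (hdisj i j hij) (-e) x h1 h2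
  calc ENNReal.ofReal (m * (2 * Real.pi * ρ)) = ∑ i : Fin m, ENNReal.ofReal (2 * Real.pi * ρ) := by
        rw [Finset.sum_const, Finset.card_univ, Fintype.card_fin, nsmul_eq_mul,
          ENNReal.ofReal_mul (by positivity), ENNReal.ofReal_natCast]
    _ ≤ ∑ i : Fin m, ((μH[1].restrict (D ∩ interior A)) (P i)
        + (μH[1].restrict (D ∩ interior A)) (N i)
        + (μH[1].restrict (frontier A)) (P i ∪ N i)) :=
        Finset.sum_le_sum (fun i _ => (hiso i).trans (hsplit i))
    _ ≤ _ := by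
        rw [Finset.sum_add_distrib, Finset.sum_add_distrib, two_mul]
        exact add_le_add (add_le_add hsP hsN) hsF


lemma poly_frontier (v u : ℕ → EuclideanSpace ℝ (Fin 2)) (n : ℕ) (r : ℝ) (hr : 0 < r)
    (A : Set (EuclideanSpace ℝ (Fin 2))) (hA : Convex ℝ A) (hAc : IsClosed A)
    (hv : ∀ k ≤ n, v k ∈ A) (hu : ∀ k < n, ‖u k‖ = 1)
    (huA : ∀ k < n, ∀ z ∈ A, inner ℝ (u k) z ≤ r)
    (heq : ∀ k < n, inner ℝ (u k) (v k) = r ∧ inner ℝ (u k) (v (k+1)) = r)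
    (sector : ∀ x, ∃ k < n, ∃ α β : ℝ, 0 ≤ α ∧ 0 ≤ β ∧ x = α • v k + β • v (k+1)) :
    frontier A ⊆ ⋃ k ∈ Finset.range n, segment ℝ (v k) (v (k+1)) := by
  have h0 : (0 : EuclideanSpace ℝ (Fin 2)) ∈ A := by
    obtain ⟨k, hk, α, β, ha, hb, h⟩ := sector (- v 0)
    have h2 := hA.sum_mem (t := Finset.univ) (w := ![1/(1+α+β), α/(1+α+β), β/(1+α+β)])
      (z := ![v 0, v k, v (k+1)]) ?_ ?_ ?_
    · convert h2 using 1
      simp only [Fin.sum_univ_three]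
      simp
      have : α • v k + β • v (k+1) + v 0 = 0 := by rw [← h]; simp
      have h3 : v 0 = - (α • v k + β • v (k+1)) := by rw [← h]; simp
      rw [h3]
      module
    · intro i _
      fin_cases i <;> simp <;> positivity
    · simp [Fin.sum_univ_three]
      field_simp
    · intro i _
      fin_cases i
      · exact hv 0 (by omega)
      · exact hv k (by omega)
      · exact hv (k+1) (by omega)
  have hsum : ∀ k < n, ∀ α β : ℝ, inner ℝ (u k) (α • v k + β • v (k+1)) = (α+β) * r := by
    intro k hk α β
    rw [inner_add_right, inner_smul_right, inner_smul_right, (heq k hk).1, (heq k hk).2]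
    ring
  have hin : ∀ k < n, ∀ α β : ℝ, 0 ≤ α → 0 ≤ β → 0 < α + β → 
      (α+β)⁻¹ • (α • v k + β • v (k+1)) ∈ segment ℝ (v k) (v (k+1)) := by
    intro k hk α β ha hb hab
    refine ⟨(α+β)⁻¹ * α, (α+β)⁻¹ * β, by positivity, by positivity, by field_simp, ?_⟩
    module
  have hsegA : ∀ k < n, segment ℝ (v k) (v (k+1)) ⊆ A := fun k hk =>
    hA.segment_subset (hv k (by omega)) (hv (k+1) (by omega))
  have hlt : ∀ k < n, ∀ α β : ℝ, 0 ≤ α → 0 ≤ β → α + β ≤ 1 → α • v k + β • v (k+1) ∈ A := by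
    intro k hk α β ha hb hab
    rcases eq_or_lt_of_le (add_nonneg ha hb) with h | h
    · have h1 : α = 0 := by linarith
      have h2 : β = 0 := by linarith
      rw [h1, h2]; simpa using h0
    · have h3 := hA h0 (hsegA k hk (hin k hk α β ha hb h)) (a := 1 - (α+β)) (b := α + β)
        (by linarith) h.le (by ring)
      rwa [smul_zero, zero_add, smul_smul, mul_inv_cancel₀ h.ne', one_smul] at h3
  have hint : (0 : EuclideanSpace ℝ (Fin 2)) ∈ interior A := by
    rw [mem_interior_iff_mem_nhds]
    refine mem_of_superset (Metric.ball_mem_nhds 0 hr) (fun z hz => ?_)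
    obtain ⟨k, hk, α, β, ha, hb, h⟩ := sector z
    rw [h]
    refine hlt k hk α β ha hb ?_
    have h1 := real_inner_le_norm (u k) z
    rw [h, hsum k hk, hu k hk, ← h, one_mul] at h1
    rw [mem_ball_zero_iff] at hz
    by_contra hcon
    push Not at hcon
    nlinarith
  intro x hx
  have hxA : x ∈ A := hAc.frontier_subset hx
  obtain ⟨k, hk, α, β, ha, hb, h⟩ := sector x
  have h1 := huA k hk x hxA
  rw [h, hsum k hk] at h1
  have h2 : α + β ≤ 1 := by
    by_contra hcon
    push Not at hcon
    nlinarith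
  rcases eq_or_lt_of_le h2 with h3 | h3
  · refine mem_biUnion (Finset.mem_coe.2 (Finset.mem_range.2 hk)) ?_
    exact ⟨α, β, ha, hb, h3, h.symm⟩
  · exfalso
    refine hx.2 ?_
    rcases eq_or_lt_of_le (add_nonneg ha hb) with h5 | h5
    · have h1 : α = 0 := by linarith
      have h2 : β = 0 := by linarith
      rw [h, h1, h2]; simpa using hint
    · have h4 := hA.combo_interior_self_mem_interior hint (hsegA k hk (hin k hk α β ha hb h5))
        (a := 1 - (α+β)) (b := α + β) (by linarith) h5.le (by ring)
      rw [smul_zero, zero_add, smul_smul, mul_inv_cancel₀ h5.ne', one_smul, ← h] at h4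
      exact h4

lemma cos_le_of_mem {δ y : ℝ} (h0 : 0 ≤ δ) (h1 : δ ≤ y) (h2 : y ≤ 2 * Real.pi - δ) :
    Real.cos y ≤ Real.cos δ := by
  rcases le_total y Real.pi with h | h
  · exact Real.cos_le_cos_of_nonneg_of_le_pi h0 h h1
  · rw [← Real.cos_two_pi_sub y]
    exact Real.cos_le_cos_of_nonneg_of_le_pi h0 (by linarith) (by linarith)

lemma polar_exists (x : EuclideanSpace ℝ (Fin 2)) : ∃ r φ : ℝ, 0 ≤ r ∧ 0 ≤ φ ∧
    φ < 2 * Real.pi ∧ x = !₂[r * Real.cos φ, r * Real.sin φ] := by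
  let z : ℂ := ⟨x 0, x 1⟩
  have hpi := Real.pi_pos
  have hz0 : ‖z‖ * Real.cos z.arg = x 0 := Complex.norm_mul_cos_arg z
  have hz1 : ‖z‖ * Real.sin z.arg = x 1 := Complex.norm_mul_sin_arg z
  rcases le_or_gt 0 z.arg with h | h
  · refine ⟨‖z‖, z.arg, norm_nonneg _, h, ?_, ?_⟩
    · have := Complex.arg_le_pi z; linarith
    · rw [hz0, hz1]; ext i; fin_cases i <;> rfl
  · refine ⟨‖z‖, z.arg + 2 * Real.pi, norm_nonneg _, ?_, by linarith, ?_⟩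
    · have := Complex.neg_pi_lt_arg z; linarith
    · rw [Real.cos_add_two_pi, Real.sin_add_two_pi, hz0, hz1]; ext i; fin_cases i <;> rfl

lemma trig_one (R a δ : ℝ) : (R * Real.cos a - R * Real.cos (a + 2*δ))^2
    + (R * Real.sin a - R * Real.sin (a + 2*δ))^2 = (2 * R * Real.sin δ)^2 := by
  rw [Real.cos_add, Real.sin_add]
  have a1 := Real.sin_sq_add_cos_sq a
  have a2 := Real.sin_sq_add_cos_sq (2*δ)
  have a3 : Real.cos (2*δ) = 1 - 2 * (Real.sin δ)^2 := by
    rw [Real.cos_two_mul, Real.cos_sq']; ring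
  have a4 : (2 * R * Real.sin δ)^2 = R^2 * (2 - 2 * Real.cos (2*δ)) := by rw [a3]; ring
  rw [a4]
  generalize Real.cos (2*δ) = C at *
  linear_combination R^2 * ((1 - C)^2 + (Real.sin (2*δ))^2) * a1 + R^2 * a2

lemma trig_two (r R a b ψ : ℝ) (hR : 0 < R) (hb : 0 < Real.sin b) :
    r * Real.cos (a + ψ) = r * Real.sin (b - ψ) / (R * Real.sin b) * (R * Real.cos a)
      + r * Real.sin ψ / (R * Real.sin b) * (R * Real.cos (a + b)) := by
  rw [Real.cos_add, Real.cos_add, Real.sin_sub]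
  field_simp
  ring

lemma trig_three (r R a b ψ : ℝ) (hR : 0 < R) (hb : 0 < Real.sin b) :
    r * Real.sin (a + ψ) = r * Real.sin (b - ψ) / (R * Real.sin b) * (R * Real.sin a)
      + r * Real.sin ψ / (R * Real.sin b) * (R * Real.sin (a + b)) := by
  rw [Real.sin_add, Real.sin_add, Real.sin_sub]
  field_simp
  ring

lemma polygon_frontier (n : ℕ) (hn : 3 ≤ n) (R : ℝ) (hR : R = 1 / (2 * Real.sin (Real.pi / n)))
    (A : Set (EuclideanSpace ℝ (Fin 2)))
    (hA : A = convexHull ℝ (Set.range fun k : Fin n =>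
      (!₂[R * Real.cos (2 * Real.pi * k / n), R * Real.sin (2 * Real.pi * k / n)] :
        EuclideanSpace ℝ (Fin 2)))) :
    IsCompact A ∧ μH[1] (frontier A) ≤ (n : ENNReal) := by
  have hpi := Real.pi_pos
  have hn3 : (3:ℝ) ≤ n := by exact_mod_cast hn
  have hn0 : (0:ℝ) < n := by linarith
  have hAc : IsCompact A := by rw [hA]; exact (Set.finite_range _).isCompact_convexHull ℝ
  refine ⟨hAc, ?_⟩
  set δ := Real.pi / n with hδ
  have hδ0 : 0 < δ := by positivity
  have hδn : n * δ = Real.pi := by rw [hδ]; field_simp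
  have hδ3 : 3 * δ ≤ Real.pi := by rw [← hδn]; nlinarith
  have hsin : 0 < Real.sin δ := Real.sin_pos_of_pos_of_lt_pi hδ0 (by linarith)
  have hcos : 0 < Real.cos δ := Real.cos_pos_of_mem_Ioo ⟨by linarith, by linarith⟩
  have hsin2 : 0 < Real.sin (2*δ) := Real.sin_pos_of_pos_of_lt_pi (by linarith) (by linarith)
  have hR0 : 0 < R := by rw [hR]; positivity
  have hang : ∀ k : ℝ, 2 * Real.pi * k / n = k * (2 * δ) := by intro k; rw [hδ]; ring
  simp_rw [hang] at hA
  let v : ℕ → EuclideanSpace ℝ (Fin 2) := fun k =>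
    !₂[R * Real.cos (k * (2 * δ)), R * Real.sin (k * (2*δ))]
  let u : ℕ → EuclideanSpace ℝ (Fin 2) := fun k =>
    !₂[Real.cos ((2*k+1) * δ), Real.sin ((2*k+1)*δ)]
  have huv : ∀ k j : ℕ, inner ℝ (u k) (v j) = R * Real.cos ((2*k+1)*δ - j * (2*δ)) := by
    intro k j
    rw [Real.cos_sub]
    simp [u, v, PiLp.inner_apply, Fin.sum_univ_two]
    ring
  have hvlt : ∀ k < n, v k ∈ A := by
    intro k hk
    rw [hA]
    exact subset_convexHull ℝ _ ⟨⟨k, hk⟩, rfl⟩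
  have hvn : v n = v 0 := by
    have : (n:ℝ) * (2 * δ) = 2 * Real.pi := by rw [← hδn]; ring
    simp [v, this]
  have hfr := poly_frontier v u n (R * Real.cos δ) (by positivity) A
    (by rw [hA]; exact convex_convexHull ℝ _) hAc.isClosed ?_ ?_ ?_ ?_ ?_
  · refine (measure_mono hfr).trans ((measure_biUnion_finset_le _ _).trans ?_)
    have : ∀ k ∈ Finset.range n, μH[1] (segment ℝ (v k) (v (k+1))) = 1 := by
      intro k _
      rw [hausdorffMeasure_segment, edist_dist, EuclideanSpace.dist_eq]
      simp only [Fin.sum_univ_two, Real.dist_eq, sq_abs, v]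
      rw [ENNReal.ofReal_eq_one, Real.sqrt_eq_one]
      simp
      have e1 : ((k:ℝ)+1) * (2*δ) = k * (2*δ) + 2*δ := by ring
      rw [e1]
      have e2 : (R * Real.cos (k*(2*δ)) - R * Real.cos (k * (2*δ) + 2*δ))^2
        + (R * Real.sin (k*(2*δ)) - R * Real.sin (k * (2*δ) + 2*δ))^2
        = (2 * R * Real.sin δ)^2 := by
        exact trig_one R _ δ
      rw [e2, hR]
      field_simp
    rw [Finset.sum_congr rfl this]
    simp
  · intro k hk
    rcases eq_or_lt_of_le hk with h | h
    · rw [h, hvn]; exact hvlt 0 (by omega)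
    · exact hvlt k h
  · intro k _
    rw [EuclideanSpace.norm_eq, Real.sqrt_eq_one]
    simp [u, Fin.sum_univ_two]
  · intro k hk z hz
    have hsub : A ⊆ {z | inner ℝ (u k) z ≤ R * Real.cos δ} := by
      rw [hA]
      refine convexHull_min ?_ ?_
      · rintro _ ⟨⟨j, hj⟩, rfl⟩
        have := huv k j
        change inner ℝ (u k) (v j) ≤ _
        rw [this]
        refine mul_le_mul_of_nonneg_left ?_ hR0.le
        rw [← Real.cos_abs]
        have hq : (2*(k:ℝ)+1)*δ - j * (2*δ) = ((2*(k:ℤ)+1 - 2*(j:ℤ) : ℤ) : ℝ) * δ := by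
          push_cast; ring
        rw [hq, abs_mul, abs_of_pos hδ0, ← Int.cast_abs]
        have l1 : 1 ≤ |2*(k:ℤ)+1 - 2*(j:ℤ)| := Int.one_le_abs (by omega)
        have l2 : |2*(k:ℤ)+1 - 2*(j:ℤ)| ≤ 2 * n - 1 := by rw [abs_le]; omega
        have l1' : (1:ℝ) ≤ ((|2*(k:ℤ)+1 - 2*(j:ℤ)| : ℤ) : ℝ) := by exact_mod_cast l1
        have l2' : ((|2*(k:ℤ)+1 - 2*(j:ℤ)| : ℤ) : ℝ) ≤ 2 * n - 1 := by exact_mod_cast l2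
        refine cos_le_of_mem hδ0.le (by nlinarith) ?_
        have : 2 * Real.pi - δ = (2 * n - 1) * δ := by rw [← hδn]; ring
        rw [this]
        exact mul_le_mul_of_nonneg_right l2' hδ0.le
      · exact convex_halfSpace_le ⟨fun a b => inner_add_right _ _ _, fun c a => inner_smul_right _ _ _⟩ _
    exact hsub hz
  · intro k _
    rw [huv, huv]
    constructor
    · congr 2; ring
    · rw [← Real.cos_neg δ]; congr 2; push_cast; ring
  · intro x
    obtain ⟨r, φ, hr, hφ0, hφ1, hx⟩ := polar_exists x
    have hq0 : 0 ≤ φ / (2*δ) := by positivity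
    have f1 := Nat.floor_le hq0
    have f2 := Nat.lt_floor_add_one (φ / (2*δ))
    set k := ⌊φ / (2*δ)⌋₊
    rw [le_div_iff₀ (by positivity)] at f1
    rw [div_lt_iff₀ (by positivity)] at f2
    have hkn : k < n := by
      have : (k:ℝ) * (2*δ) < n * (2*δ) := by
        have : (n:ℝ) * (2*δ) = 2 * Real.pi := by rw [← hδn]; ring
        linarith
      exact_mod_cast lt_of_mul_lt_mul_right this (by positivity)
    set ψ := φ - k * (2*δ) with hψ
    have hψ0 : 0 ≤ ψ := by linarith
    have hψ1 : ψ ≤ 2*δ := by linarith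
    have s1 : 0 ≤ Real.sin ψ := Real.sin_nonneg_of_nonneg_of_le_pi hψ0 (by linarith)
    have s2 : 0 ≤ Real.sin (2*δ - ψ) := Real.sin_nonneg_of_nonneg_of_le_pi (by linarith) (by linarith)
    refine ⟨k, hkn, r * Real.sin (2*δ-ψ) / (R * Real.sin (2*δ)), r * Real.sin ψ / (R * Real.sin (2*δ)),
      by positivity, by positivity, ?_⟩
    have hφ : φ = k * (2*δ) + ψ := by rw [hψ]; ring
    have e1 : ((k:ℝ)+1) * (2*δ) = k * (2*δ) + 2*δ := by ring
    rw [hx, hφ]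
    ext i
    fin_cases i
    · simp [v, e1]
      exact trig_two r R _ _ ψ hR0 hsin2
    · simp [v, e1]
      exact trig_three r R _ _ ψ hR0 hsin2


end

/-- **Theorem 4.1.** `l_{m,n} ≥ (1/2)(√(m·n·π·cot(π/n)) − n)`: every `m`-part equal-area
division of a regular `n`-gon with unit side length has dividing length at least
`(1/2)(√(m·n·π·cot(π/n)) − n)`. -/
theorem stmt_12 (n : ℕ) (hn : 3 ≤ n) (m : ℕ) (hm : 1 ≤ m)
    (R : ℝ) (hR : R = 1 / (2 * Real.sin (Real.pi / n)))
    (An : Set (EuclideanSpace ℝ (Fin 2)))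
    (hAn : An = convexHull ℝ (Set.range fun k : Fin n =>
      (WithLp.equiv 2 (Fin 2 → ℝ)).symm
        ![R * Real.cos (2 * Real.pi * k / n), R * Real.sin (2 * Real.pi * k / n)]))
    (U : Fin m → Set (EuclideanSpace ℝ (Fin 2)))
    (hdisj : ∀ i j, i ≠ j → Disjoint (U i) (U j))
    (hopen : ∀ i, ∃ V : Set (EuclideanSpace ℝ (Fin 2)), IsOpen V ∧ U i = V ∩ An)
    (hvol : ∀ i, volume (U i) =
      ENNReal.ofReal ((n / (4 * m)) * Real.cot (Real.pi / n))) :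
    ENNReal.ofReal ((1 / 2) * (Real.sqrt (m * n * Real.pi * Real.cot (Real.pi / n)) - n)) ≤
      μH[1] ((An \ ⋃ i, U i) ∩ interior An) := by
  obtain ⟨hAc, hF⟩ := polygon_frontier n hn R hR An hAn
  have hconv : Convex ℝ An := by rw [hAn]; exact convex_convexHull ℝ _
  have hpi := Real.pi_pos
  have hn3 : (3:ℝ) ≤ n := by exact_mod_cast hn
  have hn0 : (0:ℝ) < n := by linarith
  have hm0 : (0:ℝ) < m := by exact_mod_cast hm
  have hδ0 : 0 < Real.pi / n := by positivity
  have hδ3 : Real.pi / n ≤ Real.pi / 3 := by gcongr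
  have hcot : 0 < Real.cot (Real.pi / n) := by
    rw [Real.cot_eq_cos_div_sin]
    exact div_pos (Real.cos_pos_of_mem_Ioo ⟨by linarith, by linarith⟩)
      (Real.sin_pos_of_pos_of_lt_pi hδ0 (by linarith))
  generalize Real.cot (Real.pi / n) = c at *
  set a := (n / (4 * m)) * c with ha
  have ha0 : 0 < a := by positivity
  set ρ := Real.sqrt (a / Real.pi) with hρdef
  have hρ : 0 < ρ := Real.sqrt_pos.2 (by positivity)
  have hρ2 : Real.pi * ρ^2 = a := by
    rw [hρdef, Real.sq_sqrt (by positivity)]; field_simp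
  have hfr0 : volume (frontier An) = 0 := hconv.addHaar_frontier volume
  let O : Fin m → Set (EuclideanSpace ℝ (Fin 2)) := fun i => U i ∩ interior An
  have hO : ∀ i, IsOpen (O i) := by
    intro i
    obtain ⟨V, hV, hUV⟩ := hopen i
    have : O i = V ∩ interior An := by
      change U i ∩ interior An = _
      rw [hUV, Set.inter_assoc, Set.inter_eq_self_of_subset_right interior_subset]
    rw [this]; exact hV.inter isOpen_interior
  have hOv : ∀ i, volume (O i) = ENNReal.ofReal (Real.pi * ρ^2) := by
    intro i
    rw [hρ2, ← hvol i]
    refine le_antisymm (measure_mono Set.inter_subset_left) ?_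
    have hsub : U i ⊆ O i ∪ frontier An := by
      intro x hx
      by_cases h : x ∈ interior An
      · exact Or.inl ⟨hx, h⟩
      · refine Or.inr ⟨subset_closure ?_, h⟩
        obtain ⟨V, hV, hUV⟩ := hopen i
        rw [hUV] at hx
        exact hx.2
    refine (measure_mono hsub).trans ((measure_union_le _ _).trans ?_)
    rw [hfr0, add_zero]
  have hset : (An \ ⋃ i, U i) ∩ interior An = (An \ ⋃ i, O i) ∩ interior An := by
    ext x
    simp only [Set.mem_inter_iff, Set.mem_sdiff, Set.mem_iUnion, O]
    rw [exists_and_right]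
    tauto
  rw [hset]
  by_cases htop : μH[1] ((An \ ⋃ i, O i) ∩ interior An) = ⊤
  · rw [htop]; exact le_top
  have hFt : μH[1] (frontier An) ≠ ⊤ := ne_top_of_le_ne_top (ENNReal.natCast_ne_top n) hF
  have hDf : μH[1] (An \ ⋃ i, O i) ≠ ⊤ := by
    have hsub : An \ ⋃ i, O i ⊆ ((An \ ⋃ i, O i) ∩ interior An) ∪ frontier An := by
      intro x hx
      by_cases h : x ∈ interior An
      · exact Or.inl ⟨hx, h⟩
      · exact Or.inr ⟨subset_closure hx.1, h⟩
    exact ne_top_of_le_ne_top (ENNReal.add_ne_top.2 ⟨htop, hFt⟩)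
      ((measure_mono hsub).trans (measure_union_le _ _))
  have key := counting An hconv hAc O hO (fun i j hij => (hdisj i j hij).mono
    Set.inter_subset_left Set.inter_subset_left) (fun i => Set.inter_subset_right) ρ hρ hOv hDf
  have key2 := key.trans (add_le_add le_rfl hF)
  have hsq : Real.sqrt (m * n * Real.pi * c) = m * (2 * Real.pi * ρ) := by
    rw [Real.sqrt_eq_iff_mul_self_eq (by positivity) (by positivity)]
    have : m * (2 * Real.pi * ρ) * (m * (2 * Real.pi * ρ)) = 4 * m^2 * Real.pi * (Real.pi * ρ^2) := by
      ring
    rw [this, hρ2, ha]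
    field_simp
  rw [hsq]
  generalize μH[1] ((An \ ⋃ i, O i) ∩ interior An) = X at *
  lift X to NNReal using htop
  rw [ENNReal.ofReal_le_iff_le_toReal (by finiteness)] at key2 ⊢
  rw [ENNReal.toReal_add (by finiteness) (by finiteness), ENNReal.toReal_mul] at key2
  simp at key2 ⊢
  linarith
end

section
/- Let n ≥ 3 and let Aₙ ⊆ ℝ² be the convex hull of the n points (R·cos(2πk/n), R·sin(2πk/n)), k = 0, …, n−1, where R = 1/(2·sin(π/n)) (a regular n-gon with unit side length, of area (n/4)·cot(π/n)). For m ≥ 1, call a family U₁, …, Uₘ of pairwise disjoint sets, each open in the subspace topology of Aₙ and each of two-dimensional Lebesgue measure (n/(4m))·cot(π/n), an m-part equal-area division of Aₙ, and let l(m) denote the infimum of μH¹((Aₙ \ (U₁ ∪ ⋯ ∪ Uₘ)) ∩ interior Aₙ) over all such divisions. Then for every ε > 0 there exists M such that for all m ≥ M there is an m-part equal-area division of Aₙ whose dividing length is at most (√((√3/2)·n·cot(π/n)) + ε)·√m; in particular limsup_{m→∞} l(m)/√m ≤ √((√3/2)·n·cot(π/n)). -/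
open MeasureTheory

namespace HC
abbrev E2 := EuclideanSpace ℝ (Fin 2)

noncomputable def uu (s : ℝ) (v : ℤ × ℤ) (p : E2) : ℝ := p 0 / (s * (√3 / 2)) - (2 * v.1 + v.2)
noncomputable def vv (s : ℝ) (v : ℤ × ℤ) (p : E2) : ℝ := p 1 / (s / 2) - 3 * v.2
def hex (s : ℝ) (v : ℤ × ℤ) : Set E2 := {p | |uu s v p| < 1 ∧ |uu s v p| + |vv s v p| < 2}
def chex (s : ℝ) (v : ℤ × ℤ) : Set E2 := {p | |uu s v p| ≤ 1 ∧ |uu s v p| + |vv s v p| ≤ 2}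
def edge (s : ℝ) (v : ℤ × ℤ) : Set E2 := {p | (uu s v p = 1 ∧ |vv s v p| ≤ 1) ∨
  (0 ≤ uu s v p ∧ uu s v p ≤ 1 ∧ vv s v p = 2 - uu s v p) ∨
  (-1 ≤ uu s v p ∧ uu s v p ≤ 0 ∧ vv s v p = 2 + uu s v p)}
noncomputable def ctr (s : ℝ) (v : ℤ × ℤ) : E2 :=
  !₂[s * (√3 / 2) * (2 * v.1 + v.2), s / 2 * (3 * v.2)]

lemma hex_open (s v) : IsOpen (hex s v) := by
  unfold hex uu vv
  rw [Set.ofPred_and]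
  apply IsOpen.inter
  · apply isOpen_lt <;> fun_prop
  · apply isOpen_lt <;> fun_prop

lemma chex_closed (s v) : IsClosed (chex s v) := by
  unfold chex uu vv
  rw [Set.ofPred_and]
  apply IsClosed.inter
  · apply isClosed_le <;> fun_prop
  · apply isClosed_le <;> fun_prop

lemma hex_sub_chex (s v) : hex s v ⊆ chex s v := fun _ h => ⟨h.1.le, h.2.le⟩

lemma edge_sub_chex (s v) : edge s v ⊆ chex s v := by
  rintro p (⟨h1, h2⟩ | ⟨h1, h2, h3⟩ | ⟨h1, h2, h3⟩)
  · exact ⟨by rw [h1]; simp, by rw [h1]; simp; linarith⟩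
  · refine ⟨by rw [abs_of_nonneg h1]; exact h2, ?_⟩
    rw [h3, abs_of_nonneg h1, abs_of_nonneg] <;> linarith
  · refine ⟨by rw [abs_of_nonpos h2]; linarith, ?_⟩
    rw [h3, abs_of_nonpos h2, abs_of_nonneg] <;> linarith

lemma hex_disj {s : ℝ} {v w : ℤ × ℤ} (h : v ≠ w) : Disjoint (hex s v) (chex s w) := by
  rw [Set.disjoint_left]
  rintro p ⟨h1, h2⟩ ⟨h3, h4⟩
  have e1 : uu s w p - uu s v p = ((2 * (v.1 - w.1) + (v.2 - w.2) : ℤ) : ℝ) := by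
    simp only [uu]; push_cast; ring
  have e2 : vv s w p - vv s v p = ((3 * (v.2 - w.2) : ℤ) : ℝ) := by
    simp only [vv]; push_cast; ring
  have d1 : |uu s w p - uu s v p| ≤ |uu s w p| + |uu s v p| := abs_sub _ _
  have d2 : |vv s w p - vv s v p| ≤ |vv s w p| + |vv s v p| := abs_sub _ _
  have f1 : |uu s w p - uu s v p| < 2 := by linarith
  have f2 : |uu s w p - uu s v p| + |vv s w p - vv s v p| < 4 := by linarith
  rw [e1] at f1
  rw [e1, e2] at f2
  norm_cast at f1 f2
  apply h
  have : v.2 = w.2 := by grind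
  have : v.1 = w.1 := by grind
  ext <;> assumption

lemma ccover (s : ℝ) (p : E2) : ∃ v, p ∈ chex s v := by
  set x := p 0 / (s * (√3 / 2)) with hx
  set y := p 1 / (s / 2) with hy
  let j := ⌊y / 3⌋
  have hj1 : 3 * (j : ℝ) ≤ y := by have := Int.floor_le (y / 3); simp only [j]; linarith
  have hj2 : y < 3 * (j : ℝ) + 3 := by have := Int.lt_floor_add_one (y / 3); simp only [j]; linarith
  let i := ⌊(x - j + 1) / 2⌋
  have hi1 : 2 * (i : ℝ) + j - 1 ≤ x := by
    have := Int.floor_le ((x - j + 1) / 2); simp only [i]; linarith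
  have hi2 : x < 2 * (i : ℝ) + j + 1 := by
    have := Int.lt_floor_add_one ((x - j + 1) / 2); simp only [i]; linarith
  by_cases c : |x - (2 * i + j)| + |y - 3 * j| ≤ 2
  · refine ⟨(i, j), ?_, c⟩
    simp only [uu, ← hx]
    rw [abs_le]; constructor <;> linarith
  · push Not at c
    rw [abs_of_nonneg (a := y - 3 * j) (by linarith)] at c
    rcases le_total 0 (x - (2 * i + j)) with h | h
    · rw [abs_of_nonneg h] at c
      have e1 : |uu s (i, j+1) p| = 1 - (x - (2 * i + j)) := by
        simp only [uu, ← hx]; push_cast; rw [abs_of_nonpos] <;> linarith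
      have e2 : |vv s (i, j+1) p| = 3 - (y - 3 * j) := by
        simp only [vv, ← hy]; push_cast; rw [abs_of_nonpos] <;> linarith
      refine ⟨(i, j + 1), ?_, ?_⟩ <;> simp only [e1, e2] <;> linarith
    · rw [abs_of_nonpos h] at c
      have e1 : |uu s (i-1, j+1) p| = 1 + (x - (2 * i + j)) := by
        simp only [uu, ← hx]; push_cast; rw [abs_of_nonneg] <;> linarith
      have e2 : |vv s (i-1, j+1) p| = 3 - (y - 3 * j) := by
        simp only [vv, ← hy]; push_cast; rw [abs_of_nonpos] <;> linarith
      refine ⟨(i - 1, j + 1), ?_, ?_⟩ <;> simp only [e1, e2] <;> linarith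

lemma cover (s : ℝ) (p : E2) : ∃ v, p ∈ hex s v ∨ p ∈ edge s v := by
  obtain ⟨⟨i, j⟩, h1, h2⟩ := ccover s p
  have shift : ∀ a b : ℤ, uu s (i + a, j + b) p = uu s (i, j) p - (2 * a + b) ∧
      vv s (i + a, j + b) p = vv s (i, j) p - 3 * b := by
    intro a b; simp only [uu, vv]; push_cast; constructor <;> ring
  set u := uu s (i, j) p with hu
  set v := vv s (i, j) p with hv
  by_cases c : |u| < 1 ∧ |u| + |v| < 2
  · exact ⟨(i, j), Or.inl c⟩
  rcases le_or_gt 1 |u| with c1 | c1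
  · have hu1 : |u| = 1 := le_antisymm h1 c1
    have hv1 : |v| ≤ 1 := by linarith
    rcases (abs_eq zero_le_one).1 hu1 with h | h
    · exact ⟨(i, j), Or.inr (Or.inl ⟨h, hv1⟩)⟩
    · refine ⟨(i + (-1), j + 0), Or.inr (Or.inl ?_)⟩
      rw [(shift _ _).1, (shift _ _).2, h]; norm_num; exact hv1
  have c2 : |u| + |v| = 2 := by
    apply le_antisymm h2; by_contra h; exact c ⟨c1, not_le.1 h⟩
  rw [abs_le] at h1
  rcases le_total 0 v with hv0 | hv0
  · rw [abs_of_nonneg hv0] at c2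
    rcases le_total 0 u with hu0 | hu0
    · rw [abs_of_nonneg hu0] at c2
      exact ⟨(i, j), Or.inr (Or.inr (Or.inl ⟨hu0, h1.2, by linarith⟩))⟩
    · rw [abs_of_nonpos hu0] at c2
      exact ⟨(i, j), Or.inr (Or.inr (Or.inr ⟨h1.1, hu0, by linarith⟩))⟩
  · rw [abs_of_nonpos hv0] at c2
    rcases le_total 0 u with hu0 | hu0
    · rw [abs_of_nonneg hu0] at c2
      refine ⟨(i + 1, j + (-1)), Or.inr (Or.inr (Or.inr ?_))⟩
      rw [(shift _ _).1, (shift _ _).2]; push_cast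
      refine ⟨?_, ?_, ?_⟩ <;> linarith
    · rw [abs_of_nonpos hu0] at c2
      refine ⟨(i + 0, j + (-1)), Or.inr (Or.inr (Or.inl ?_))⟩
      rw [(shift _ _).1, (shift _ _).2]; push_cast
      refine ⟨?_, ?_, ?_⟩ <;> linarith

lemma coord0 {s : ℝ} (hs : 0 < s) (v p) : p 0 = s * (√3 / 2) * (uu s v p + (2 * v.1 + v.2)) := by
  simp only [uu]; field_simp; ring
lemma coord1 {s : ℝ} (hs : 0 < s) (v p) : p 1 = s / 2 * (vv s v p + 3 * v.2) := by
  simp only [vv]; field_simp; ring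

lemma chex_dist {s : ℝ} (hs : 0 < s) {v p} (h : p ∈ chex s v) : dist p (ctr s v) ≤ s := by
  obtain ⟨h1, h2⟩ := h
  rw [EuclideanSpace.dist_eq]
  apply Real.sqrt_le_iff.2 ⟨hs.le, ?_⟩
  simp only [Fin.sum_univ_two, Real.dist_eq, sq_abs, ctr]
  rw [coord0 hs v p, coord1 hs v p]
  simp
  set x := uu s v p
  set y := vv s v p
  have e3 : √3 ^ 2 = 3 := Real.sq_sqrt (by norm_num)
  have : (s * (√3 / 2) * (x + (2 * v.1 + v.2)) - s * (√3 / 2) * (2 * v.1 + v.2)) ^ 2 +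
    (s / 2 * (y + 3 * v.2) - s / 2 * (3 * v.2)) ^ 2 = s ^ 2 / 4 * (√3 ^ 2 * x ^ 2 + y ^ 2) := by ring
  rw [this, e3]
  have : 3 * x ^ 2 + y ^ 2 ≤ 4 := by
    rw [← sq_abs x, ← sq_abs y]
    have := abs_nonneg x
    have := abs_nonneg y
    nlinarith
  nlinarith [sq_nonneg s]

lemma seg_meas {a b : E2} {s : ℝ} (hs : 0 < s) (h : (a 0 - b 0) ^ 2 + (a 1 - b 1) ^ 2 = s ^ 2) :
    μH[1] (segment ℝ a b) = ENNReal.ofReal s := by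
  rw [hausdorffMeasure_segment, edist_dist, EuclideanSpace.dist_eq]
  simp only [Fin.sum_univ_two, Real.dist_eq, sq_abs]
  rw [h, Real.sqrt_sq hs.le]

lemma mem_seg {a b p : E2} {t : ℝ} (h0 : 0 ≤ t) (h1 : t ≤ 1) (e0 : p 0 = (1 - t) * a 0 + t * b 0)
    (e1 : p 1 = (1 - t) * a 1 + t * b 1) : p ∈ segment ℝ a b := by
  refine ⟨1 - t, t, by linarith, h0, by ring, ?_⟩
  ext i; fin_cases i <;> simp [e0, e1]

lemma edge_meas {s : ℝ} (hs : 0 < s) (v) : μH[1] (edge s v) ≤ ENNReal.ofReal (3 * s) := by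
  let P : ℝ → ℝ → E2 := fun x y => !₂[s * (√3 / 2) * (x + (2 * v.1 + v.2)), s / 2 * (y + 3 * v.2)]
  have P0 : ∀ x y, (P x y) 0 = s * (√3 / 2) * (x + (2 * v.1 + v.2)) := fun _ _ => rfl
  have P1 : ∀ x y, (P x y) 1 = s / 2 * (y + 3 * v.2) := fun _ _ => rfl
  have e3 : √3 ^ 2 = 3 := Real.sq_sqrt (by norm_num)
  have sub : edge s v ⊆ segment ℝ (P 1 (-1)) (P 1 1) ∪ (segment ℝ (P 1 1) (P 0 2) ∪
      segment ℝ (P 0 2) (P (-1) 1)) := by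
    rintro p (⟨h1, h2⟩ | ⟨h1, h2, h3⟩ | ⟨h1, h2, h3⟩)
    · left
      rw [abs_le] at h2
      apply mem_seg (t := (vv s v p + 1) / 2) (by linarith) (by linarith)
      · rw [coord0 hs v p, h1, P0, P0]; ring
      · rw [coord1 hs v p, P1, P1]; ring
    · right; left
      apply mem_seg (t := 1 - uu s v p) (by linarith) (by linarith)
      · rw [coord0 hs v p, P0, P0]; ring
      · rw [coord1 hs v p, P1, P1, h3]; ring
    · right; right
      apply mem_seg (t := - uu s v p) (by linarith) (by linarith)
      · rw [coord0 hs v p, P0, P0]; ring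
      · rw [coord1 hs v p, P1, P1, h3]; ring
  refine (measure_mono sub).trans ((measure_union_le _ _).trans ?_)
  have : ENNReal.ofReal (3 * s) = ENNReal.ofReal s + (ENNReal.ofReal s + ENNReal.ofReal s) := by
    rw [← ENNReal.ofReal_add hs.le hs.le, ← ENNReal.ofReal_add hs.le (by linarith)]; congr 1; ring
  rw [this]
  refine add_le_add (le_of_eq (seg_meas hs ?_)) ((measure_union_le _ _).trans
    (add_le_add (le_of_eq (seg_meas hs ?_)) (le_of_eq (seg_meas hs ?_))))
  · simp only [P0, P1]; ring
  · simp only [P0, P1]; ring_nf; rw [e3]; ring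
  · simp only [P0, P1]; ring_nf; rw [e3]; ring
end HC

namespace HC
lemma mp2 : MeasurePreserving (fun p : E2 => (p 0, p 1)) := by
  have := (volume_preserving_finTwoArrow ℝ).comp (PiLp.volume_preserving_ofLp (Fin 2))
  exact this

lemma vol_coord {S : Set (ℝ × ℝ)} (hS : MeasurableSet S) :
    volume {p : E2 | (p 0, p 1) ∈ S} = volume S :=
  mp2.measure_preimage hS.nullMeasurableSet

lemma vol_hexr {c b d e r : ℝ} (hc : 0 < c) (hb : 0 < b) (hr : 0 < r) :
    volume {p : E2 | |p 0 / c - d| < r ∧ |p 0 / c - d| + |p 1 / b - e| < 2 * r} =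
      ENNReal.ofReal (6 * r ^ 2 * c * b) := by
  let f : ℝ → ℝ := fun x => b * (e - (2 * r - |x / c - d|))
  let g : ℝ → ℝ := fun x => b * (e + (2 * r - |x / c - d|))
  have hf : Continuous f := by fun_prop
  have hg : Continuous g := by fun_prop
  have hle : c * (d - r) ≤ c * (d + r) := by nlinarith
  have e1 : {p : E2 | |p 0 / c - d| < r ∧ |p 0 / c - d| + |p 1 / b - e| < 2 * r} =
      {p : E2 | (p 0, p 1) ∈ regionBetween f g (Set.Ioo (c * (d - r)) (c * (d + r)))} := by
    ext p
    simp only [Set.mem_ofPred_eq, regionBetween, Set.mem_Ioo, f, g]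
    have A : |p 0 / c - d| < r ↔ c * (d - r) < p 0 ∧ p 0 < c * (d + r) := by
      rw [abs_lt, ← div_lt_iff₀' hc, mul_comm c (d - r), ← lt_div_iff₀ hc]
      constructor <;> rintro ⟨h1, h2⟩ <;> constructor <;> linarith
    have B : |p 0 / c - d| + |p 1 / b - e| < 2 * r ↔ b * (e - (2 * r - |p 0 / c - d|)) < p 1 ∧
        p 1 < b * (e + (2 * r - |p 0 / c - d|)) := by
      rw [← lt_sub_iff_add_lt', abs_lt, ← div_lt_iff₀' hb, mul_comm b (e - _), ← lt_div_iff₀ hb]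
      constructor <;> rintro ⟨h1, h2⟩ <;> constructor <;> linarith
    rw [A, B]
  rw [e1, vol_coord (measurableSet_regionBetween hf.measurable hg.measurable measurableSet_Ioo),
    Measure.volume_eq_prod, volume_regionBetween_eq_integral]
  · congr 1
    rw [← integral_Ioc_eq_integral_Ioo, ← intervalIntegral.integral_of_le hle]
    have : ∀ x, (g - f) x = (fun z => 2 * b * (2 * r - |z|)) (x / c - d) := by
      intro x; simp only [Pi.sub_apply, f, g]; ring
    simp_rw [this]
    rw [intervalIntegral.integral_comp_div_sub (fun z => 2 * b * (2 * r - |z|)) hc.ne' d]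
    have l1 : c * (d - r) / c - d = -r := by field_simp; ring
    have l2 : c * (d + r) / c - d = r := by field_simp; ring
    rw [l1, l2, ← intervalIntegral.integral_add_adjacent_intervals (b := 0)]
    · have i1 : ∫ z in (-r)..0, 2 * b * (2 * r - |z|) = ∫ z in (-r)..0, 2 * b * (2 * r + z) := by
        apply intervalIntegral.integral_congr
        intro z hz
        rw [Set.uIcc_of_le (by linarith)] at hz
        simp only [abs_of_nonpos hz.2]; ring
      have i2 : ∫ z in 0..r, 2 * b * (2 * r - |z|) = ∫ z in 0..r, 2 * b * (2 * r - z) := by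
        apply intervalIntegral.integral_congr
        intro z hz
        rw [Set.uIcc_of_le hr.le] at hz
        simp only [abs_of_nonneg hz.1]
      rw [i1, i2, intervalIntegral.integral_const_mul, intervalIntegral.integral_const_mul,
        intervalIntegral.integral_add, intervalIntegral.integral_sub]
      · simp; ring
      all_goals apply Continuous.intervalIntegrable; fun_prop
    all_goals apply Continuous.intervalIntegrable; fun_prop
  · exact (hf.continuousOn.integrableOn_Icc).mono_set Set.Ioo_subset_Icc_self
  · exact (hg.continuousOn.integrableOn_Icc).mono_set Set.Ioo_subset_Icc_self
  · exact measurableSet_Ioo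
  · intro x hx
    have : |x / c - d| < r := by
      rw [abs_lt]
      have h1 := hx.1
      have h2 := hx.2
      rw [← div_lt_iff₀' hc] at h2
      rw [mul_comm, ← lt_div_iff₀ hc] at h1
      constructor <;> linarith
    simp only [f, g]
    nlinarith

lemma vol_hex {s : ℝ} (hs : 0 < s) (v) :
    volume (hex s v) = ENNReal.ofReal (3 * √3 / 2 * s ^ 2) := by
  have := vol_hexr (c := s * (√3 / 2)) (b := s / 2) (d := 2 * v.1 + v.2) (e := 3 * v.2) (r := 1)
    (by positivity) (by positivity) one_pos
  rw [show 6 * 1 ^ 2 * (s * (√3 / 2)) * (s / 2) = 3 * √3 / 2 * s ^ 2 by ring] at this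
  rw [← this]; simp [hex, uu, vv]

lemma vol_chex {s : ℝ} (hs : 0 < s) (v) :
    volume (chex s v) = ENNReal.ofReal (3 * √3 / 2 * s ^ 2) := by
  apply le_antisymm
  · have key : ∀ r : ℝ, 1 < r → volume (chex s v) ≤
        ENNReal.ofReal (6 * r ^ 2 * (s * (√3 / 2)) * (s / 2)) := by
      intro r hr
      rw [← vol_hexr (c := s * (√3 / 2)) (b := s / 2) (d := 2 * v.1 + v.2) (e := 3 * v.2) (r := r)
        (by positivity) (by positivity) (by linarith)]
      apply measure_mono
      rintro p ⟨h1, h2⟩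
      exact ⟨h1.trans_lt hr, h2.trans_lt (by linarith)⟩
    have lim : Filter.Tendsto (fun r : ℝ => ENNReal.ofReal (6 * r ^ 2 * (s * (√3 / 2)) * (s / 2)))
        (nhdsWithin 1 (Set.Ioi 1)) (nhds (ENNReal.ofReal (6 * 1 ^ 2 * (s * (√3 / 2)) * (s / 2)))) := by
      apply Filter.Tendsto.mono_left _ nhdsWithin_le_nhds
      apply Continuous.tendsto (f := fun r : ℝ => ENNReal.ofReal (6 * r ^ 2 * (s * (√3 / 2)) * (s / 2)))
      exact ENNReal.continuous_ofReal.comp (by fun_prop)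
    rw [show 6 * 1 ^ 2 * (s * (√3 / 2)) * (s / 2) = 3 * √3 / 2 * s ^ 2 by ring] at lim
    exact ge_of_tendsto lim (by filter_upwards [self_mem_nhdsWithin] with r hr using key r hr)
  · rw [← vol_hex hs v]; exact measure_mono (hex_sub_chex s v)

lemma vol_tri {δ : ℝ} (hd : 0 ≤ δ) :
    volume {p : E2 | -δ < p 0 ∧ -δ < p 1 ∧ p 0 + p 1 < 1 + δ} =
      ENNReal.ofReal ((1 + 3 * δ) ^ 2 / 2) := by
  let f : ℝ → ℝ := fun x => -δ
  let g : ℝ → ℝ := fun x => 1 + δ - x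
  have hf : Continuous f := by fun_prop
  have hg : Continuous g := by fun_prop
  have hle : -δ ≤ 1 + 2 * δ := by linarith
  have e1 : {p : E2 | -δ < p 0 ∧ -δ < p 1 ∧ p 0 + p 1 < 1 + δ} =
      {p : E2 | (p 0, p 1) ∈ regionBetween f g (Set.Ioo (-δ) (1 + 2 * δ))} := by
    ext p
    simp only [Set.mem_ofPred_eq, regionBetween, Set.mem_Ioo, f, g]
    constructor
    · rintro ⟨h1, h2, h3⟩; refine ⟨⟨?_, ?_⟩, ?_, ?_⟩ <;> linarith
    · rintro ⟨⟨h1, h2⟩, h3, h4⟩; refine ⟨?_, ?_, ?_⟩ <;> linarith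
  rw [e1, vol_coord (measurableSet_regionBetween hf.measurable hg.measurable measurableSet_Ioo),
    Measure.volume_eq_prod, volume_regionBetween_eq_integral]
  · congr 1
    rw [← integral_Ioc_eq_integral_Ioo, ← intervalIntegral.integral_of_le hle]
    have : ∀ x, (g - f) x = (1 + 2 * δ) - x := by
      intro x; simp only [Pi.sub_apply, f, g]; ring
    simp_rw [this]
    rw [intervalIntegral.integral_sub]
    · simp; ring
    all_goals apply Continuous.intervalIntegrable; fun_prop
  · exact (hf.continuousOn.integrableOn_Icc).mono_set Set.Ioo_subset_Icc_self
  · exact (hg.continuousOn.integrableOn_Icc).mono_set Set.Ioo_subset_Icc_self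
  · exact measurableSet_Ioo
  · intro x hx
    have := hx.2
    simp only [f, g]
    linarith

lemma vol_tri_open : volume {p : E2 | 0 < p 0 ∧ 0 < p 1 ∧ p 0 + p 1 < 1} =
      ENNReal.ofReal (1 / 2) := by
  have := vol_tri le_rfl
  simpa using this

lemma vol_tri_closed : volume {p : E2 | 0 ≤ p 0 ∧ 0 ≤ p 1 ∧ p 0 + p 1 ≤ 1} ≤
      ENNReal.ofReal (1 / 2) := by
  have key : ∀ r : ℝ, 0 < r → volume {p : E2 | 0 ≤ p 0 ∧ 0 ≤ p 1 ∧ p 0 + p 1 ≤ 1} ≤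
        ENNReal.ofReal ((1 + 3 * r) ^ 2 / 2) := by
    intro r hr
    rw [← vol_tri hr.le]
    apply measure_mono
    rintro p ⟨h1, h2, h3⟩
    refine ⟨?_, ?_, ?_⟩ <;> linarith
  have lim : Filter.Tendsto (fun r : ℝ => ENNReal.ofReal ((1 + 3 * r) ^ 2 / 2))
      (nhdsWithin 0 (Set.Ioi 0)) (nhds (ENNReal.ofReal ((1 + 3 * 0) ^ 2 / 2))) := by
    apply Filter.Tendsto.mono_left _ nhdsWithin_le_nhds
    apply Continuous.tendsto (f := fun r : ℝ => ENNReal.ofReal ((1 + 3 * r) ^ 2 / 2))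
    exact ENNReal.continuous_ofReal.comp (by fun_prop)
  rw [show ((1 + 3 * 0) ^ 2 / 2 : ℝ) = 1 / 2 by norm_num] at lim
  exact ge_of_tendsto lim (by filter_upwards [self_mem_nhdsWithin] with r hr using key r hr)
end HC

namespace HC
lemma null_line (i : Fin 2) (c : ℝ) : volume {p : E2 | p i = c} = 0 := by
  have := (PiLp.volume_preserving_ofLp (Fin 2)).measure_preimage
    (s := {f : Fin 2 → ℝ | f i = c}) (measurableSet_eq_fun (by fun_prop) (by fun_prop)).nullMeasurableSet
  rw [show {p : E2 | p i = c} = WithLp.ofLp ⁻¹' {f : Fin 2 → ℝ | f i = c} from rfl, this]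
  exact Measure.pi_hyperplane (α := fun _ : Fin 2 => ℝ) (fun _ => volume) i c

noncomputable def phi (W h : ℝ) (p : E2) : ℝ := 2 * W * (⌊p 1 / h⌋ : ℝ) + p 0

lemma phi_meas (W h : ℝ) : Measurable (phi W h) := by
  unfold phi
  fun_prop

lemma phi_null (W h t : ℝ) : volume (phi W h ⁻¹' {t}) = 0 := by
  have : phi W h ⁻¹' {t} ⊆ ⋃ j : ℤ, {p : E2 | p 0 = t - 2 * W * j} := by
    intro p hp
    rw [Set.mem_iUnion]
    refine ⟨⌊p 1 / h⌋, ?_⟩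
    have : phi W h p = t := hp
    simp only [phi] at this
    show p 0 = _
    linarith
  exact measure_mono_null this (measure_iUnion_null fun j => null_line 0 _)

lemma lam_null (h : ℝ) : volume {p : E2 | ∃ j : ℤ, p 1 = j * h} = 0 := by
  have : {p : E2 | ∃ j : ℤ, p 1 = j * h} ⊆ ⋃ j : ℤ, {p : E2 | p 1 = j * h} := by
    rintro p ⟨j, hj⟩
    exact Set.mem_iUnion.2 ⟨j, hj⟩
  exact measure_mono_null this (measure_iUnion_null fun j => null_line 1 _)

lemma phi_level {W h t : ℝ} (hh : 0 < h) {B : Set E2}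
    (hB : ∀ p ∈ B, |p 0| < W ∧ |p 1| < W) :
    μH[1] (B ∩ phi W h ⁻¹' {t}) ≤ ENNReal.ofReal h := by
  rcases Set.eq_empty_or_nonempty (B ∩ phi W h ⁻¹' {t}) with he | ⟨q, hq, hqt⟩
  · rw [he]; simp
  have hq' : 2 * W * (⌊q 1 / h⌋ : ℝ) + q 0 = t := hqt
  set j := ⌊q 1 / h⌋ with hj
  let a : E2 := !₂[q 0, j * h]
  let b : E2 := !₂[q 0, (j + 1) * h]
  rw [← seg_meas (a := a) (b := b) hh]
  · apply measure_mono
    rintro p ⟨hp, hpt⟩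
    have hp' : 2 * W * (⌊p 1 / h⌋ : ℝ) + p 0 = t := hpt
    have b1 := abs_lt.1 (hB p hp).1
    have b2 := abs_lt.1 (hB q hq).1
    have hW : 0 < W := by linarith
    have hj2 : ⌊p 1 / h⌋ = j := by
      have h1 : 2 * W * ((⌊p 1 / h⌋ : ℝ) - j) < 2 * W * 1 := by linarith
      have h2 : 2 * W * (-1) < 2 * W * ((⌊p 1 / h⌋ : ℝ) - j) := by linarith
      have h1 := lt_of_mul_lt_mul_left h1 (by linarith)
      have h2 := lt_of_mul_lt_mul_left h2 (by linarith)
      norm_cast at h1 h2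
      have h2' : -1 < ⌊p 1 / h⌋ - j := by exact_mod_cast h2
      omega
    rw [hj2] at hp'
    have hf := Int.floor_eq_iff.1 hj2
    apply mem_seg (t := p 1 / h - j) (by linarith) (by linarith)
    · simp [a, b]; linarith
    · simp [a, b]; field_simp; ring
  · simp [a, b]; ring

lemma lam_meas {W h : ℝ} (hW : 0 < W) (hh : 0 < h) {B : Set E2}
    (hB : ∀ p ∈ B, |p 0| < W ∧ |p 1| < W) :
    μH[1] (B ∩ {p : E2 | ∃ j : ℤ, p 1 = j * h}) ≤ ENNReal.ofReal ((2 * W / h + 3) * (2 * W)) := by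
  let a : ℤ → E2 := fun j => !₂[-W, j * h]
  let b : ℤ → E2 := fun j => !₂[W, j * h]
  let J : ℤ := ⌈W / h⌉
  have sub : B ∩ {p : E2 | ∃ j : ℤ, p 1 = j * h} ⊆
      ⋃ j ∈ Finset.Icc (-J) J, segment ℝ (a j) (b j) := by
    rintro p ⟨hp, j, hj⟩
    have b1 := abs_lt.1 (hB p hp).1
    have b2 := abs_lt.1 (hB p hp).2
    have c1 := Int.le_ceil (W / h)
    rw [div_le_iff₀ hh] at c1
    simp only [Set.mem_iUnion]
    refine ⟨j, ?_, ?_⟩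
    · rw [hj] at b2
      rw [Finset.mem_Icc]
      have h1 : (j : ℝ) * h < (J : ℝ) * h := by linarith [b2.2]
      have h2 : (-J : ℝ) * h < j * h := by linarith [b2.1]
      have h1 := lt_of_mul_lt_mul_right h1 hh.le
      have h2 := lt_of_mul_lt_mul_right h2 hh.le
      constructor
      · exact_mod_cast h2.le
      · exact_mod_cast h1.le
    · apply mem_seg (t := (p 0 + W) / (2 * W)) (div_nonneg (by linarith) (by linarith))
        ((div_le_one (by linarith)).2 (by linarith))
      · simp [a, b]; field_simp; ring
      · simp [a, b, hj]; ring
  refine (measure_mono sub).trans ((measure_biUnion_finset_le _ _).trans ?_)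
  have : ∀ j, μH[1] (segment ℝ (a j) (b j)) = ENNReal.ofReal (2 * W) := by
    intro j
    apply seg_meas (by linarith)
    simp [a, b]; ring
  simp_rw [this]
  rw [Finset.sum_const, nsmul_eq_mul, ENNReal.ofReal_mul (p := 2 * W / h + 3) (by positivity)]
  gcongr
  rw [← ENNReal.ofReal_natCast]
  apply ENNReal.ofReal_le_ofReal
  have hJ : 0 ≤ J := Int.ceil_nonneg (by positivity)
  have hc : (((Finset.Icc (-J) J).card : ℤ) : ℝ) = 2 * J + 1 := by
    rw [Int.card_Icc, Int.toNat_of_nonneg (by omega)]; push_cast; ring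
  have hc' : ((Finset.Icc (-J) J).card : ℝ) = 2 * J + 1 := by rw [← hc]; push_cast; rfl
  rw [hc']
  have := Int.ceil_lt_add_one (W / h)
  have e : 2 * W / h = 2 * (W / h) := by ring
  rw [e]
  simp only [J]
  linarith

lemma exists_cuts (ν : Measure ℝ) [IsFiniteMeasure ν] [NullSingletonClass ν] {C a : ℝ} {k : ℕ} (hC : 0 ≤ C)
    (ha : 0 < a) (hk : 1 ≤ k) (htot : ν (Set.Ioc (-C) C) = k * ENNReal.ofReal a) :
    ∃ t : ℕ → ℝ, t 0 = -C ∧ t k = C ∧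
      ∀ i < k, ν (Set.Ioo (t i) (t (i + 1))) = ENNReal.ofReal a := by
  have hint : ∀ x y, IntervalIntegrable (fun _ : ℝ => (1 : ℝ)) ν x y := fun x y =>
    intervalIntegrable_const
  let G : ℝ → ℝ := fun t => ∫ x in (-C)..t, (1 : ℝ) ∂ν
  have hG : Continuous G := intervalIntegral.continuous_primitive hint (-C)
  have hG0 : G (-C) = 0 := intervalIntegral.integral_same
  have hval : ∀ x y, x ≤ y → ∫ z in x..y, (1 : ℝ) ∂ν = ν.real (Set.Ioc x y) := by
    intro x y hxy
    rw [intervalIntegral.integral_of_le hxy]; simp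
  have hGC : G C = k * a := by
    show ∫ z in (-C)..C, (1 : ℝ) ∂ν = _
    rw [hval _ _ (by linarith), Measure.real, htot]; simp [ha.le]
  have ex : ∀ i : ℕ, ∃ t, (i = 0 → t = -C) ∧ (i = k → t = C) ∧ (i ≤ k → G t = i * a) := by
    intro i
    by_cases h0 : i = 0
    · exact ⟨-C, fun _ => rfl, by omega, fun _ => by rw [hG0, h0]; simp⟩
    by_cases h1 : i = k
    · exact ⟨C, by omega, fun _ => rfl, fun _ => by rw [hGC, h1]⟩
    by_cases h2 : i ≤ k
    · have := intermediate_value_Icc (show -C ≤ C by linarith) hG.continuousOn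
      have hm : (i : ℝ) * a ∈ Set.Icc (G (-C)) (G C) := by
        rw [hG0, hGC]
        exact ⟨by positivity, by gcongr⟩
      obtain ⟨t, -, ht⟩ := this hm
      exact ⟨t, by omega, by omega, fun _ => ht⟩
    · exact ⟨0, by omega, by omega, by omega⟩
  choose t ht0 htk ht using ex
  refine ⟨t, ht0 0 rfl, htk k rfl, ?_⟩
  intro i hi
  have hd : ∫ z in (t i)..(t (i + 1)), (1 : ℝ) ∂ν = a := by
    rw [← intervalIntegral.integral_interval_sub_left (hint (-C) _) (hint (-C) _)]
    show G _ - G _ = _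
    rw [ht _ (by omega), ht _ (by omega)]; push_cast; ring
  have hle : t i ≤ t (i + 1) := by
    by_contra hcon
    push Not at hcon
    rw [intervalIntegral.integral_symm, hval _ _ hcon.le] at hd
    have : 0 ≤ ν.real (Set.Ioc (t (i + 1)) (t i)) := measureReal_nonneg
    linarith
  rw [hval _ _ hle] at hd
  rw [measure_congr Ioo_ae_eq_Ioc, ← hd, ofReal_measureReal]

lemma crude {B : Set E2} (hBo : IsOpen B) {W h a : ℝ} {k : ℕ} (hW : 0 < W) (hh : 0 < h)
    (ha : 0 < a) (hB : ∀ p ∈ B, |p 0| < W ∧ |p 1| < W) (hvol : volume B = k * ENNReal.ofReal a) :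
    ∃ V : Fin k → Set E2, (∀ i, IsOpen (V i)) ∧ (∀ i, V i ⊆ B) ∧
      (∀ i j, i ≠ j → Disjoint (V i) (V j)) ∧ (∀ i, volume (V i) = ENNReal.ofReal a) ∧
      μH[1] (B \ ⋃ i, V i) ≤ ENNReal.ofReal ((2 * W / h + 3) * (2 * W) + (k + 1) * h) := by
  rcases Nat.eq_zero_or_pos k with rfl | hk
  · have : B = ∅ := (hBo.measure_eq_zero_iff volume).1 (by simpa using hvol)
    refine ⟨fun _ => ∅, by simp, by simp, by simp, fun i => i.elim0, ?_⟩
    simp [this]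
  let C := 2 * W * (W / h + 1) + W
  have hC : 0 ≤ C := by positivity
  have hphi : ∀ p ∈ B, -C < phi W h p ∧ phi W h p < C := by
    intro p hp
    have b1 := abs_lt.1 (hB p hp).1
    have b2 := abs_lt.1 (hB p hp).2
    have f1 := Int.floor_le (p 1 / h)
    have f2 := Int.lt_floor_add_one (p 1 / h)
    have g1 : p 1 / h < W / h := by gcongr; exact b2.2
    have g2 : -(W / h) < p 1 / h := by rw [← neg_div]; gcongr; exact b2.1
    simp only [phi, C]
    constructor
    · have : 2 * W * (-(W / h + 1)) < 2 * W * (⌊p 1 / h⌋ : ℝ) := by gcongr; linarith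
      linarith
    · have : 2 * W * (⌊p 1 / h⌋ : ℝ) < 2 * W * (W / h + 1) := by gcongr; linarith
      linarith
  have hfin : volume B ≠ ⊤ := by rw [hvol]; exact ENNReal.mul_ne_top (by simp) (by simp)
  have : IsFiniteMeasure (volume.restrict B) := ⟨by simpa using hfin.lt_top⟩
  let ν : Measure ℝ := Measure.map (phi W h) (volume.restrict B)
  have : NullSingletonClass ν := ⟨fun t => by
    show Measure.map (phi W h) (volume.restrict B) {t} = 0
    rw [Measure.map_apply (phi_meas W h) (measurableSet_singleton t)]
    exact measure_mono_null le_rfl (le_antisymm ((Measure.restrict_apply_le _ _).trans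
      (phi_null W h t).le) bot_le)⟩
  have hν : ∀ S, MeasurableSet S → ν S = volume (B ∩ phi W h ⁻¹' S) := by
    intro S hS
    show Measure.map (phi W h) (volume.restrict B) S = _
    rw [Measure.map_apply (phi_meas W h) hS, Measure.restrict_apply ((phi_meas W h) hS),
      Set.inter_comm]
  have htot : ν (Set.Ioc (-C) C) = k * ENNReal.ofReal a := by
    rw [hν _ measurableSet_Ioc, ← hvol]
    congr 1
    exact Set.inter_eq_left.2 fun p hp => ⟨(hphi p hp).1, (hphi p hp).2.le⟩
  obtain ⟨t, ht0, htk, ht⟩ := exists_cuts ν hC ha hk htot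
  let V : Fin k → Set E2 := fun i => B ∩ ⋃ j : ℤ, {p : E2 | (j * h < p 1 ∧ p 1 < (j + 1) * h) ∧
    (t i < 2 * W * j + p 0 ∧ 2 * W * j + p 0 < t (i + 1))}
  have fl : ∀ (p : E2) (j : ℤ), j * h < p 1 ∧ p 1 < (j + 1) * h → ⌊p 1 / h⌋ = j := by
    rintro p j ⟨h1, h2⟩
    rw [Int.floor_eq_iff]
    exact ⟨(le_div_iff₀ hh).2 h1.le, (div_lt_iff₀ hh).2 h2⟩
  have hVeq : ∀ i, V i = (B ∩ phi W h ⁻¹' (Set.Ioo (t i) (t (i + 1)))) \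
      {p : E2 | ∃ j : ℤ, p 1 = j * h} := by
    intro i
    ext p
    simp only [V, Set.mem_inter_iff, Set.mem_iUnion, Set.mem_sdiff, Set.mem_preimage, Set.mem_Ioo]
    constructor
    · rintro ⟨hp, j, h1, h2⟩
      have hj := fl p j h1
      refine ⟨⟨hp, ?_⟩, ?_⟩
      · simp only [phi, hj]; exact h2
      · rintro ⟨j', hj'⟩
        rw [hj'] at h1
        have h3 := lt_of_mul_lt_mul_right h1.1 hh.le
        have h4 := lt_of_mul_lt_mul_right h1.2 hh.le
        norm_cast at h3 h4
        omega
    · rintro ⟨⟨hp, h1⟩, h2⟩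
      refine ⟨hp, ⌊p 1 / h⌋, ⟨?_, ?_⟩, h1⟩
      · have := (le_div_iff₀ hh).1 (Int.floor_le (p 1 / h))
        refine lt_of_le_of_ne this fun e => h2 ⟨_, e.symm⟩
      · exact (div_lt_iff₀ hh).1 (Int.lt_floor_add_one (p 1 / h))
  refine ⟨V, ?_, fun i => Set.inter_subset_left, ?_, ?_, ?_⟩
  · intro i
    refine hBo.inter (isOpen_iUnion fun j => ?_)
    rw [Set.ofPred_and, Set.ofPred_and, Set.ofPred_and]
    refine ((isOpen_lt ?_ ?_).inter (isOpen_lt ?_ ?_)).inter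
      ((isOpen_lt ?_ ?_).inter (isOpen_lt ?_ ?_)) <;> fun_prop
  · have tmono : ∀ i j, i ≤ j → j ≤ k → t i ≤ t j := by
      intro i j hij
      induction hij with
      | refl => intro _; exact le_rfl
      | @step n hn ih =>
        intro hk'
        refine (ih (by omega)).trans ?_
        by_contra hcon
        have := ht n (by omega)
        rw [Set.Ioo_eq_empty (fun hlt => hcon hlt.le)] at this
        simp at this
        linarith
    have aux : ∀ i j : Fin k, i < j → Disjoint (V i) (V j) := by
      intro i j hij
      rw [Set.disjoint_left, hVeq, hVeq]
      rintro p ⟨⟨-, h1⟩, -⟩ ⟨⟨-, h2⟩, -⟩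
      have := tmono (i + 1) j (by have : i.1 < j.1 := hij; omega) j.2.le
      exact absurd (h1.2.trans_le (this.trans h2.1.le)) (lt_irrefl _)
    intro i j hij
    rcases lt_or_gt_of_ne hij with h | h
    · exact aux i j h
    · exact (aux j i h).symm
  · intro i
    rw [hVeq, measure_sdiff_null (lam_null h), ← hν _ measurableSet_Ioo, ht i i.2]
  · have sub : B \ ⋃ i, V i ⊆ (B ∩ {p : E2 | ∃ j : ℤ, p 1 = j * h}) ∪
        ⋃ i ∈ Finset.range (k + 1), (B ∩ phi W h ⁻¹' {t i}) := by
      rintro p ⟨hp, hpV⟩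
      by_contra hcon
      simp only [Set.mem_union, Set.mem_iUnion, not_or, not_exists, Set.mem_inter_iff, not_and] at hcon
      obtain ⟨hc1, hc2⟩ := hcon
      have hc1 := hc1 hp
      have key : ∀ i, i ≤ k → t i < phi W h p := by
        intro i
        induction i with
        | zero => intro _; rw [ht0]; exact (hphi p hp).1
        | succ i ih =>
          intro hi
          have h1 := ih (by omega)
          by_contra hlt
          have hne : phi W h p ≠ t (i + 1) := fun e =>
            hc2 (i + 1) (Finset.mem_range.2 (by omega)) hp e
          apply hpV
          rw [Set.mem_iUnion]
          refine ⟨⟨i, by omega⟩, ?_⟩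
          rw [hVeq]
          exact ⟨⟨hp, h1, lt_of_le_of_ne (not_lt.1 hlt) hne⟩, hc1⟩
      have := key k le_rfl
      rw [htk] at this
      exact absurd (hphi p hp).2 (not_lt.2 this.le)
    refine (measure_mono sub).trans ((measure_union_le _ _).trans ?_)
    rw [ENNReal.ofReal_add (by positivity) (by positivity)]
    refine add_le_add (lam_meas hW hh hB) ((measure_biUnion_finset_le _ _).trans ?_)
    refine (Finset.sum_le_sum fun i _ => phi_level hh hB).trans ?_
    rw [Finset.sum_const, nsmul_eq_mul, ENNReal.ofReal_mul (by positivity), Finset.card_range,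
      ← ENNReal.ofReal_natCast]
    push_cast
    exact le_rfl
end HC

namespace HC
lemma step {O : Set E2} (hO : IsOpen O) {W h a s : ℝ} {m : ℕ} (hW : 0 < W) (hh : 0 < h)
    (ha : 0 < a) (hs : 0 < s) (has : a = 3 * √3 / 2 * s ^ 2)
    (hB : ∀ p ∈ O, |p 0| < W ∧ |p 1| < W) (hvol : volume O = m * ENNReal.ofReal a) :
    ∃ k : ℕ, k * ENNReal.ofReal a ≤ (volume.restrict O) (Metric.cthickening (4 * s) Oᶜ) ∧
    ∃ U : Fin m → Set E2, (∀ i, IsOpen (U i)) ∧ (∀ i, U i ⊆ O) ∧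
      (∀ i j, i ≠ j → Disjoint (U i) (U j)) ∧ (∀ i, volume (U i) = ENNReal.ofReal a) ∧
      μH[1] (O \ ⋃ i, U i) ≤
        ENNReal.ofReal (3 * s * m + ((2 * W / h + 3) * (2 * W) + (k + 1) * h)) := by
  have ha0 : ENNReal.ofReal a ≠ 0 := by simpa using ha
  have hat : ENNReal.ofReal a ≠ ⊤ := ENNReal.ofReal_ne_top
  have vhex : ∀ v, volume (hex s v) = ENNReal.ofReal a := fun v => by rw [vol_hex hs, has]
  have vchex : ∀ v, volume (chex s v) = ENNReal.ofReal a := fun v => by rw [vol_chex hs, has]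
  have csub : ∀ v, chex s v ⊆ Metric.closedBall (ctr s v) s := fun v p hp => chex_dist hs hp
  let Q : Set (ℤ × ℤ) := {v | Metric.closedBall (ctr s v) s ⊆ O}
  let Q1 : Set (ℤ × ℤ) := {v | Metric.closedBall (ctr s v) (3 * s) ⊆ O}
  have hQ1 : Q1 ⊆ Q := fun v hv => (Metric.closedBall_subset_closedBall (by linarith)).trans hv
  have hexU : ∀ T : Finset (ℤ × ℤ), volume (⋃ v ∈ T, hex s v) = T.card * ENNReal.ofReal a := by
    intro T
    rw [measure_biUnion_finset]
    · simp [vhex]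
    · intro v _ w _ hvw
      exact (hex_disj hvw).mono_right (hex_sub_chex s w)
    · intro v _; exact (hex_open s v).measurableSet
  have chexU : ∀ T : Finset (ℤ × ℤ), volume (⋃ v ∈ T, chex s v) = T.card * ENNReal.ofReal a := by
    intro T
    apply le_antisymm
    · refine (measure_biUnion_finset_le _ _).trans ?_
      simp [vchex]
    · rw [← hexU T]
      exact measure_mono (Set.iUnion₂_mono fun v _ => hex_sub_chex s v)
  have hTO : ∀ T : Finset (ℤ × ℤ), (T : Set (ℤ × ℤ)) ⊆ Q → (⋃ v ∈ T, chex s v) ⊆ O := by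
    intro T hT
    exact Set.iUnion₂_subset fun v hv => (csub v).trans (hT hv)
  have hcard : ∀ T : Finset (ℤ × ℤ), (T : Set (ℤ × ℤ)) ⊆ Q → T.card ≤ m := by
    intro T hT
    have := measure_mono (μ := volume) (hTO T hT)
    rw [chexU, hvol, ENNReal.mul_le_mul_iff_left ha0 hat] at this
    exact_mod_cast this
  have hQf : Q.Finite := by
    by_contra hinf
    obtain ⟨T, hT, hc⟩ := Set.Infinite.exists_subset_card_eq hinf (m + 1)
    have := hcard T hT
    omega
  have hQ1f : Q1.Finite := hQf.subset hQ1
  let F := hQf.toFinset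
  let F1 := hQ1f.toFinset
  have hF : F.card ≤ m := hcard F (by simp [F])
  have hF1 : F1.card ≤ m := hcard F1 (by simpa [F1] using hQ1)
  let k := m - F1.card
  let B := O \ ⋃ v ∈ F1, chex s v
  have hcl : IsClosed (⋃ v ∈ F1, chex s v) :=
    Set.Finite.isClosed_biUnion F1.finite_toSet fun v _ => chex_closed s v
  have hBo : IsOpen B := hO.sdiff hcl
  have hBvol : volume B = k * ENNReal.ofReal a := by
    rw [measure_sdiff (hTO F1 (by simpa [F1] using hQ1)) hcl.measurableSet.nullMeasurableSet,
      chexU, hvol, ← ENNReal.sub_mul (fun _ _ => hat)]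
    · congr 1
      simp [k]
    · rw [chexU]; exact ENNReal.mul_ne_top (by simp) hat
  obtain ⟨V, hV1, hV2, hV3, hV4, hV5⟩ := crude hBo hW hh ha (fun p hp => hB p hp.1) hBvol
  refine ⟨k, ?_, ?_⟩
  · rw [← hBvol, Measure.restrict_apply Metric.isClosed_cthickening.measurableSet]
    apply measure_mono
    rintro p ⟨hp, hp2⟩
    refine ⟨?_, hp⟩
    obtain ⟨v, hv⟩ := ccover s p
    have hvn : v ∉ Q1 := by
      intro hv1
      apply hp2
      simp only [Set.mem_iUnion]
      exact ⟨v, hQ1f.mem_toFinset.2 hv1, hv⟩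
    obtain ⟨q, hq, hqO⟩ := Set.not_subset.1 hvn
    refine Metric.mem_cthickening_of_dist_le p q _ _ hqO ?_
    have h1 := chex_dist hs hv
    have h2 : dist q (ctr s v) ≤ 3 * s := hq
    have := dist_triangle_right p q (ctr s v)
    linarith
  · have hcm : Fintype.card (Fin m) = Fintype.card (F1 ⊕ Fin k) := by
      simp [k]; omega
    let e := Fintype.equivOfCardEq hcm
    let Z : F1 ⊕ Fin k → Set E2 := Sum.elim (fun v => hex s v.1) V
    have hexO : ∀ v : F1, hex s v.1 ⊆ O := fun v =>
      (hex_sub_chex s _).trans ((csub _).trans (hQ1 (hQ1f.mem_toFinset.1 v.2)))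
    have hexB : ∀ (v : F1) i, Disjoint (hex s v.1) (V i) := by
      intro v i
      rw [Set.disjoint_left]
      intro p hp hpV
      apply (hV2 i hpV).2
      simp only [Set.mem_iUnion]
      exact ⟨v.1, v.2, hex_sub_chex _ _ hp⟩
    refine ⟨fun i => Z (e i), ?_, ?_, ?_, ?_, ?_⟩
    · intro i
      beta_reduce
      generalize e i = x
      rcases x with v | j
      · exact hex_open _ _
      · exact hV1 j
    · intro i
      beta_reduce
      generalize e i = x
      rcases x with v | j
      · exact hexO v
      · exact (hV2 j).trans Set.sdiff_subset
    · intro i j hij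
      have hne : e i ≠ e j := fun h => hij (e.injective h)
      show Disjoint (Z (e i)) (Z (e j))
      generalize e i = x at hne
      generalize e j = y at hne
      rcases x with v | i <;> rcases y with w | j
      · refine (hex_disj ?_).mono_right (hex_sub_chex _ _)
        intro h; exact hne (by rw [Subtype.ext h])
      · exact hexB v j
      · exact (hexB w i).symm
      · exact hV3 i j (fun h => hne (by rw [h]))
    · intro i
      beta_reduce
      generalize e i = x
      rcases x with v | j
      · exact vhex _
      · exact hV4 j
    · have sub : O \ ⋃ i, Z (e i) ⊆ (⋃ w ∈ F, edge s w) ∪ (B \ ⋃ i, V i) := by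
        rintro p ⟨hp, hpU⟩
        have hpZ : ∀ x, p ∉ Z x := by
          intro x hx
          apply hpU
          rw [Set.mem_iUnion]
          exact ⟨e.symm x, by simpa using hx⟩
        by_cases hpB : p ∈ ⋃ v ∈ F1, chex s v
        · left
          simp only [Set.mem_iUnion] at hpB
          obtain ⟨v, hv, hpv⟩ := hpB
          obtain ⟨w, hw | hw⟩ := cover s p
          · exfalso
            by_cases hwv : w = v
            · subst hwv
              exact hpZ (Sum.inl ⟨w, hv⟩) hw
            · exact Set.disjoint_left.1 (hex_disj hwv) hw hpv
          · simp only [Set.mem_iUnion]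
            refine ⟨w, ?_, hw⟩
            apply hQf.mem_toFinset.2
            have hv1 : Metric.closedBall (ctr s v) (3 * s) ⊆ O := hQ1f.mem_toFinset.1 hv
            refine Set.Subset.trans (Metric.closedBall_subset_closedBall' ?_) hv1
            have h1 := chex_dist hs hpv
            have h2 := chex_dist hs (edge_sub_chex s w hw)
            have := dist_triangle_left (ctr s w) (ctr s v) p
            linarith
        · right
          refine ⟨⟨hp, hpB⟩, ?_⟩
          intro h
          obtain ⟨i, hi⟩ := Set.mem_iUnion.1 h
          exact hpZ (Sum.inr i) hi
      refine (measure_mono sub).trans ((measure_union_le _ _).trans ?_)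
      rw [ENNReal.ofReal_add (by positivity) (by positivity)]
      refine add_le_add ?_ hV5
      refine (measure_biUnion_finset_le _ _).trans ?_
      refine (Finset.sum_le_sum fun i _ => edge_meas hs i).trans ?_
      rw [Finset.sum_const, nsmul_eq_mul, mul_comm, ENNReal.ofReal_mul (p := 3 * s) (by positivity),
        ENNReal.ofReal_natCast]
      gcongr

theorem division {O : Set E2} (hO : IsOpen O) {W A : ℝ} (hW : 0 < W) (hA : 0 < A)
    (hB : ∀ p ∈ O, |p 0| < W ∧ |p 1| < W) (hvol : volume O = ENNReal.ofReal A)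
    {ε : ℝ} (hε : 0 < ε) : ∃ M : ℕ, 1 ≤ M ∧ ∀ m : ℕ, M ≤ m →
    ∃ U : Fin m → Set E2, (∀ i, IsOpen (U i)) ∧ (∀ i, U i ⊆ O) ∧
      (∀ i j, i ≠ j → Disjoint (U i) (U j)) ∧ (∀ i, volume (U i) = ENNReal.ofReal (A / m)) ∧
      μH[1] (O \ ⋃ i, U i) ≤ ENNReal.ofReal ((√(2 * √3 * A) + ε) * √m) := by
  let K : ℝ := 16 * W ^ 2 / ε
  have hK : 0 < K := by positivity
  let η : ℝ := ε * A / (4 * K)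
  have hη : 0 < η := by positivity
  have : IsFiniteMeasure (volume.restrict O) := ⟨by simp [hvol]⟩
  have lim := tendsto_measure_cthickening_of_isClosed (μ := volume.restrict O) (s := Oᶜ)
    ⟨1, one_pos, measure_ne_top _ _⟩ hO.isClosed_compl
  have hz : (volume.restrict O) Oᶜ = 0 := by
    rw [Measure.restrict_apply hO.measurableSet.compl]; simp
  rw [hz] at lim
  let sf : ℕ → ℝ := fun m => √(2 * (A / m) / (3 * √3))
  have hsf : Filter.Tendsto (fun m => 4 * sf m) Filter.atTop (nhds 0) := by
    have h1 : Filter.Tendsto (fun m : ℕ => A / (m : ℝ)) Filter.atTop (nhds 0) :=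
      tendsto_const_div_atTop_nhds_zero_nat A
    have h2 : Continuous fun x : ℝ => 4 * √(2 * x / (3 * √3)) := by fun_prop
    have h3 := h2.tendsto 0
    have e0 : 4 * √(2 * 0 / (3 * √3)) = 0 := by simp
    rw [e0] at h3
    exact h3.comp h1
  have ev1 : ∀ᶠ m : ℕ in Filter.atTop,
      (volume.restrict O) (Metric.cthickening (4 * sf m) Oᶜ) < ENNReal.ofReal η :=
    (lim.comp hsf).eventually (gt_mem_nhds (by simpa using hη))
  have ev2 : ∀ᶠ m : ℕ in Filter.atTop, (6 * W + K) / (ε / 4) ≤ √(m : ℝ) :=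
    (Real.tendsto_sqrt_atTop.comp tendsto_natCast_atTop_atTop).eventually
      (Filter.eventually_ge_atTop _)
  obtain ⟨M, hM⟩ := Filter.eventually_atTop.1 (ev1.and ev2)
  refine ⟨max M 1, le_max_right _ _, ?_⟩
  intro m hm
  obtain ⟨hm1, hm2⟩ := hM m (le_trans (le_max_left _ _) hm)
  have hm0 : 1 ≤ m := le_trans (le_max_right _ _) hm
  have hmR : (1 : ℝ) ≤ m := by exact_mod_cast hm0
  have hmpos : (0 : ℝ) < m := by linarith
  have hsm : 1 ≤ √(m : ℝ) := Real.one_le_sqrt.2 hmR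
  have hsm0 : 0 < √(m : ℝ) := by linarith
  have hsq : √(m : ℝ) ^ 2 = m := Real.sq_sqrt hmpos.le
  have ha : 0 < A / m := by positivity
  have hs : 0 < sf m := by simp only [sf]; positivity
  have hs2 : sf m ^ 2 = 2 * (A / m) / (3 * √3) := Real.sq_sqrt (by positivity)
  have has : A / m = 3 * √3 / 2 * sf m ^ 2 := by rw [hs2]; field_simp
  have hvol' : volume O = m * ENNReal.ofReal (A / m) := by
    rw [hvol, ← ENNReal.ofReal_natCast, ← ENNReal.ofReal_mul hmpos.le]; congr 1; field_simp
  obtain ⟨k, hk, U, h1, h2, h3, h4, h5⟩ := step (h := K / √m) hO hW (by positivity) ha hs has hB hvol'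
  refine ⟨U, h1, h2, h3, h4, h5.trans (ENNReal.ofReal_le_ofReal ?_)⟩
  have hk' : k * (A / m) ≤ η := by
    have := hk.trans hm1.le
    rw [← ENNReal.ofReal_natCast, ← ENNReal.ofReal_mul (by positivity)] at this
    exact (ENNReal.ofReal_le_ofReal_iff hη.le).1 this
  have main : 3 * sf m * m = √(2 * √3 * A) * √m := by
    rw [← Real.sqrt_mul (by positivity), eq_comm, Real.sqrt_eq_iff_eq_sq (by positivity) (by positivity)]
    have e3 : √3 ^ 2 = 3 := Real.sq_sqrt (by norm_num)
    rw [show (3 * sf m * m) ^ 2 = 9 * sf m ^ 2 * m ^ 2 by ring, hs2]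
    field_simp
    rw [e3]; ring
  rw [main]
  have t1 : 2 * W / (K / √m) * (2 * W) = ε / 4 * √m := by
    simp only [K]; field_simp; ring
  have t2 : k * (K / √m) ≤ ε / 4 * √m := by
    have : (k : ℝ) ≤ η * m / A := by
      rw [le_div_iff₀ hA]
      have := mul_le_mul_of_nonneg_right hk' hmpos.le
      rw [show (k : ℝ) * (A / m) * m = k * A by field_simp] at this
      exact this
    calc k * (K / √m) ≤ η * m / A * (K / √m) := by gcongr
      _ = ε / 4 * √m := by
        simp only [η]
        rw [← hsq]
        field_simp
        simp
  have t3 : K / √m ≤ K := div_le_self hK.le hsm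
  have t4 : 6 * W + K ≤ ε / 4 * √m := by
    rw [div_le_iff₀ (by positivity)] at hm2; linarith
  have : 0 < ε * √m := by positivity
  nlinarith
end HC

namespace HC
noncomputable def vtx (R θ : ℝ) (k : ℕ) : E2 := !₂[R * Real.cos (2 * k * θ), R * Real.sin (2 * k * θ)]
noncomputable def Lk (R θ : ℝ) (k : ℕ) : E2 →ₗ[ℝ] E2 :=
  Matrix.toEuclideanLin !![R * Real.cos (2 * k * θ), R * Real.cos (2 * (k + 1 : ℕ) * θ);
    R * Real.sin (2 * k * θ), R * Real.sin (2 * (k + 1 : ℕ) * θ)]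
def T0 : Set E2 := {p : E2 | 0 < p 0 ∧ 0 < p 1 ∧ p 0 + p 1 < 1}
def C0 : Set E2 := {p : E2 | 0 ≤ p 0 ∧ 0 ≤ p 1 ∧ p 0 + p 1 ≤ 1}
noncomputable def ff (θ : ℝ) (k : ℕ) (p : E2) : ℝ :=
  p 0 * Real.cos ((2 * k + 1) * θ) + p 1 * Real.sin ((2 * k + 1) * θ)

lemma Lk_apply (R θ k) (p : E2) : Lk R θ k p = p 0 • vtx R θ k + p 1 • vtx R θ (k + 1) := by
  ext i
  fin_cases i <;> simp [Lk, vtx, Matrix.toLpLin_apply, dotProduct, Fin.sum_univ_two] <;> ring_nf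

lemma Lk_det (R θ k) : LinearMap.det (Lk R θ k) = R ^ 2 * Real.sin (2 * θ) := by
  rw [Lk, LinearMap.det_toLpLin, Matrix.det_fin_two_of]
  have : (2 * θ) = 2 * (k + 1 : ℕ) * θ - 2 * k * θ := by push_cast; ring
  rw [this, Real.sin_sub]; ring

lemma ff_vtx (R θ : ℝ) (k j : ℕ) : ff θ k (vtx R θ j) = R * Real.cos ((2 * ((j : ℝ) - k) - 1) * θ) := by
  have : (2 * ((j : ℝ) - k) - 1) * θ = 2 * j * θ - (2 * k + 1) * θ := by ring
  rw [this, Real.cos_sub]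
  simp [ff, vtx]; ring

lemma ff_lin (θ : ℝ) (k : ℕ) (x y : ℝ) (p q : E2) : ff θ k (x • p + y • q) = x * ff θ k p + y * ff θ k q := by
  simp [ff]; ring

lemma cos_diff (θ d : ℝ) : Real.cos θ - Real.cos ((2 * d - 1) * θ) =
    2 * Real.sin (d * θ) * Real.sin ((d - 1) * θ) := by
  rw [Real.cos_sub_cos]
  rw [show (θ + (2 * d - 1) * θ) / 2 = d * θ by ring,
    show (θ - (2 * d - 1) * θ) / 2 = -((d - 1) * θ) by ring, Real.sin_neg]; ring

lemma T0_convex : Convex ℝ T0 := by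
  intro p hp q hq a b ha hb hab
  refine ⟨?_, ?_, ?_⟩
  · exact convex_Ioi (0 : ℝ) hp.1 hq.1 ha hb hab
  · exact convex_Ioi (0 : ℝ) hp.2.1 hq.2.1 ha hb hab
  · have := convex_Iio (1 : ℝ) hp.2.2 hq.2.2 ha hb hab
    simp at this ⊢
    linarith

section
variable {n : ℕ} {θ R : ℝ}

lemma sin_nn (hθ : 0 < θ) (hn : n * θ = Real.pi) {x : ℝ} (h0 : 0 ≤ x) (h1 : x ≤ n) :
    0 ≤ Real.sin (x * θ) := by
  apply Real.sin_nonneg_of_nonneg_of_le_pi (by positivity)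
  rw [← hn]; gcongr

lemma sin_pos' (hθ : 0 < θ) (hn : n * θ = Real.pi) {x : ℝ} (h0 : 0 < x) (h1 : x < n) :
    0 < Real.sin (x * θ) := by
  apply Real.sin_pos_of_pos_of_lt_pi (by positivity)
  rw [← hn]; gcongr

lemma ff_vtx_le (hθ : 0 < θ) (hn : n * θ = Real.pi) (hR : 0 < R) {k j : ℕ} (hk : k < n) (hj : j < n) :
    ff θ k (vtx R θ j) ≤ R * Real.cos θ := by
  rw [ff_vtx]
  refine mul_le_mul_of_nonneg_left ?_ hR.le
  rw [← sub_nonneg, cos_diff]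
  have hk' : (k : ℝ) < n := by exact_mod_cast hk
  have hj' : (j : ℝ) < n := by exact_mod_cast hj
  have k0 : (0 : ℝ) ≤ k := by positivity
  have j0 : (0 : ℝ) ≤ j := by positivity
  rcases lt_or_ge k j with h | h
  · have h' : (k : ℝ) + 1 ≤ j := by exact_mod_cast h
    have := sin_nn hθ hn (x := (j : ℝ) - k) (by linarith) (by linarith)
    have := sin_nn hθ hn (x := (j : ℝ) - k - 1) (by linarith) (by linarith)
    positivity
  · have h' : (j : ℝ) ≤ k := by exact_mod_cast h
    have k1 : (k : ℝ) + 1 ≤ n := by exact_mod_cast hk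
    have a1 := sin_nn hθ hn (x := -((j : ℝ) - k)) (by linarith) (by linarith)
    have a2 := sin_nn hθ hn (x := -((j : ℝ) - k - 1)) (by linarith) (by linarith)
    rw [neg_mul, Real.sin_neg] at a1 a2
    nlinarith

lemma pos_aux (hn3 : 3 ≤ n) (hθ : 0 < θ) (hn : n * θ = Real.pi) {d : ℕ} (hd : 1 ≤ d) (hdn : d < n)
    {x y : ℝ} (hx : 0 < x) (hy : 0 < y) :
    0 < Real.sin (d * θ) * (x * Real.sin ((d - 1) * θ) + y * Real.sin ((d + 1) * θ)) := by
  have hd' : (1 : ℝ) ≤ d := by exact_mod_cast hd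
  have hdn' : (d : ℝ) + 1 ≤ n := by exact_mod_cast hdn
  have a0 := sin_pos' hθ hn (x := (d : ℝ)) (by linarith) (by linarith)
  have a1 := sin_nn hθ hn (x := (d : ℝ) - 1) (by linarith) (by linarith)
  have a2 := sin_nn hθ hn (x := (d : ℝ) + 1) (by linarith) (by linarith)
  apply mul_pos a0
  rcases eq_or_lt_of_le hd with h | h
  · have n3 : (3 : ℝ) ≤ n := by exact_mod_cast hn3
    have : (d : ℝ) = 1 := by exact_mod_cast h.symm
    have a3 := sin_pos' hθ hn (x := (d : ℝ) + 1) (by linarith) (by linarith)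
    positivity
  · have h' : (2 : ℝ) ≤ d := by exact_mod_cast h
    have a3 := sin_pos' hθ hn (x := (d : ℝ) - 1) (by linarith) (by linarith)
    positivity

lemma ff_Lk_self (q : E2) (k : ℕ) : ff θ k (Lk R θ k q) = (q 0 + q 1) * (R * Real.cos θ) := by
  rw [Lk_apply, ff_lin, ff_vtx, ff_vtx]
  push_cast
  rw [show (2 * ((k : ℝ) - k) - 1) * θ = -θ by ring,
    show (2 * ((k : ℝ) + 1 - k) - 1) * θ = θ by ring, Real.cos_neg]; ring

lemma ff_diff (q : E2) (k j : ℕ) : ff θ k (Lk R θ k q) - ff θ j (Lk R θ k q) =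
    2 * R * (Real.sin (((k : ℝ) - j) * θ) * (q 0 * Real.sin (((k : ℝ) - j - 1) * θ) +
      q 1 * Real.sin (((k : ℝ) - j + 1) * θ))) := by
  rw [ff_Lk_self, Lk_apply, ff_lin, ff_vtx, ff_vtx]
  have e1 := cos_diff θ ((k : ℝ) - j)
  have e2 := cos_diff θ ((k : ℝ) - j + 1)
  push_cast
  rw [show (2 * ((k : ℝ) + 1 - j) - 1) = (2 * ((k : ℝ) - j + 1) - 1) by ring]
  rw [show (k : ℝ) - j + 1 - 1 = k - j by ring] at e2
  linear_combination q 0 * R * e1 + q 1 * R * e2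

lemma ff_lt (hn3 : 3 ≤ n) (hθ : 0 < θ) (hn : n * θ = Real.pi) (hR : 0 < R) {k j : ℕ}
    (hk : k < n) (hj : j < n) (hkj : k ≠ j) {q : E2} (hq : q ∈ T0) :
    ff θ j (Lk R θ k q) < ff θ k (Lk R θ k q) := by
  rw [← sub_pos, ff_diff]
  apply mul_pos (by linarith)
  rcases lt_or_gt_of_ne hkj with h | h
  · have := pos_aux hn3 hθ hn (d := j - k) (by omega) (by omega) hq.2.1 hq.1
    rw [Nat.cast_sub h.le] at this
    rw [show ((k : ℝ) - j) * θ = -((j - k) * θ) by ring,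
      show ((k : ℝ) - j - 1) * θ = -((j - k + 1) * θ) by ring,
      show ((k : ℝ) - j + 1) * θ = -((j - k - 1) * θ) by ring, Real.sin_neg, Real.sin_neg, Real.sin_neg]
    linarith
  · have := pos_aux hn3 hθ hn (d := k - j) (by omega) (by omega) hq.1 hq.2.1
    rw [Nat.cast_sub h.le] at this
    exact this

lemma tri_disj (hn3 : 3 ≤ n) (hθ : 0 < θ) (hn : n * θ = Real.pi) (hR : 0 < R) {k j : ℕ}
    (hk : k < n) (hj : j < n) (hkj : k ≠ j) : Disjoint (Lk R θ k '' T0) (Lk R θ j '' T0) := by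
  rw [Set.disjoint_left]
  rintro _ ⟨q, hq, rfl⟩ ⟨q', hq', he⟩
  have h1 := ff_lt hn3 hθ hn hR hk hj hkj hq
  have h2 := ff_lt hn3 hθ hn hR hj hk hkj.symm hq'
  rw [he] at h2
  exact lt_asymm h1 h2

lemma polar (p : E2) : ∃ r φ : ℝ, 0 ≤ r ∧ 0 ≤ φ ∧ φ < 2 * Real.pi ∧ p 0 = r * Real.cos φ ∧
    p 1 = r * Real.sin φ := by
  let z : ℂ := ⟨p 0, p 1⟩
  have h1 : ‖z‖ * Real.cos z.arg = p 0 := Complex.norm_mul_cos_arg z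
  have h2 : ‖z‖ * Real.sin z.arg = p 1 := Complex.norm_mul_sin_arg z
  have h3 := Complex.neg_pi_lt_arg z
  have h4 := Complex.arg_le_pi z
  have hp := Real.pi_pos
  rcases le_or_gt 0 z.arg with h | h
  · exact ⟨‖z‖, z.arg, norm_nonneg _, h, by linarith, h1.symm, h2.symm⟩
  · refine ⟨‖z‖, z.arg + 2 * Real.pi, norm_nonneg _, by linarith, by linarith, ?_, ?_⟩
    · rw [Real.cos_add_two_pi, h1]
    · rw [Real.sin_add_two_pi, h2]

lemma cover_tri (hn3 : 3 ≤ n) (hθ : 0 < θ) (hn : n * θ = Real.pi) (hR : 0 < R) (p : E2)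
    (hp : ∀ k < n, ff θ k p ≤ R * Real.cos θ) : ∃ k < n, p ∈ Lk R θ k '' C0 := by
  obtain ⟨r, φ, hr, h0, h1, e0, e1⟩ := polar p
  let k := ⌊φ / (2 * θ)⌋₊
  have k1 : k * (2 * θ) ≤ φ := (le_div_iff₀ (by positivity)).1 (Nat.floor_le (by positivity))
  have k2 : φ < (k + 1) * (2 * θ) := (div_lt_iff₀ (by positivity)).1 (Nat.lt_floor_add_one _)
  have n3 : (3 : ℝ) ≤ n := by exact_mod_cast hn3
  have hk : k < n := by
    have : (k : ℝ) * (2 * θ) < n * (2 * θ) := by nlinarith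
    have := lt_of_mul_lt_mul_right this (by positivity)
    exact_mod_cast this
  have h2 : 0 < Real.sin (2 * θ) := sin_pos' hθ hn (by norm_num) (by linarith)
  have hpi : 2 * θ ≤ Real.pi := by rw [← hn]; gcongr; linarith
  have s1 : 0 ≤ Real.sin ((k + 1) * (2 * θ) - φ) :=
    Real.sin_nonneg_of_nonneg_of_le_pi (by linarith) (by linarith)
  have s2 : 0 ≤ Real.sin (φ - k * (2 * θ)) :=
    Real.sin_nonneg_of_nonneg_of_le_pi (by linarith) (by linarith)
  have hc : 0 < Real.cos θ := by
    have := Real.sin_two_mul θ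
    have s3 := sin_pos' hθ hn (x := 1) (by norm_num) (by linarith)
    rw [one_mul] at s3
    rw [this] at h2
    by_contra hcon
    nlinarith
  let q : E2 := !₂[r / (R * Real.sin (2 * θ)) * Real.sin ((k + 1) * (2 * θ) - φ),
    r / (R * Real.sin (2 * θ)) * Real.sin (φ - k * (2 * θ))]
  have q0 : q 0 = r / (R * Real.sin (2 * θ)) * Real.sin ((k + 1) * (2 * θ) - φ) := rfl
  have q1 : q 1 = r / (R * Real.sin (2 * θ)) * Real.sin (φ - k * (2 * θ)) := rfl
  have hs2 : Real.sin (2 * θ) = Real.sin ((k + 1) * (2 * θ)) * Real.cos (k * (2 * θ)) -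
      Real.cos ((k + 1) * (2 * θ)) * Real.sin (k * (2 * θ)) := by
    rw [← Real.sin_sub]; congr 1; ring
  have hL : Lk R θ k q = p := by
    rw [Lk_apply, q0, q1, Real.sin_sub, Real.sin_sub]
    ext i
    fin_cases i
    · simp only [vtx, PiLp.add_apply, PiLp.smul_apply, smul_eq_mul, Fin.zero_eta]
      simp only [Matrix.cons_val_zero]
      rw [e0, show 2 * (k : ℝ) * θ = k * (2 * θ) by ring,
        show 2 * ((k + 1 : ℕ) : ℝ) * θ = (k + 1) * (2 * θ) by push_cast; ring]
      field_simp
      rw [hs2]; ring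
    · simp only [vtx, PiLp.add_apply, PiLp.smul_apply, smul_eq_mul, Fin.mk_one]
      simp only [Matrix.cons_val_one, Matrix.cons_val_zero]
      rw [e1, show 2 * (k : ℝ) * θ = k * (2 * θ) by ring,
        show 2 * ((k + 1 : ℕ) : ℝ) * θ = (k + 1) * (2 * θ) by push_cast; ring]
      field_simp
      rw [hs2]; ring
  refine ⟨k, hk, q, ⟨?_, ?_, ?_⟩, hL⟩
  · rw [q0]; positivity
  · rw [q1]; positivity
  · have := hp k hk
    rw [← hL, ff_Lk_self] at this
    have hRc : 0 < R * Real.cos θ := by positivity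
    by_contra hcon
    nlinarith

lemma vol_Lk_T (hR : 0 < R) (h2 : 0 < Real.sin (2 * θ)) (k) :
    volume (Lk R θ k '' T0) = ENNReal.ofReal (R ^ 2 * Real.sin (2 * θ) / 2) := by
  rw [Measure.addHaar_image_linearMap, Lk_det, T0, vol_tri_open, ← ENNReal.ofReal_mul (abs_nonneg _),
    abs_of_pos (by positivity)]
  congr 1; ring

lemma vol_Lk_C (hR : 0 < R) (h2 : 0 < Real.sin (2 * θ)) (k) :
    volume (Lk R θ k '' C0) ≤ ENNReal.ofReal (R ^ 2 * Real.sin (2 * θ) / 2) := by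
  rw [Measure.addHaar_image_linearMap, Lk_det, C0]
  refine (mul_le_mul_right vol_tri_closed _).trans ?_
  rw [← ENNReal.ofReal_mul (abs_nonneg _), abs_of_pos (by positivity)]
  apply ENNReal.ofReal_le_ofReal
  linarith

lemma zero_mem (hn3 : 3 ≤ n) (hn : n * θ = Real.pi) :
    (0 : E2) ∈ convexHull ℝ (Set.range fun k : Fin n => vtx R θ k) := by
  have hn0 : (n : ℝ) ≠ 0 := by positivity
  have hprim := Complex.isPrimitiveRoot_exp n (by omega)
  have hsum := hprim.geom_sum_eq_zero (by omega)
  have hz : ∀ k : ℕ, Complex.exp (2 * Real.pi * Complex.I / n) ^ k =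
      (Real.cos (2 * k * θ) : ℂ) + (Real.sin (2 * k * θ) : ℂ) * Complex.I := by
    intro k
    rw [← Complex.exp_nat_mul, Complex.ofReal_cos, Complex.ofReal_sin, ← Complex.exp_mul_I]
    congr 1
    rw [← hn]; push_cast
    have : (n : ℂ) ≠ 0 := by exact_mod_cast hn0
    field_simp
  simp_rw [hz] at hsum
  have hc : ∑ k ∈ Finset.range n, Real.cos (2 * k * θ) = 0 := by
    have := congrArg Complex.re hsum
    simpa [-Complex.ofReal_cos, -Complex.ofReal_sin] using this
  have hsn : ∑ k ∈ Finset.range n, Real.sin (2 * k * θ) = 0 := by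
    have := congrArg Complex.im hsum
    simpa [-Complex.ofReal_cos, -Complex.ofReal_sin] using this
  have key : ∑ k : Fin n, (1 / n : ℝ) • vtx R θ k = 0 := by
    rw [← Finset.smul_sum]
    have : ∑ k : Fin n, vtx R θ k = 0 := by
      rw [Fin.sum_univ_eq_sum_range (fun k => vtx R θ k)]
      ext i
      fin_cases i
      · simp [vtx, ← Finset.mul_sum, hc]
      · simp [vtx, ← Finset.mul_sum, hsn]
    rw [this, smul_zero]
  rw [← key]
  apply (convex_convexHull ℝ _).sum_mem
  · intro i _; positivity
  · simp [hn0]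
  · intro i _; exact subset_convexHull ℝ _ ⟨i, rfl⟩

lemma vol_poly (hn3 : 3 ≤ n) (hθ : 0 < θ) (hn : n * θ = Real.pi) (hR : 0 < R) :
    volume (convexHull ℝ (Set.range fun k : Fin n => vtx R θ k)) =
      n * ENNReal.ofReal (R ^ 2 * Real.sin (2 * θ) / 2) := by
  have n3 : (3 : ℝ) ≤ n := by exact_mod_cast hn3
  have h2 : 0 < Real.sin (2 * θ) := sin_pos' hθ hn (by norm_num) (by linarith)
  set P := convexHull ℝ (Set.range fun k : Fin n => vtx R θ k) with hP
  have hv : ∀ k < n, vtx R θ k ∈ P := fun k hk => subset_convexHull ℝ _ ⟨⟨k, hk⟩, rfl⟩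
  have hvn : vtx R θ n = vtx R θ 0 := by
    simp only [vtx]
    rw [mul_assoc, hn]; simp
  have hv' : ∀ k < n, vtx R θ (k + 1) ∈ P := by
    intro k hk
    rcases Nat.lt_or_ge (k + 1) n with h | h
    · exact hv _ h
    · rw [show k + 1 = n by omega, hvn]; exact hv 0 (by omega)
  have hcv : Convex ℝ P := convex_convexHull ℝ _
  apply le_antisymm
  · have sub : P ⊆ ⋃ k ∈ Finset.range n, Lk R θ k '' C0 := by
      intro p hp
      have : ∀ k < n, ff θ k p ≤ R * Real.cos θ := by
        intro k hk
        have hc : Convex ℝ {p : E2 | ff θ k p ≤ R * Real.cos θ} := by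
          intro p hp q hq a b ha hb hab
          show ff θ k _ ≤ _
          rw [ff_lin]
          exact convex_Iic (R * Real.cos θ) hp hq ha hb hab
        refine convexHull_min ?_ hc hp
        rintro _ ⟨j, rfl⟩
        exact ff_vtx_le hθ hn hR hk j.2
      obtain ⟨k, hk, h⟩ := cover_tri hn3 hθ hn hR p this
      simp only [Set.mem_iUnion]
      exact ⟨k, Finset.mem_range.2 hk, h⟩
    refine (measure_mono sub).trans ((measure_biUnion_finset_le _ _).trans ?_)
    refine (Finset.sum_le_sum fun k _ => vol_Lk_C hR h2 k).trans ?_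
    simp
  · have sub : (⋃ k ∈ Finset.range n, Lk R θ k '' T0) ⊆ P := by
      refine Set.iUnion₂_subset fun k hk => ?_
      rw [Finset.mem_range] at hk
      rintro _ ⟨q, hq, rfl⟩
      rw [Lk_apply]
      have h0 : (0 : E2) ∈ P := zero_mem hn3 hn
      have hq1 : 0 < q 0 + q 1 := add_pos hq.1 hq.2.1
      have hm := hcv (hv k hk) (hv' k hk) (a := q 0 / (q 0 + q 1)) (b := q 1 / (q 0 + q 1))
        (div_nonneg hq.1.le hq1.le) (div_nonneg hq.2.1.le hq1.le) (by field_simp)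
      have hm2 := hcv h0 hm (a := 1 - (q 0 + q 1)) (b := q 0 + q 1) (by linarith [hq.2.2]) hq1.le
        (by ring)
      rw [smul_zero, zero_add, smul_add, smul_smul, smul_smul, mul_div_cancel₀ _ hq1.ne',
        mul_div_cancel₀ _ hq1.ne'] at hm2
      exact hm2
    refine le_trans ?_ (measure_mono sub)
    rw [measure_biUnion_finset₀]
    · simp [vol_Lk_T hR h2]
    · intro k hk j hj hkj
      exact (tri_disj hn3 hθ hn hR (Finset.mem_range.1 hk) (Finset.mem_range.1 hj) hkj).aedisjoint
    · intro k _
      exact (T0_convex.linear_image (Lk R θ k)).nullMeasurableSet volume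
end
end HC

/-- **Theorem 4.3.** `limsup_{m→∞} l_{m,n}/√m ≤ √((√3/2)·n·cot(π/n))`: for every `ε > 0` and
all sufficiently large `m` there is an `m`-part equal-area division of the unit-side regular
`n`-gon with dividing length at most `(√((√3/2)·n·cot(π/n)) + ε)·√m`; in particular the
limit superior of `l(m)/√m` is at most `√((√3/2)·n·cot(π/n))`. -/
theorem stmt_13 (n : ℕ) (hn : 3 ≤ n)
    (R : ℝ) (hR : R = 1 / (2 * Real.sin (Real.pi / n)))
    (An : Set (EuclideanSpace ℝ (Fin 2)))
    (hAn : An = convexHull ℝ (Set.range fun k : Fin n =>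
      (WithLp.equiv 2 (Fin 2 → ℝ)).symm
        ![R * Real.cos (2 * Real.pi * k / n), R * Real.sin (2 * Real.pi * k / n)]))
    (l : ℕ → ℝ)
    (hl : ∀ m : ℕ, 1 ≤ m → l m =
      sInf { L : ℝ | ∃ U : Fin m → Set (EuclideanSpace ℝ (Fin 2)),
        (∀ i j, i ≠ j → Disjoint (U i) (U j)) ∧
        (∀ i, ∃ V : Set (EuclideanSpace ℝ (Fin 2)), IsOpen V ∧ U i = V ∩ An) ∧
        (∀ i, volume (U i) = ENNReal.ofReal ((n / (4 * m)) * Real.cot (Real.pi / n))) ∧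
        0 ≤ L ∧
        μH[1] ((An \ ⋃ i, U i) ∩ interior An) = ENNReal.ofReal L }) :
    (∀ ε : ℝ, 0 < ε → ∃ M : ℕ, ∀ m : ℕ, M ≤ m →
      ∃ U : Fin m → Set (EuclideanSpace ℝ (Fin 2)),
        (∀ i j, i ≠ j → Disjoint (U i) (U j)) ∧
        (∀ i, ∃ V : Set (EuclideanSpace ℝ (Fin 2)), IsOpen V ∧ U i = V ∩ An) ∧
        (∀ i, volume (U i) = ENNReal.ofReal ((n / (4 * m)) * Real.cot (Real.pi / n))) ∧
        μH[1] ((An \ ⋃ i, U i) ∩ interior An) ≤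
          ENNReal.ofReal
            ((Real.sqrt ((Real.sqrt 3 / 2) * n * Real.cot (Real.pi / n)) + ε) *
              Real.sqrt m)) ∧
    Filter.limsup (fun m : ℕ => l m / Real.sqrt m) Filter.atTop ≤
      Real.sqrt ((Real.sqrt 3 / 2) * n * Real.cot (Real.pi / n)) := by
  have hn0 : (0 : ℝ) < n := by exact_mod_cast (by omega : 0 < n)
  have hn3 : (3 : ℝ) ≤ n := by exact_mod_cast hn
  have hθ : 0 < Real.pi / n := div_pos Real.pi_pos hn0
  have hnθ : n * (Real.pi / n) = Real.pi := by field_simp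
  have hsin : 0 < Real.sin (Real.pi / n) := by
    have := HC.sin_pos' hθ hnθ (x := 1) one_pos (by linarith)
    rwa [one_mul] at this
  have hR0 : 0 < R := by rw [hR]; positivity
  have hcos : 0 < Real.cos (Real.pi / n) := by
    have h2 := HC.sin_pos' hθ hnθ (x := 2) two_pos (by linarith)
    rw [Real.sin_two_mul] at h2
    by_contra hcon
    nlinarith
  have hAn' : An = convexHull ℝ (Set.range fun k : Fin n => HC.vtx R (Real.pi / n) k) := by
    rw [hAn]
    congr 2
    funext k
    have : 2 * Real.pi * (k : ℝ) / n = 2 * k * (Real.pi / n) := by ring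
    simp only [HC.vtx, this]
    rfl
  have hcv : Convex ℝ An := by rw [hAn]; exact convex_convexHull ℝ _
  set A : ℝ := n / 4 * Real.cot (Real.pi / n) with hA
  have hcot : 0 < Real.cot (Real.pi / n) := by rw [Real.cot_eq_cos_div_sin]; positivity
  have hA0 : 0 < A := by positivity
  have hvol : volume An = ENNReal.ofReal A := by
    rw [hAn', HC.vol_poly hn hθ hnθ hR0, ← ENNReal.ofReal_natCast, ← ENNReal.ofReal_mul hn0.le]
    congr 1
    rw [hA, Real.cot_eq_cos_div_sin, Real.sin_two_mul, hR]
    field_simp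
    norm_num
  have hvolO : volume (interior An) = ENNReal.ofReal A := by
    rw [← hvol]
    exact measure_congr (interior_ae_eq_of_null_frontier (hcv.addHaar_frontier volume))
  have hbd : Bornology.IsBounded An := by
    rw [hAn]
    exact (isBounded_convexHull).2 (Set.finite_range _).isBounded
  obtain ⟨r, hr⟩ := hbd.exists_norm_le
  have hW : ∀ p ∈ interior An, |p 0| < |r| + 1 ∧ |p 1| < |r| + 1 := by
    intro p hp
    have h1 := hr p (interior_subset hp)
    have h2 : ∀ i, |p i| ≤ ‖p‖ := fun i => by
      have := PiLp.norm_apply_le p i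
      rwa [Real.norm_eq_abs] at this
    have := le_abs_self r
    exact ⟨by linarith [h2 0], by linarith [h2 1]⟩
  have hconst : 2 * √3 * A = √3 / 2 * n * Real.cot (Real.pi / n) := by rw [hA]; ring
  have main : ∀ ε : ℝ, 0 < ε → ∃ M : ℕ, 1 ≤ M ∧ ∀ m : ℕ, M ≤ m →
      ∃ U : Fin m → Set (EuclideanSpace ℝ (Fin 2)),
        (∀ i j, i ≠ j → Disjoint (U i) (U j)) ∧
        (∀ i, ∃ V : Set (EuclideanSpace ℝ (Fin 2)), IsOpen V ∧ U i = V ∩ An) ∧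
        (∀ i, volume (U i) = ENNReal.ofReal ((n / (4 * m)) * Real.cot (Real.pi / n))) ∧
        μH[1] ((An \ ⋃ i, U i) ∩ interior An) ≤
          ENNReal.ofReal
            ((Real.sqrt ((Real.sqrt 3 / 2) * n * Real.cot (Real.pi / n)) + ε) *
              Real.sqrt m) := by
    intro ε hε
    obtain ⟨M, hM1, hM⟩ := HC.division isOpen_interior (by positivity) hA0 hW hvolO hε
    refine ⟨M, hM1, fun m hm => ?_⟩
    obtain ⟨U, h1, h2, h3, h4, h5⟩ := hM m hm
    refine ⟨U, h3, fun i => ⟨U i, h1 i, ?_⟩, fun i => ?_, ?_⟩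
    · exact (Set.inter_eq_left.2 ((h2 i).trans interior_subset)).symm
    · rw [h4 i]; congr 1; rw [hA]
      have : (m : ℝ) ≠ 0 := by
        have : 1 ≤ m := hM1.trans hm
        positivity
      field_simp
    · rw [← hconst]
      refine (measure_mono ?_).trans h5
      rintro p ⟨⟨-, hp⟩, hp2⟩
      exact ⟨hp2, hp⟩
  refine ⟨fun ε hε => ?_, ?_⟩
  · obtain ⟨M, -, hM⟩ := main ε hε
    exact ⟨M, hM⟩
  · apply le_of_forall_pos_le_add
    intro ε hε
    obtain ⟨M, hM1, hM⟩ := main ε hε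
    have hl0 : ∀ m, 1 ≤ m → 0 ≤ l m := by
      intro m hm
      rw [hl m hm]
      apply Real.sInf_nonneg
      rintro L ⟨U, -, -, -, hL, -⟩
      exact hL
    refine Filter.limsup_le_of_le ?_ ?_
    · refine Filter.IsBoundedUnder.isCoboundedUnder_le ⟨0, ?_⟩
      rw [Filter.eventually_map]
      filter_upwards [Filter.eventually_ge_atTop 1] with m hm
      exact div_nonneg (hl0 m hm) (Real.sqrt_nonneg _)
    · filter_upwards [Filter.eventually_ge_atTop M] with m hm
      have hm1 : 1 ≤ m := hM1.trans hm
      have hm0 : (0 : ℝ) < m := by exact_mod_cast hm1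
      rw [div_le_iff₀ (Real.sqrt_pos.2 hm0), hl m hm1]
      obtain ⟨U, h1, h2, h3, h4⟩ := hM m hm
      have hfin := ne_top_of_le_ne_top ENNReal.ofReal_ne_top h4
      refine le_trans (csInf_le (a := (μH[1] ((An \ ⋃ i, U i) ∩ interior An)).toReal) ⟨0, ?_⟩ ?_) ?_
      · rintro L ⟨U, -, -, -, hL, -⟩
        exact hL
      · exact ⟨U, h1, h2, h3, ENNReal.toReal_nonneg, (ENNReal.ofReal_toReal hfin).symm⟩
      · exact ENNReal.toReal_le_of_le_ofReal (by positivity) h4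
end
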